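/- Let K be a number field with ring of integers 𝓞_K, let r₁ and r₂ be the numbers of real and complex places of K, let h = |Cl(𝓞_K)| be the (finite) order of the class group of 𝓞_K, and for n ≥ 2 set d = r₁·(n(n+1)/2 − 1) + r₂·(n² − 1) − (n − 1). Then the ℚ-vector space H^d(SL_n(𝓞_K); ℚ) has dimension at least (h − 1)^{n−1}; in particular, if 𝓞_K is not a principal ideal domain then H^d(SL_n(𝓞_K); ℚ) ≠ 0. (Church–Farb–Putman) -/

import Mathlib

set_option linter.unusedSectionVars false

namespace ChurchFarbPutman

section ListCochains

variable {S S' M M' : Type*} [AddCommGroup M] [AddCommGroup M']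

/-- The simplicial coboundary of a function on finite sequences (augmented complex). -/
def cobd : (List S → M) → List S → M
  | _, [] => 0
  | f, s :: l => f l - cobd (fun l' => f (s :: l')) l

@[simp] lemma cobd_nil (f : List S → M) : cobd f [] = 0 := by simp [cobd]

lemma cobd_cons (f : List S → M) (s : S) (l : List S) :
    cobd f (s :: l) = f l - cobd (fun l' => f (s :: l')) l := by simp [cobd]

lemma cobd_map (φ : M →+ M') (f : List S → M) (l : List S) :
    cobd (fun l => φ (f l)) l = φ (cobd f l) := by
  induction l generalizing f with
  | nil => simp
  | cons s l ih => simp only [cobd_cons, map_sub, ih]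

lemma cobd_add (f g : List S → M) : cobd (f + g) = cobd f + cobd g := by
  funext l
  induction l generalizing f g with
  | nil => simp
  | cons s l ih =>
    have := ih (fun l' => f (s :: l')) (fun l' => g (s :: l'))
    simp only [cobd_cons, Pi.add_apply] at this ⊢
    rw [show (fun l' => f (s :: l') + g (s :: l')) =
      (fun l' => f (s :: l')) + (fun l' => g (s :: l')) from rfl, this]
    abel

/-- The coboundary as an additive map. -/
def cobdHom : (List S → M) →+ (List S → M) := AddMonoidHom.mk' cobd cobd_add

lemma cobd_sub (f g : List S → M) : cobd (f - g) = cobd f - cobd g := map_sub cobdHom f g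
lemma cobd_neg (f : List S → M) : cobd (-f) = -cobd f := map_neg cobdHom f
lemma cobd_zero : cobd (0 : List S → M) = 0 := map_zero cobdHom
lemma cobd_zsmul (n : ℤ) (f : List S → M) : cobd (n • f) = n • cobd f := map_zsmul cobdHom n f
lemma cobd_sum {ι : Type*} (s : Finset ι) (f : ι → List S → M) :
    cobd (∑ i ∈ s, f i) = ∑ i ∈ s, cobd (f i) := map_sum cobdHom f s

lemma cobd_smul {R : Type*} [CommRing R] [Module R M] (r : R) (f : List S → M) :
    cobd (r • f) = r • cobd f := by
  funext l
  exact cobd_map (DistribSMul.toAddMonoidHom M r) f l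

lemma cobd_cobd (f : List S → M) : cobd (cobd f) = 0 := by
  funext l
  induction l generalizing f with
  | nil => simp
  | cons s l ih =>
    have h : (fun l' => cobd f (s :: l')) = f - cobd (fun l' => f (s :: l')) := by
      funext l'; simp [cobd_cons]
    rw [cobd_cons, h, cobd_sub]
    have := ih (fun l' => f (s :: l'))
    simp only [Pi.sub_apply, this, Pi.zero_apply]
    abel

lemma cobd_comp (u : S → S') (f : List S' → M) (l : List S) :
    cobd (fun l => f (l.map u)) l = cobd f (l.map u) := by
  induction l generalizing f with
  | nil => simp
  | cons s l ih => simp only [cobd_cons, List.map_cons, ih (fun l' => f (u s :: l'))]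

lemma cobd_finsum {ι : Type*} (f : ι → List S → M)
    (hf : ∀ l, (Function.support fun i => f i l).Finite) (l : List S) :
    (Function.support fun i => cobd (f i) l).Finite ∧
      cobd (fun l => ∑ᶠ i, f i l) l = ∑ᶠ i, cobd (f i) l := by
  induction l generalizing f with
  | nil => simp
  | cons s l ih =>
    obtain ⟨h1, h2⟩ := ih (fun i l' => f i (s :: l')) (fun l => hf _)
    simp only [cobd_cons]
    refine ⟨((hf l).union h1).subset (Function.support_sub _ _), ?_⟩
    rw [finsum_sub_distrib (hf l) h1, h2]

/-- Multiplication by a function of the first vertex. -/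
def hmul (H : S → ℤ) (ψ : List S → M) : List S → M
  | [] => 0
  | s :: l => H s • ψ (s :: l)

/-- Cup product (on the left) with the coboundary of `H`. -/
def cupd (H : S → ℤ) (ψ : List S → M) : List S → M
  | [] => 0
  | [_] => 0
  | s₀ :: s₁ :: l => (H s₁ - H s₀) • ψ (s₁ :: l)

@[simp] lemma hmul_nil (H : S → ℤ) (ψ : List S → M) : hmul H ψ [] = 0 := rfl
@[simp] lemma cupd_nil (H : S → ℤ) (ψ : List S → M) : cupd H ψ [] = 0 := rfl
lemma hmul_cons (H : S → ℤ) (ψ : List S → M) (s l) : hmul H ψ (s :: l) = H s • ψ (s :: l) := rfl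
@[simp] lemma cupd_singleton (H : S → ℤ) (ψ : List S → M) (s) : cupd H ψ [s] = 0 := rfl
lemma cupd_cons_cons (H : S → ℤ) (ψ : List S → M) (s₀ s₁ l) :
    cupd H ψ (s₀ :: s₁ :: l) = (H s₁ - H s₀) • ψ (s₁ :: l) := rfl

lemma cobd_hmul (H : S → ℤ) (ψ : List S → M) (h0 : ψ [] = 0) :
    cobd (hmul H ψ) = cupd H ψ + hmul H (cobd ψ) := by
  funext l
  rcases l with _ | ⟨s, l⟩
  · simp
  · have : (fun l' => hmul H ψ (s :: l')) = H s • (fun l' => ψ (s :: l')) := rfl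
    rw [cobd_cons, this, cobd_zsmul, Pi.add_apply, hmul_cons, cobd_cons]
    rcases l with _ | ⟨s₁, l⟩
    · simp [h0]
    · simp only [hmul_cons, cupd_cons_cons, Pi.smul_apply]
      module

lemma cobd_cupd (H : S → ℤ) (ψ : List S → M) (h0 : ψ [] = 0) :
    cobd (cupd H ψ) = - cupd H (cobd ψ) := by
  have h1 := cobd_hmul H ψ h0
  have h2 := cobd_hmul H (cobd ψ) (cobd_nil _)
  have h3 := cobd_cobd (hmul H ψ)
  have h4 : hmul H (0 : List S → M) = 0 := by
    funext l; rcases l with _ | ⟨s, l⟩ <;> simp [hmul_cons]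
  rw [h1, cobd_add, h2, cobd_cobd, h4, add_zero] at h3
  exact eq_neg_of_add_eq_zero_left h3

lemma cupd_add (H : S → ℤ) (f g : List S → M) : cupd H (f + g) = cupd H f + cupd H g := by
  funext l
  rcases l with _ | ⟨s, _ | ⟨s₁, l⟩⟩ <;> simp [cupd_cons_cons]

lemma cupd_zsmul (H : S → ℤ) (n : ℤ) (f : List S → M) : cupd H (n • f) = n • cupd H f := by
  funext l
  rcases l with _ | ⟨s, _ | ⟨s₁, l⟩⟩ <;> simp [cupd_cons_cons, smul_comm n]

lemma cupd_comp (u : S → S') (H : S' → ℤ) (f : List S' → M) (l : List S) :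
    cupd H f (l.map u) = cupd (fun s => H (u s)) (fun l => f (l.map u)) l := by
  rcases l with _ | ⟨s, _ | ⟨s₁, l⟩⟩ <;> simp [cupd_cons_cons]

lemma cupd_sub_left (H H' : S → ℤ) (f : List S → M) :
    cupd H f - cupd H' f = cupd (H - H') f := by
  funext l
  rcases l with _ | ⟨s, _ | ⟨s₁, l⟩⟩ <;> simp [cupd_cons_cons]
  module

lemma cupd_mul_left (c : ℤ) (H : S → ℤ) (f : List S → M) :
    cupd (fun s => c * H s) f = c • cupd H f := by
  funext l
  rcases l with _ | ⟨s, _ | ⟨s₁, l⟩⟩ <;> simp [cupd_cons_cons]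
  module

lemma exists_ne_of_cupd_ne_zero {H : S → ℤ} {f : List S → M} {l : List S} (h : cupd H f l ≠ 0) :
    (∃ s ∈ l, ∃ s' ∈ l, H s ≠ H s') ∧ ∃ s l', l = s :: l' ∧ f l' ≠ 0 := by
  rcases l with _ | ⟨s, _ | ⟨s₁, l⟩⟩
  · simp at h
  · simp at h
  · rw [cupd_cons_cons] at h
    refine ⟨⟨s₁, by simp, s, by simp, fun h' => h (by simp [h'])⟩, s, _, rfl,
      fun h' => h (by simp [h'])⟩

/-- Homogeneous functions supported on nonempty sequences of length `n`. -/
def Coch (n : ℕ) (f : List S → M) : Prop := ∀ l, f l ≠ 0 → l.length = n ∧ l ≠ []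

lemma Coch.nil {n : ℕ} {f : List S → M} (h : Coch n f) : f [] = 0 := by
  by_contra h'; exact (h _ h').2 rfl

lemma Coch.add {n : ℕ} {f g : List S → M} (hf : Coch n f) (hg : Coch n g) : Coch n (f + g) := by
  intro l h
  by_cases h' : f l = 0
  · exact hg l (by simpa [h'] using h)
  · exact hf l h'

lemma Coch.map {n : ℕ} {f : List S → M} (hf : Coch n f) (φ : M →+ M') :
    Coch n (fun l => φ (f l)) := fun l h => hf l (fun h' => h (by simp [h']))

lemma Coch.neg {n : ℕ} {f : List S → M} (hf : Coch n f) : Coch n (-f) :=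
  hf.map (-AddMonoidHom.id M)

lemma Coch.sub {n : ℕ} {f g : List S → M} (hf : Coch n f) (hg : Coch n g) : Coch n (f - g) := by
  rw [sub_eq_add_neg]; exact hf.add hg.neg

lemma Coch.zsmul {n : ℕ} {f : List S → M} (hf : Coch n f) (k : ℤ) : Coch n (k • f) :=
  hf.map (zsmulAddGroupHom k)

lemma Coch.zero {n : ℕ} : Coch n (0 : List S → M) := fun _ h => absurd rfl h

lemma Coch.cobd {n : ℕ} {f : List S → M} (hf : Coch n f) : Coch (n + 1) (cobd f) := by
  have key : ∀ (l : List S) (n : ℕ) (f : List S → M), (∀ l, f l ≠ 0 → l.length = n) →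
      ChurchFarbPutman.cobd f l ≠ 0 → l.length = n + 1 := by
    intro l
    induction l with
    | nil => intro n f _ h; simp at h
    | cons s l ih =>
      intro n f hf h
      rw [cobd_cons] at h
      by_cases h1 : f l = 0
      · rw [h1, zero_sub, neg_ne_zero] at h
        have h2 : l ≠ [] := by rintro rfl; simp at h
        rcases n with _ | n
        · exfalso
          have : (fun l' => f (s :: l')) = 0 := by
            funext l'; by_contra h'; simpa using hf _ h'
          rw [this, cobd_zero] at h
          exact h rfl
        · have := ih n (fun l' => f (s :: l')) (fun l' h' => by simpa using hf _ h') h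
          simp [this]
      · simp [hf l h1]
  intro l h
  exact ⟨key l n f (fun l h => (hf l h).1) h, by rintro rfl; simp at h⟩

lemma Coch.cupd {n : ℕ} {f : List S → M} (hf : Coch n f) (H : S → ℤ) : Coch (n + 1) (cupd H f) := by
  intro l h
  obtain ⟨_, s, l', rfl, h'⟩ := exists_ne_of_cupd_ne_zero h
  simp [(hf _ h').1]

lemma Coch.hmul {n : ℕ} {f : List S → M} (hf : Coch n f) (H : S → ℤ) : Coch n (hmul H f) := by
  intro l h
  rcases l with _ | ⟨s, l⟩
  · simp at h
  · exact hf _ (fun h' => h (by simp [hmul_cons, h']))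

lemma Coch.comp {n : ℕ} {f : List S' → M} (hf : Coch n f) (u : S → S') :
    Coch n (fun l => f (l.map u)) := fun l h => by simpa using hf _ h

lemma Coch.finsum {ι : Type*} {n : ℕ} {f : ι → List S → M} (hf : ∀ i, Coch n (f i)) :
    Coch n (fun l => ∑ᶠ i, f i l) := by
  intro l h
  obtain ⟨i, hi⟩ : ∃ i, f i l ≠ 0 := by
    by_contra! h'
    exact h (by simp [h'])
  exact hf i l hi

/-- The augmentation cochain. -/
def unitCochain : List S → ℤ := fun l => if l.length = 1 then 1 else 0

lemma coch_unitCochain : Coch 1 (unitCochain : List S → ℤ) := by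
  intro l h
  have : l.length = 1 := by by_contra h'; simp [unitCochain, h'] at h
  exact ⟨this, by rintro rfl; simp at this⟩

lemma cobd_indicator_nil :
    cobd (fun l : List S => if l.length = 0 then (1 : ℤ) else 0) = unitCochain := by
  funext l
  rcases l with _ | ⟨s, l⟩
  · simp [unitCochain]
  · rw [cobd_cons]
    have : (fun l' => if (s :: l').length = 0 then (1 : ℤ) else 0) = 0 := by funext; simp
    rw [this, cobd_zero]
    simp [unitCochain]

lemma cobd_unitCochain : cobd (unitCochain : List S → ℤ) = 0 := by
  rw [← cobd_indicator_nil, cobd_cobd]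

/-- Iterated cup product. -/
def cupds (Hs : List (S → ℤ)) (ψ : List S → M) : List S → M := Hs.foldr cupd ψ

@[simp] lemma cupds_nil (ψ : List S → M) : cupds [] ψ = ψ := rfl
@[simp] lemma cupds_cons (H : S → ℤ) (Hs) (ψ : List S → M) :
    cupds (H :: Hs) ψ = cupd H (cupds Hs ψ) := rfl
lemma cupds_append (Hs Hs') (ψ : List S → M) :
    cupds (Hs ++ Hs') ψ = cupds Hs (cupds Hs' ψ) := by simp [cupds]

lemma Coch.cupds {n : ℕ} {f : List S → M} (hf : Coch n f) (Hs : List (S → ℤ)) :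
    Coch (Hs.length + n) (cupds Hs f) := by
  induction Hs with
  | nil => simpa
  | cons H Hs ih => simpa [add_right_comm] using ih.cupd H

lemma exists_ne_of_cupds_ne_zero {Hs : List (S → ℤ)} {f : List S → M} {l : List S}
    (h : cupds Hs f l ≠ 0) : ∀ H ∈ Hs, ∃ s ∈ l, ∃ s' ∈ l, H s ≠ H s' := by
  induction Hs generalizing l with
  | nil => simp
  | cons H Hs ih =>
    intro H' hH'
    obtain ⟨h1, s, l', rfl, h'⟩ := exists_ne_of_cupd_ne_zero h
    rcases List.mem_cons.1 hH' with rfl | hH'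
    · exact h1
    · obtain ⟨a, ha, b, hb, hab⟩ := ih h' H' hH'
      exact ⟨a, by simp [ha], b, by simp [hb], hab⟩

lemma exists_suffix_of_cupds_ne_zero {Hs : List (S → ℤ)} {f : List S → M} {l : List S}
    (h : cupds Hs f l ≠ 0) : ∃ l', l' <:+ l ∧ f l' ≠ 0 := by
  induction Hs generalizing l with
  | nil => exact ⟨l, List.suffix_refl l, h⟩
  | cons H Hs ih =>
    obtain ⟨h1, s, l', rfl, h'⟩ := exists_ne_of_cupd_ne_zero h
    obtain ⟨l'', h2, h3⟩ := ih h'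
    exact ⟨l'', h2.trans (List.suffix_cons _ _), h3⟩

lemma cupds_nil_eq {Hs : List (S → ℤ)} {f : List S → M} (h : f [] = 0) : cupds Hs f [] = 0 := by
  cases Hs <;> simp [h]

lemma cobd_cupds (Hs : List (S → ℤ)) (f : List S → M) (h0 : f [] = 0) :
    cobd (cupds Hs f) = (-1 : ℤ) ^ Hs.length • cupds Hs (cobd f) := by
  induction Hs with
  | nil => simp
  | cons H Hs ih =>
    rw [cupds_cons, cobd_cupd _ _ (cupds_nil_eq h0), ih, cupd_zsmul, List.length_cons, pow_succ]
    simp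

lemma cupds_comp (u : S → S') (Hs : List (S' → ℤ)) (f : List S' → M) (l : List S) :
    cupds Hs f (l.map u) = cupds (Hs.map fun H s => H (u s)) (fun l => f (l.map u)) l := by
  induction Hs generalizing l with
  | nil => rfl
  | cons H Hs ih =>
    rw [cupds_cons, cupd_comp, List.map_cons, cupds_cons]
    congr 1
    funext l; exact ih l

lemma cupds_add (Hs : List (S → ℤ)) (f g : List S → M) :
    cupds Hs (f + g) = cupds Hs f + cupds Hs g := by
  induction Hs with
  | nil => rfl
  | cons H Hs ih => simp [ih, cupd_add]

lemma cupds_zsmul (Hs : List (S → ℤ)) (n : ℤ) (f : List S → M) :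
    cupds Hs (n • f) = n • cupds Hs f := by
  induction Hs with
  | nil => rfl
  | cons H Hs ih => simp [ih, cupd_zsmul]

lemma cupds_finsum {ι : Type*} (Hs : List (S → ℤ)) (f : ι → List S → M)
    (hf : ∀ l, (Function.support fun i => f i l).Finite) (l : List S) :
    (Function.support fun i => cupds Hs (f i) l).Finite ∧
      cupds Hs (fun l => ∑ᶠ i, f i l) l = ∑ᶠ i, cupds Hs (f i) l := by
  induction Hs generalizing l with
  | nil => exact ⟨hf l, rfl⟩
  | cons H Hs ih =>
    have ih2 : cupds Hs (fun l => ∑ᶠ i, f i l) = fun l => ∑ᶠ i, cupds Hs (f i) l :=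
      funext fun l => (ih l).2
    simp only [cupds_cons, ih2]
    rcases l with _ | ⟨s, _ | ⟨s₁, l⟩⟩
    · simp
    · simp
    · simp only [cupd_cons_cons]
      refine ⟨(ih (s₁ :: l)).1.subset fun i hi h => hi (by simp [h]), ?_⟩
      exact AddMonoidHom.map_finsum (zsmulAddGroupHom (α := M) (H s₁ - H s)) (ih (s₁ :: l)).1

/-- The prism operator between two vertex maps. -/
def prism (u u' : S → S') : (List S' → M) → List S → M
  | _, [] => 0
  | c, s :: l => c (u s :: u' s :: l.map u') - prism u u' (fun l' => c (u s :: l')) l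

lemma prism_cons (u u' : S → S') (c : List S' → M) (s l) : prism u u' c (s :: l) =
    c (u s :: u' s :: l.map u') - prism u u' (fun l' => c (u s :: l')) l := by simp [prism]
@[simp] lemma prism_nil (u u' : S → S') (c : List S' → M) : prism u u' c [] = 0 := by simp [prism]

lemma prism_sub (u u' : S → S') (f g : List S' → M) :
    prism u u' (f - g) = prism u u' f - prism u u' g := by
  funext l
  induction l generalizing f g with
  | nil => simp
  | cons s l ih =>
    have := ih (fun l' => f (u s :: l')) (fun l' => g (u s :: l'))
    simp only [prism_cons, Pi.sub_apply] at this ⊢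
    rw [show (fun l' => f (u s :: l') - g (u s :: l')) =
      (fun l' => f (u s :: l')) - (fun l' => g (u s :: l')) from rfl, this]
    abel

lemma prism_formula (u u' : S → S') (c : List S' → M) (l : List S) :
    c (l.map u') - c (l.map u) = cobd (prism u u' c) l + prism u u' (cobd c) l := by
  induction l generalizing c with
  | nil => simp
  | cons s l ih =>
    have e1 : (fun l' => prism u u' c (s :: l')) =
        (fun l' => c (u s :: u' s :: l'.map u')) - prism u u' (fun l' => c (u s :: l')) := by
      funext l'; simp [prism_cons]
    have e2 : (fun l' => cobd c (u s :: l')) = c - cobd (fun l' => c (u s :: l')) := by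
      funext l'; simp [cobd_cons]
    have h := ih (fun l' => c (u s :: l'))
    rw [cobd_cons, prism_cons, e1, e2, prism_sub, cobd_sub]
    simp only [Pi.sub_apply, cobd_cons, List.map_cons] at h ⊢
    rw [cobd_comp u' (fun l' => c (u s :: u' s :: l'))]
    have h' : cobd (prism u u' fun l' => c (u s :: l')) l =
      c (u s :: l.map u') - c (u s :: l.map u) - prism u u' (cobd fun l' => c (u s :: l')) l := by
        rw [h]; abel
    rw [h']
    abel

lemma Coch.prism {n : ℕ} {c : List S' → M} (hc : Coch (n + 1) c) (hn : n ≠ 0) (u u' : S → S') :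
    Coch n (prism u u' c) := by
  have key : ∀ (l : List S) (n : ℕ) (f : List S' → M), (∀ l, f l ≠ 0 → l.length = n + 1) →
      ChurchFarbPutman.prism u u' f l ≠ 0 → l.length = n := by
    intro l
    induction l with
    | nil => intro n f _ h; simp at h
    | cons s l ih =>
      intro n f hf h
      rw [prism_cons] at h
      by_cases h1 : f (u s :: u' s :: l.map u') = 0
      · rw [h1, zero_sub, neg_ne_zero] at h
        rcases n with _ | n
        · exfalso
          have hz : ∀ l : List S, ∀ f : List S' → M, (∀ l, f l ≠ 0 → l.length = 0) →
              ChurchFarbPutman.prism u u' f l = 0 := by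
            intro l
            induction l with
            | nil => simp
            | cons s l ih =>
              intro f hf
              rw [prism_cons, ih (fun l' => f (u s :: l'))]
              · by_contra h
                have := hf _ (show f _ ≠ 0 from fun h' => h (by rw [h', sub_zero]))
                simp at this
              · intro l h; simpa using hf _ h
          exact h (hz _ _ fun l h => by simpa using hf _ h)
        · have := ih n (fun l' => f (u s :: l')) (fun l' h' => by simpa using hf _ h') h
          simp [this]
      · simpa using hf _ h1
  intro l h
  have := key l n c (fun l h => (hc l h).1) h
  exact ⟨this, by rintro rfl; exact hn (by simpa using this.symm)⟩

lemma prism_equivariant {G : Type*} [SMul G S] [SMul G S'] (g : G) (u u' : S → S')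
    (hu : ∀ s, u (g • s) = g • u s) (hu' : ∀ s, u' (g • s) = g • u' s)
    (c : List S' → M) (l : List S) :
    prism u u' c (l.map (g • ·)) = prism u u' (fun l => c (l.map (g • ·))) l := by
  induction l generalizing c with
  | nil => simp
  | cons s l ih =>
    simp only [List.map_cons, prism_cons, hu, hu', ih]
    simp [Function.comp_def, hu']

end ListCochains

section Wang

variable {S M M' : Type*} [AddCommGroup M] [AddCommGroup M']
variable {G : Type*} [Group G] [MulAction G S]

/-- Translation of cochains. -/
def tr (t : G) (f : List S → M) : List S → M := fun l => f (l.map (t • ·))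

lemma map_smul_mul (a b : G) (l : List S) :
    l.map ((a * b) • ·) = (l.map (b • ·)).map (a • ·) := by simp [mul_smul, Function.comp_def]

lemma tr_mul (a b : G) (f : List S → M) : tr (a * b) f = tr b (tr a f) := by
  funext l; simp only [tr, map_smul_mul]

@[simp] lemma tr_one (f : List S → M) : tr (1 : G) f = f := by funext l; simp [tr]

lemma tr_add (a : G) (f g : List S → M) : tr a (f + g) = tr a f + tr a g := rfl
lemma tr_sub (a : G) (f g : List S → M) : tr a (f - g) = tr a f - tr a g := rfl
lemma tr_neg (a : G) (f : List S → M) : tr a (-f) = -tr a f := rfl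
lemma tr_zsmul (a : G) (n : ℤ) (f : List S → M) : tr a (n • f) = n • tr a f := rfl
@[simp] lemma tr_zero (a : G) : tr a (0 : List S → M) = 0 := rfl

lemma cobd_tr (a : G) (f : List S → M) : cobd (tr a f) = tr a (cobd f) := by
  funext l; exact cobd_comp _ f l

lemma tr_cupd (a : G) (H : S → ℤ) (f : List S → M) :
    tr a (cupd H f) = cupd (fun s => H (a • s)) (tr a f) := by
  funext l; exact cupd_comp _ H f l

lemma tr_cupds (a : G) (Hs : List (S → ℤ)) (f : List S → M) :
    tr a (cupds Hs f) = cupds (Hs.map fun H s => H (a • s)) (tr a f) := by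
  funext l; exact cupds_comp _ Hs f l

lemma tr_hmul (a : G) (H : S → ℤ) (f : List S → M) :
    tr a (hmul H f) = hmul (fun s => H (a • s)) (tr a f) := by
  funext l; rcases l with _ | ⟨s, l⟩ <;> simp [tr, hmul_cons]

lemma Coch.tr {n : ℕ} {f : List S → M} (hf : Coch n f) (a : G) : Coch n (tr a f) := hf.comp _

/-- The stabilizer of a cochain. -/
def stab (f : List S → M) : Subgroup G where
  carrier := {a | tr a f = f}
  one_mem' := tr_one f
  mul_mem' {a b} ha hb := by
    simp only [Set.mem_ofPred_eq] at *
    rw [tr_mul, ha, hb]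
  inv_mem' {a} ha := by
    simp only [Set.mem_ofPred_eq] at *
    conv_lhs => rw [← ha, ← tr_mul, mul_inv_cancel, tr_one]

lemma mem_stab {f : List S → M} {a : G} : a ∈ stab f ↔ tr a f = f := Iff.rfl

/-- Invariance of a cochain under a subgroup. -/
def Inv (N : Subgroup G) (f : List S → M) : Prop := N ≤ stab f

variable {N : Subgroup G}

lemma Inv.add {f g : List S → M} (hf : Inv N f) (hg : Inv N g) : Inv N (f + g) := fun a ha => by
  rw [mem_stab, tr_add, mem_stab.1 (hf ha), mem_stab.1 (hg ha)]
lemma Inv.map {f : List S → M} (hf : Inv N f) (φ : M →+ M') : Inv N (fun l => φ (f l)) :=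
  fun a ha => by
    rw [mem_stab]; funext l
    exact congrArg φ (congrFun (hf ha) l)
lemma Inv.neg {f : List S → M} (hf : Inv N f) : Inv N (-f) := hf.map (-AddMonoidHom.id M)
lemma Inv.sub {f g : List S → M} (hf : Inv N f) (hg : Inv N g) : Inv N (f - g) := by
  rw [sub_eq_add_neg]; exact hf.add hg.neg
lemma Inv.zsmul {f : List S → M} (hf : Inv N f) (k : ℤ) : Inv N (k • f) :=
  hf.map (zsmulAddGroupHom k)
lemma Inv.zero : Inv N (0 : List S → M) := fun _ _ => rfl
lemma Inv.cobd {f : List S → M} (hf : Inv N f) : Inv N (cobd f) := fun a ha => by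
  rw [mem_stab, ← cobd_tr, mem_stab.1 (hf ha)]
lemma Inv.mono {N' : Subgroup G} (h : N' ≤ N) {f : List S → M} (hf : Inv N f) : Inv N' f :=
  h.trans hf
lemma inv_bot (f : List S → M) : Inv (⊥ : Subgroup G) f := bot_le
lemma Inv.cupd {f : List S → M} (hf : Inv N f) {H : S → ℤ} (hH : ∀ a ∈ N, ∀ s, H (a • s) = H s) :
    Inv N (cupd H f) := fun a ha => by
  rw [mem_stab, tr_cupd, mem_stab.1 (hf ha)]; congr 1; funext s; exact hH a ha s
lemma Inv.hmul {f : List S → M} (hf : Inv N f) {H : S → ℤ} (hH : ∀ a ∈ N, ∀ s, H (a • s) = H s) :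
    Inv N (hmul H f) := fun a ha => by
  rw [mem_stab, tr_hmul, mem_stab.1 (hf ha)]; congr 1; funext s; exact hH a ha s
lemma Inv.cupds {f : List S → M} (hf : Inv N f) {Hs : List (S → ℤ)}
    (hH : ∀ H ∈ Hs, ∀ a ∈ N, ∀ s, H (a • s) = H s) : Inv N (cupds Hs f) := by
  induction Hs with
  | nil => exact hf
  | cons H Hs ih =>
    exact (ih fun H' h' => hH H' (by simp [h'])).cupd (hH H (by simp))

lemma Inv.tr {f : List S → M} (hf : Inv N f) {t : G} (ht : t ∈ Subgroup.normalizer (N : Set G)) :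
    Inv N (tr t f) := fun a ha => by
  rw [mem_stab, ← tr_mul, show t * a = (t * a * t⁻¹) * t by group, tr_mul]
  rw [mem_stab.1 (hf ((Subgroup.mem_normalizer_iff.1 ht a).1 ha))]

/-- The cochain `g` with coefficient `a`. -/
def scl (g : List S → ℤ) (a : M) : List S → M := fun l => g l • a

lemma scl_eq (g : List S → ℤ) (a : M) : scl g a = fun l => zmultiplesHom M a (g l) := by
  funext l; simp [scl]
lemma scl_zero (g : List S → ℤ) : scl g (0 : M) = 0 := by funext l; simp [scl]
lemma scl_add_left (g h : List S → ℤ) (a : M) : scl (g + h) a = scl g a + scl h a := by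
  funext l; simp [scl, add_smul]
lemma cobd_scl (g : List S → ℤ) (a : M) : cobd (scl g a) = scl (cobd g) a := by
  funext l; rw [scl_eq, scl_eq, cobd_map]
lemma tr_scl (t : G) (g : List S → ℤ) (a : M) : tr t (scl g a) = scl (tr t g) a := rfl
lemma Coch.scl {n : ℕ} {g : List S → ℤ} (hg : Coch n g) (a : M) : Coch n (scl g a) := by
  rw [scl_eq]; exact hg.map _
lemma Inv.scl {g : List S → ℤ} (hg : Inv N g) (a : M) : Inv N (scl g a) := by
  rw [scl_eq]; exact hg.map _

/-- Finiteness of the sum defining `sumtr`. -/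
def FinOn {ι : Type*} (τ : ι → G) (f : List S → M) : Prop :=
  ∀ l, (Function.support fun i => tr (τ i) f l).Finite

/-- Sum of translates of a cochain. -/
noncomputable def sumtr {ι : Type*} (τ : ι → G) (f : List S → M) : List S → M :=
  fun l => ∑ᶠ i, tr (τ i) f l

variable {ι : Type*} {τ : ι → G}

lemma Coch.sumtr {n : ℕ} {f : List S → M} (hf : Coch n f) : Coch n (sumtr τ f) :=
  Coch.finsum fun i => hf.tr (τ i)

lemma FinOn.cobd {f : List S → M} (hf : FinOn τ f) : FinOn τ (cobd f) := fun l => by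
  simp only [← cobd_tr]
  exact (cobd_finsum (fun i => ChurchFarbPutman.tr (τ i) f) hf l).1

lemma cobd_sumtr {f : List S → M} (hf : FinOn τ f) : cobd (sumtr τ f) = sumtr τ (cobd f) := by
  funext l
  change _ = ∑ᶠ i, tr (τ i) (cobd f) l
  simp only [← cobd_tr]
  exact (cobd_finsum (fun i => tr (τ i) f) hf l).2

lemma sumtr_add {f g : List S → M} (hf : FinOn τ f) (hg : FinOn τ g) :
    sumtr τ (f + g) = sumtr τ f + sumtr τ g := by
  funext l; exact finsum_add_distrib (hf l) (hg l)

lemma sumtr_sub {f g : List S → M} (hf : FinOn τ f) (hg : FinOn τ g) :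
    sumtr τ (f - g) = sumtr τ f - sumtr τ g := by
  funext l; exact finsum_sub_distrib (hf l) (hg l)

lemma sumtr_map (f : List S → M) (φ : M →+ M') (hf : FinOn τ f) (l : List S) :
    sumtr τ (fun l => φ (f l)) l = φ (sumtr τ f l) := (φ.map_finsum (hf l)).symm

lemma FinOn.map {f : List S → M} (φ : M →+ M') (hf : FinOn τ f) : FinOn τ (fun l => φ (f l)) :=
  fun l => (hf l).subset fun i hi h => hi (by simp only [tr] at h ⊢; rw [h, map_zero])

lemma sumtr_inv {A : Type*} [AddCommGroup A] {τ : A → G} (hτ : ∀ a b, τ (a + b) = τ a * τ b)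
    (f : List S → M) (b : A) : tr (τ b) (sumtr τ f) = sumtr τ f := by
  funext l
  change ∑ᶠ a, tr (τ a) f (l.map (τ b • ·)) = ∑ᶠ a, tr (τ a) f l
  rw [← finsum_comp_equiv (Equiv.addRight b) (f := fun a => tr (τ a) f l)]
  refine finsum_congr fun a => ?_
  simp only [Equiv.coe_addRight, hτ, tr_mul]
  rfl

lemma Inv.sumtr {f : List S → M} (hf : Inv N f)
    (hτ : ∀ i, τ i ∈ Subgroup.normalizer (N : Set G)) :
    Inv N (sumtr τ f) := fun a ha => by
  rw [mem_stab]; funext l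
  refine finsum_congr fun i => ?_
  have := hf.tr (hτ i) ha
  exact congrFun this l

/-- `N` has a one-dimensional top cohomology, in length `n`, generated by the class of `g`,
for all coefficients. -/
structure Fund (N : Subgroup G) (n : ℕ) (g : List S → ℤ) : Prop where
  pos : 1 ≤ n
  coch : Coch n g
  inv : Inv N g
  closed : cobd g = 0
  exh : ∀ (M : Type) [AddCommGroup M] (k : ℕ) (f : List S → M), n ≤ k → Coch k f → Inv N f →
    cobd f = 0 → ∃ (a : M) (α : List S → M), Coch (k - 1) α ∧ Inv N α ∧ (k = n ∨ a = 0) ∧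
      f = scl g a + cobd α
  free : ∀ (M : Type) [AddCommGroup M] (a : M) (α : List S → M), Coch (n - 1) α → Inv N α →
    scl g a = cobd α → a = 0

lemma fund_bot (s₀ : S) : Fund (⊥ : Subgroup G) 1 (unitCochain : List S → ℤ) where
  pos := le_rfl
  coch := coch_unitCochain
  inv := inv_bot _
  closed := cobd_unitCochain
  exh M _ k f hk hf _ hcl := by
    have h1 : f = cobd (fun l => f (s₀ :: l)) := by
      funext l
      have := congrFun hcl (s₀ :: l)
      rw [cobd_cons, Pi.zero_apply, sub_eq_zero] at this
      exact this
    rcases hk.eq_or_lt with rfl | hk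
    · refine ⟨f [s₀], 0, Coch.zero, inv_bot _, Or.inl rfl, ?_⟩
      rw [cobd_zero, add_zero, ← cobd_indicator_nil, ← cobd_scl]
      conv_lhs => rw [h1]
      congr 1
      funext l
      rcases l with _ | ⟨s, l⟩
      · simp [scl]
      · simp only [scl, List.length_cons, Nat.add_eq_zero_iff, one_ne_zero, and_false, if_false,
          zero_smul]
        by_contra h
        simpa using (hf _ h).1
    · refine ⟨0, fun l => f (s₀ :: l), ?_, inv_bot _, Or.inr rfl, ?_⟩
      · intro l h
        have := (hf _ h).1
        simp only [List.length_cons] at this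
        exact ⟨by omega, by rintro rfl; simp at this; omega⟩
      · rw [scl_zero, zero_add]; exact h1
  free M _ a α hα _ h := by
    have h0 : α = 0 := by
      funext l
      by_contra h'
      obtain ⟨h1, h2⟩ := hα _ h'
      exact h2 (by simpa using h1)
    rw [h0, cobd_zero] at h
    simpa [scl, unitCochain] using congrFun h [s₀]

lemma Fund.sq {n : ℕ} {g : List S → ℤ} (h : Fund N n g) {s : G}
    (hs : s ∈ Subgroup.normalizer (N : Set G)) :
    ∃ ζ : List S → ℤ, Coch (n - 1) ζ ∧ Inv N ζ ∧ tr (s * s) g = g + cobd ζ := by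
  have key : ∀ x ∈ Subgroup.normalizer (N : Set G), ∃ (c : ℤ) (ζ : List S → ℤ), Coch (n - 1) ζ ∧
      Inv N ζ ∧ tr x g = c • g + cobd ζ := by
    intro x hx
    obtain ⟨a, α, h1, h2, -, h4⟩ := h.exh ℤ n (tr x g) le_rfl (h.coch.tr x) (h.inv.tr hx)
      (by rw [cobd_tr, h.closed, tr_zero])
    refine ⟨a, α, h1, h2, ?_⟩
    rw [h4]; congr 1; funext l; simp [scl, mul_comm]
  obtain ⟨c, ζ, h1, h2, h3⟩ := key s hs
  obtain ⟨c', ζ', h1', h2', h3'⟩ := key s⁻¹ (inv_mem hs)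
  have e : g = (c * c') • g + cobd (c • ζ' + tr s⁻¹ ζ) := by
    have : tr (s * s⁻¹) g = g := by simp
    rw [tr_mul, h3, tr_add, tr_zsmul, h3', ← cobd_tr, smul_add, ← mul_smul, add_assoc,
      ← cobd_zsmul, ← cobd_add] at this
    exact this.symm
  have hc : 1 - c * c' = 0 := by
    refine h.free ℤ _ (c • ζ' + tr s⁻¹ ζ) ((h1'.zsmul c).add (h1.tr _))
      ((h2'.zsmul c).add (h2.tr (inv_mem hs))) ?_
    have : scl g (1 - c * c') = g - (c * c') • g := by
      funext l; simp [scl]; ring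
    rw [this, sub_eq_iff_eq_add']
    exact e
  have hcc : c * c = 1 := by
    rcases Int.eq_one_or_neg_one_of_mul_eq_one (show c * c' = 1 by omega) with h | h <;> simp [h]
  refine ⟨c • ζ + tr s ζ, (h1.zsmul c).add (h1.tr s), (h2.zsmul c).add (h2.tr hs), ?_⟩
  rw [tr_mul, h3, tr_add, tr_zsmul, h3, ← cobd_tr, smul_add, ← mul_smul, hcc, one_smul, cobd_add,
    cobd_zsmul, add_assoc]

section Step

variable (t : G) (χ : S → ℤ)

/-- The step function of a height function. -/
def hstep (s : S) : ℤ := if 0 ≤ χ s then 1 else 0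

lemma finOn_of_finite {A : Type*} {τ : A → G} {f : List S → M} (P : A → S → Prop)
    (hP : ∀ a l, tr (τ a) f l ≠ 0 → ∃ s ∈ l, P a s) (hfin : ∀ s, {a | P a s}.Finite) :
    FinOn τ f := fun l => by
  refine Set.Finite.subset (Set.Finite.biUnion (List.finite_toSet l) fun s _ => hfin s) ?_
  intro a ha
  obtain ⟨s, hs, h⟩ := hP a l ha
  simp only [Set.mem_iUnion]
  exact ⟨s, hs, h⟩

variable {t χ}

lemma height_zpow (hχ : ∀ s, χ (t • s) = χ s + 1) (m : ℤ) (s : S) : χ (t ^ m • s) = χ s + m := by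
  induction m using Int.induction_on with
  | zero => simp
  | succ i ih => rw [add_comm, zpow_add, zpow_one, mul_smul, hχ, ih]; ring
  | pred i ih =>
    rw [show t ^ (-(i : ℤ)) = t * t ^ (-(i : ℤ) - 1) by rw [← zpow_one_add]; congr 1; ring,
      mul_smul, hχ] at ih
    linarith

/-- If `D` vanishes far along `t`-orbits, then so do its products. -/
lemma finOn_hmul {D : S → ℤ} {τ : ι → G} (hD : ∀ s, {m : ι | D (τ m • s) ≠ 0}.Finite)
    (ψ : List S → M) : FinOn τ (hmul D ψ) := by
  refine finOn_of_finite (fun m s => D (τ m • s) ≠ 0) ?_ hD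
  intro m l h
  rcases l with _ | ⟨s, l⟩
  · simp [tr] at h
  · refine ⟨s, by simp, fun h' => h ?_⟩
    simp [tr, hmul_cons, h']

lemma finOn_cupd_hstep (hχ : ∀ s, χ (t • s) = χ s + 1) (ψ : List S → M) :
    FinOn (fun m : ℤ => t ^ m) (cupd (hstep χ) ψ) := by
  intro l
  have : ∃ C : ℤ, ∀ s ∈ l, |χ s| ≤ C := by
    induction l with
    | nil => simp
    | cons s l ih =>
      obtain ⟨C, hC⟩ := ih
      refine ⟨max C |χ s|, ?_⟩
      intro s' hs'
      rcases List.mem_cons.1 hs' with rfl | h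
      · simp
      · exact (hC _ h).trans (le_max_left _ _)
  obtain ⟨C, hC⟩ := this
  refine (Set.finite_Icc (-C) C).subset fun m hm => ?_
  obtain ⟨⟨s, hs, s', hs', hne⟩, -⟩ := exists_ne_of_cupd_ne_zero hm
  simp only [List.mem_map] at hs hs'
  obtain ⟨s, hs, rfl⟩ := hs
  obtain ⟨s', hs', rfl⟩ := hs'
  have h1 := abs_le.1 (hC s hs)
  have h2 := abs_le.1 (hC s' hs')
  simp only [hstep, height_zpow hχ] at hne
  simp only [Set.mem_Icc]
  by_contra hcon
  apply hne
  split_ifs <;> first | rfl | omega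

variable (t χ)

/-- The partial sum operator inverting `tr t - 1`. -/
noncomputable def psum (η : List S → M) : List S → M := fun l =>
  ∑ᶠ m : ℤ, hmul (fun s => hstep χ (t ^ m • s) - if 0 ≤ m then 1 else 0) (tr (t ^ m) η) l

variable {t χ}

lemma psum_fin (hχ : ∀ s, χ (t • s) = χ s + 1) (η : List S → M) (l : List S) :
    (Function.support fun m : ℤ => hmul (fun s => hstep χ (t ^ m • s) - if 0 ≤ m then 1 else 0)
      (tr (t ^ m) η) l).Finite := by
  rcases l with _ | ⟨s, l⟩
  · simp
  · refine (Set.finite_Icc (-|χ s|) (|χ s|)).subset fun m hm => ?_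
    simp only [Function.mem_support, hmul_cons, hstep, height_zpow hχ] at hm
    have h1 := le_abs_self (χ s)
    have h2 := neg_abs_le (χ s)
    by_contra hcon
    simp only [Set.mem_Icc] at hcon
    apply hm
    split_ifs <;> first | omega | simp

lemma Coch.psum {n : ℕ} {η : List S → M} (hη : Coch n η) : Coch n (psum t χ η) :=
  Coch.finsum fun _ => (hη.tr _).hmul _

lemma Inv.psum {η : List S → M} (hη : Inv N η) (ht : t ∈ Subgroup.normalizer (N : Set G))
    (hN : ∀ a ∈ N, ∀ s, χ (a • s) = χ s) (hχ : ∀ s, χ (t • s) = χ s + 1) :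
    Inv N (psum t χ η) := fun a ha => by
  rw [mem_stab]; funext l
  refine finsum_congr fun m => ?_
  refine congrFun (Inv.hmul (hη.tr (zpow_mem ht m)) ?_ ha) l
  intro a ha s
  simp only [hstep, height_zpow hχ, hN a ha]

lemma tr_psum (hχ : ∀ s, χ (t • s) = χ s + 1) (η : List S → M) (h0 : η [] = 0) :
    tr t (psum t χ η) - psum t χ η = η := by
  funext l
  rcases l with _ | ⟨s, l⟩
  · simp [tr, psum, h0]
  have e : tr t (psum t χ η) (s :: l) = ∑ᶠ m : ℤ,
      ((hstep χ (t ^ m • s) - if 1 ≤ m then 1 else 0 : ℤ) • tr (t ^ m) η (s :: l)) := by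
    simp only [tr, psum, List.map_cons, hmul_cons]
    rw [← finsum_comp_equiv (Equiv.addRight (1 : ℤ)) (f := fun m : ℤ =>
      (hstep χ (t ^ m • s) - if 1 ≤ m then 1 else 0 : ℤ) •
        η (t ^ m • s :: l.map (t ^ m • ·)))]
    refine finsum_congr fun m => ?_
    have e1 : ∀ x : S, t ^ m • t • x = t ^ (m + 1) • x := by
      intro x; rw [zpow_add, zpow_one, mul_smul]
    have e2 : ((1 : ℤ) ≤ m + 1) = (0 ≤ m) := by simp only [eq_iff_iff]; omega
    simp only [Equiv.coe_addRight, List.map_map, Function.comp_def, e1, e2]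
  have f1 := psum_fin hχ η (s :: l)
  have f2 : (Function.support fun m : ℤ =>
      (hstep χ (t ^ m • s) - if 1 ≤ m then 1 else 0 : ℤ) • tr (t ^ m) η (s :: l)).Finite := by
    refine (f1.union (Set.finite_singleton 0)).subset fun m hm => ?_
    by_contra hcon
    simp only [Set.mem_union, Set.mem_singleton_iff, not_or, Function.mem_support, not_not,
      hmul_cons] at hcon hm
    apply hm
    have : ((1 : ℤ) ≤ m) = (0 ≤ m) := by
      have := hcon.2
      simp only [eq_iff_iff]; omega
    rw [← hcon.1]
    simp only [this]
  simp only [hmul_cons] at f1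
  rw [Pi.sub_apply, e, psum]
  simp only [hmul_cons]
  rw [← finsum_sub_distrib f2 f1, finsum_eq_single _ (0 : ℤ)]
  · simp only [← sub_smul]
    simp [hstep]
  · intro m hm
    rw [← sub_smul]
    have : ((1 : ℤ) ≤ m) = (0 ≤ m) := by simp only [eq_iff_iff]; omega
    simp [this]

lemma cobd_psum (hχ : ∀ s, χ (t • s) = χ s + 1) (η : List S → M) (h0 : η [] = 0) :
    cobd (psum t χ η) =
      sumtr (fun m : ℤ => t ^ m) (cupd (hstep χ) η) + psum t χ (cobd η) := by
  funext l
  have h1 := (cobd_finsum _ (psum_fin hχ η) l).2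
  rw [Pi.add_apply]
  unfold psum sumtr
  rw [h1, ← finsum_add_distrib (finOn_cupd_hstep hχ η l) (psum_fin hχ (cobd η) l)]
  refine finsum_congr fun m => ?_
  rw [cobd_hmul _ _ (by simpa [tr] using h0), cobd_tr, tr_cupd, Pi.add_apply]
  congr 1
  have := cupd_sub_left (fun s => hstep χ (t ^ m • s)) (fun _ => if 0 ≤ m then 1 else 0)
    (tr (t ^ m) η)
  have h2 : cupd (fun _ => if 0 ≤ m then 1 else 0) (tr (t ^ m) η) = 0 := by
    funext l
    rcases l with _ | ⟨s, _ | ⟨s₁, l⟩⟩ <;> simp [cupd_cons_cons]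
  rw [h2, sub_zero] at this
  exact (congrFun this l).symm

lemma psum_scl (hχ : ∀ s, χ (t • s) = χ s + 1) {g : List S → ℤ} (a : M) :
    psum t χ (scl g a) = scl (psum t χ g) a := by
  funext l
  rw [scl_eq (psum t χ g)]
  simp only [psum]
  rw [AddMonoidHom.map_finsum _ (psum_fin hχ g l)]
  refine finsum_congr fun m => ?_
  rcases l with _ | ⟨s, l⟩
  · simp
  · simp only [hmul_cons, map_zsmul]
    simp [tr, scl]

theorem Fund.step {n : ℕ} {g : List S → ℤ} (h : Fund N n g)
    (ht : t ∈ Subgroup.normalizer (N : Set G))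
    (hN : ∀ a ∈ N, ∀ s, χ (a • s) = χ s) (hχ : ∀ s, χ (t • s) = χ s + 1)
    (hg : ∃ ζ : List S → ℤ, Coch (n - 1) ζ ∧ Inv N ζ ∧ tr t g = g + cobd ζ) :
    Fund (N ⊔ Subgroup.zpowers t) (n + 1) (sumtr (fun m : ℤ => t ^ m) (cupd (hstep χ) g)) := by
  have hHN : ∀ a ∈ N, ∀ s, hstep χ (a • s) = hstep χ s := fun a ha s => by simp [hstep, hN a ha]
  have inv_iff : ∀ {M : Type} [AddCommGroup M] (f : List S → M),
      Inv (N ⊔ Subgroup.zpowers t) f ↔ Inv N f ∧ tr t f = f := by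
    intro M _ f
    rw [Inv, sup_le_iff, Subgroup.zpowers_le, mem_stab]; rfl
  have hn := h.pos
  have hcobd : cobd (psum t χ g) = sumtr (fun m : ℤ => t ^ m) (cupd (hstep χ) g) := by
    have e3 : psum t χ (0 : List S → ℤ) = 0 := by
      funext l; rcases l with _ | ⟨s, l⟩ <;> simp [psum, hmul_cons]
    rw [cobd_psum hχ _ h.coch.nil, h.closed, e3, add_zero]
  refine ⟨by omega, (h.coch.cupd _).sumtr, ?_, ?_, ?_, ?_⟩
  · rw [inv_iff]
    refine ⟨(h.inv.cupd hHN).sumtr fun m => zpow_mem ht m, ?_⟩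
    have := sumtr_inv (τ := fun m : ℤ => t ^ m) (zpow_add t) (cupd (hstep χ) g) 1
    simpa using this
  · rw [cobd_sumtr (finOn_cupd_hstep hχ g), cobd_cupd _ _ h.coch.nil, h.closed]
    funext l
    have : cupd (hstep χ) (0 : List S → ℤ) = 0 := by
      simpa using cupd_zsmul (hstep χ) 0 (0 : List S → ℤ)
    simp [this, sumtr, tr]
  · intro M _ k f hk hf hinv hcl
    obtain ⟨hi1, hi2⟩ := (inv_iff f).1 hinv
    obtain ⟨a₀, α, hα1, hα2, ha₀, hfα⟩ := h.exh M k f (by omega) hf hi1 hcl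
    obtain rfl : a₀ = 0 := ha₀.resolve_left (by omega)
    rw [scl_zero, zero_add] at hfα
    obtain ⟨a, η, hη1, hη2, hka, hη⟩ := h.exh M (k - 1) (tr t α - α) (by omega)
      ((hα1.tr t).sub hα1) ((hα2.tr ht).sub hα2) (by
        rw [cobd_sub, cobd_tr, ← hfα, hi2, sub_self])
    have hcp : Coch (k - 1) (scl (psum t χ g) a) := by
      rcases hka with hka | rfl
      · rw [hka]; exact (h.coch.psum).scl a
      · rw [scl_zero]; exact Coch.zero
    have hηp : Coch (k - 1) (cobd (psum t χ η)) := by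
      have := hη1.psum (t := t) (χ := χ) |>.cobd
      rwa [show k - 1 - 1 + 1 = k - 1 by omega] at this
    have hgi := (h.inv.psum ht hN hχ).scl a
    have hηi := (hη2.psum ht hN hχ).cobd
    refine ⟨a, α - scl (psum t χ g) a - cobd (psum t χ η), (hα1.sub hcp).sub hηp,
      (inv_iff _).2 ⟨(hα2.sub hgi).sub hηi, ?_⟩, ?_, ?_⟩
    · have e1 := tr_psum hχ (scl g a) (by simp [scl, h.coch.nil])
      have e2 := tr_psum hχ η hη1.nil
      rw [psum_scl hχ] at e1
      rw [← sub_eq_zero, tr_sub, tr_sub]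
      calc _ = (tr t α - α) - (tr t (scl (psum t χ g) a) - scl (psum t χ g) a) -
            cobd (tr t (psum t χ η) - psum t χ η) := by rw [cobd_sub, cobd_tr]; abel
        _ = 0 := by rw [hη, e1, e2]; abel
    · rcases hka with hka | hka
      · left; omega
      · exact Or.inr hka
    · rw [cobd_sub, cobd_sub, cobd_cobd, cobd_scl, hcobd, hfα]
      abel
  · intro M _ a β hβ1 hβ2 hβ
    obtain ⟨hi1, hi2⟩ := (inv_iff β).1 hβ2
    rw [Nat.add_sub_cancel] at hβ1
    obtain ⟨b, η, hη1, hη2, -, hη⟩ := h.exh M n (scl (psum t χ g) a - β) le_rfl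
      ((h.coch.psum.scl a).sub hβ1) (((h.inv.psum ht hN hχ).scl a).sub hi1) (by
        rw [cobd_sub, cobd_scl, hcobd, hβ, sub_self])
    obtain ⟨ζ, hζ1, hζ2, hζ⟩ := hg
    refine h.free M a (scl ζ b + (tr t η - η)) ((hζ1.scl b).add ((hη1.tr t).sub hη1))
      ((hζ2.scl b).add ((hη2.tr ht).sub hη2)) ?_
    have e1 := tr_psum hχ (scl g a) (by simp [scl, h.coch.nil])
    rw [psum_scl hχ] at e1
    have e2 := congrArg (fun x => tr t x - x) hη
    simp only [tr_sub, hi2, tr_add, tr_scl t g, hζ] at e2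
    rw [cobd_add, cobd_sub, cobd_tr, ← e1]
    calc _ = tr t (scl (psum t χ g) a) - β - (scl (psum t χ g) a - β) := by abel
      _ = _ := by rw [e2, scl_add_left, cobd_scl]; abel

end Step
end Wang

section Block

variable {S : Type*} {G : Type*} [Group G] [MulAction G S]

/-- Cohomologous relative to `N`. -/
def Coh (N : Subgroup G) (n : ℕ) (f f' : List S → ℤ) : Prop :=
  ∃ α : List S → ℤ, Coch (n - 1) α ∧ Inv N α ∧ f = f' + cobd α

variable {N : Subgroup G} {n : ℕ}

lemma Coh.refl (f : List S → ℤ) : Coh N n f f :=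
  ⟨0, Coch.zero, Inv.zero, by rw [cobd_zero, add_zero]⟩

lemma Coh.trans {f g h : List S → ℤ} (h1 : Coh N n f g) (h2 : Coh N n g h) : Coh N n f h := by
  obtain ⟨α, a1, a2, rfl⟩ := h1
  obtain ⟨β, b1, b2, rfl⟩ := h2
  exact ⟨β + α, b1.add a1, b2.add a2, by rw [cobd_add, add_assoc]⟩

lemma Coh.zsmul {f g : List S → ℤ} (h : Coh N n f g) (k : ℤ) : Coh N n (k • f) (k • g) := by
  obtain ⟨α, a1, a2, rfl⟩ := h
  exact ⟨k • α, a1.zsmul k, a2.zsmul k, by rw [cobd_zsmul, smul_add]⟩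

lemma Coh.coch {f g : List S → ℤ} (h : Coh N n f g) (hn : 1 ≤ n) (hg : Coch n g) : Coch n f := by
  obtain ⟨α, a1, a2, rfl⟩ := h
  refine hg.add ?_
  have := a1.cobd
  rwa [Nat.sub_add_cancel hn] at this

lemma Coh.inv {f g : List S → ℤ} (h : Coh N n f g) (hg : Inv N g) : Inv N f := by
  obtain ⟨α, a1, a2, rfl⟩ := h
  exact hg.add a2.cobd

lemma Coh.closed {f g : List S → ℤ} (h : Coh N n f g) (hg : cobd g = 0) : cobd f = 0 := by
  obtain ⟨α, a1, a2, rfl⟩ := h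
  rw [cobd_add, hg, cobd_cobd, add_zero]

/-- Integer-valued sign. -/
noncomputable def sg (x : ℝ) : ℤ := (SignType.sign x : ℤ)

lemma sg_pos {x : ℝ} (h : 0 < x) : sg x = 1 := by simp [sg, h]
lemma sg_neg {x : ℝ} (h : x < 0) : sg x = -1 := by simp [sg, h]
lemma sg_mul (x y : ℝ) : sg (x * y) = sg x * sg y := by simp [sg, sign_mul]

lemma abs_le_of_sg_ne {x y : ℝ} (h : sg x ≠ sg y) : |x| ≤ |x - y| := by
  rcases lt_trichotomy x 0 with hx | rfl | hx
  · rcases lt_or_ge y 0 with hy | hy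
    · rw [sg_neg hx, sg_neg hy] at h; exact absurd rfl h
    · rw [abs_of_neg hx, abs_of_nonpos (by linarith)]; linarith
  · simp
  · rcases le_or_gt y 0 with hy | hy
    · rw [abs_of_pos hx, abs_of_nonneg (by linarith)]; linarith
    · rw [sg_pos hx, sg_pos hy] at h; exact absurd rfl h

lemma finOn_cupd {ι : Type*} {τ : ι → G} {H : S → ℤ}
    (hH : ∀ s s', {i | H (τ i • s) ≠ H (τ i • s')}.Finite) (ψ : List S → ℤ) :
    FinOn τ (cupd H ψ) := by
  intro l
  refine Set.Finite.subset (Set.Finite.biUnion (List.finite_toSet l) fun s _ =>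
    Set.Finite.biUnion (List.finite_toSet l) fun s' _ => hH s s') ?_
  intro i hi
  obtain ⟨⟨s, hs, s', hs', hne⟩, -⟩ := exists_ne_of_cupd_ne_zero hi
  simp only [List.mem_map] at hs hs'
  obtain ⟨s, hs, rfl⟩ := hs
  obtain ⟨s', hs', rfl⟩ := hs'
  simp only [Set.mem_iUnion]
  exact ⟨s, hs, s', hs', hne⟩

lemma finite_of_abs_le (x : ℝ) (C : ℝ) : {k : ℤ | |x + k| ≤ C}.Finite := by
  refine (Set.finite_Icc (-⌈|x| + C⌉) ⌈|x| + C⌉).subset fun k hk => ?_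
  have h1 := abs_le.1 (show |x + k| ≤ C from hk)
  have h2 := Int.le_ceil (|x| + C)
  have h3 := neg_abs_le x
  have h4 := le_abs_self x
  constructor
  · have : (-(⌈|x| + C⌉ : ℤ) : ℝ) ≤ k := by linarith
    exact_mod_cast this
  · have : (k : ℝ) ≤ (⌈|x| + C⌉ : ℤ) := by linarith
    exact_mod_cast this

/-- An abelian group `τ` of automorphisms normalizing `N`, with square roots `σ`. -/
structure BlockData (N : Subgroup G) {m : ℕ} (τ σ : (Fin m → ℤ) → G) : Prop where
  add : ∀ a b, τ (a + b) = τ a * τ b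
  sq : ∀ a, σ a * σ a = τ a
  comm : ∀ a b, σ a * τ b = τ b * σ a
  norm : ∀ a, σ a ∈ Subgroup.normalizer (N : Set G)

lemma BlockData.norm' {m : ℕ} {τ σ : (Fin m → ℤ) → G} (h : BlockData N τ σ) (a) :
    τ a ∈ Subgroup.normalizer (N : Set G) := by
  rw [← h.sq]; exact mul_mem (h.norm a) (h.norm a)

lemma BlockData.zero {m : ℕ} {τ σ : (Fin m → ℤ) → G} (h : BlockData N τ σ) : τ 0 = 1 := by
  simpa using h.add 0 0

/-- Coordinates on which `τ` acts by translation through `M`. -/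
structure Coords (N : Subgroup G) {m : ℕ} (τ : (Fin m → ℤ) → G) (ξ : S → Fin m → ℝ)
    (M : Matrix (Fin m) (Fin m) ℝ) : Prop where
  inv : ∀ a ∈ N, ∀ s, ξ (a • s) = ξ s
  trans : ∀ a s, ξ (τ a • s) = ξ s + M.mulVec (fun i => (a i : ℝ))
  det : M.det ≠ 0

/-- The sign functions of coordinates. -/
noncomputable def signs {m : ℕ} (ξ : S → Fin m → ℝ) : List (S → ℤ) :=
  (List.finRange m).map fun k s => sg (ξ s k)

@[simp] lemma length_signs {m : ℕ} (ξ : S → Fin m → ℝ) : (signs ξ).length = m := by simp [signs]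

lemma signs_succ {m : ℕ} (ξ : S → Fin (m + 1) → ℝ) :
    signs ξ = (fun s => sg (ξ s 0)) :: signs (fun s => Fin.tail (ξ s)) := by
  simp [signs, List.finRange_succ, Fin.tail, Function.comp_def]

lemma mem_signs {m : ℕ} {ξ : S → Fin m → ℝ} {H : S → ℤ} (h : H ∈ signs ξ) :
    ∃ k, H = fun s => sg (ξ s k) := by
  simp only [signs, List.mem_map] at h
  obtain ⟨k, -, rfl⟩ := h
  exact ⟨k, rfl⟩

lemma finite_mulVec_le {m : ℕ} {M : Matrix (Fin m) (Fin m) ℝ} (hM : M.det ≠ 0) (C : ℝ) :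
    {a : Fin m → ℤ | ∀ k, |M.mulVec (fun i => (a i : ℝ)) k| ≤ C}.Finite := by
  set C' : Fin m → ℝ := fun k => ∑ j, |M⁻¹ k j| * C with hC'
  refine (Set.finite_Icc (fun k => -⌈C' k⌉) (fun k => ⌈C' k⌉)).subset fun a ha => ?_
  have key : ∀ k, |(a k : ℝ)| ≤ C' k := by
    intro k
    have : (fun i => (a i : ℝ)) = M⁻¹.mulVec (M.mulVec fun i => (a i : ℝ)) := by
      rw [Matrix.mulVec_mulVec, Matrix.nonsing_inv_mul _ (isUnit_iff_ne_zero.2 hM),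
        Matrix.one_mulVec]
    have h2 : (a k : ℝ) = ∑ j, M⁻¹ k j * M.mulVec (fun i => (a i : ℝ)) j := congrFun this k
    refine (congrArg abs h2).le.trans ?_
    refine (Finset.abs_sum_le_sum_abs _ _).trans ?_
    rw [hC']
    dsimp only
    refine Finset.sum_le_sum fun j _ => ?_
    rw [abs_mul]
    exact mul_le_mul_of_nonneg_left (ha j) (abs_nonneg _)
  constructor
  · intro k
    have h1 := (abs_le.1 (key k)).1
    have h2 := Int.le_ceil (C' k)
    have : ((-⌈C' k⌉ : ℤ) : ℝ) ≤ a k := by push_cast; linarith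
    exact_mod_cast this
  · intro k
    have h1 := (abs_le.1 (key k)).2
    have h2 := Int.le_ceil (C' k)
    have : (a k : ℝ) ≤ (⌈C' k⌉ : ℤ) := by linarith
    exact_mod_cast this

lemma exists_bound {m : ℕ} (ξ : S → Fin m → ℝ) (l : List S) :
    ∃ C : ℝ, ∀ s ∈ l, ∀ k, |ξ s k| ≤ C := by
  induction l with
  | nil => simp
  | cons s l ih =>
    obtain ⟨C, hC⟩ := ih
    refine ⟨max C (∑ k, |ξ s k|), ?_⟩
    intro s' hs' k
    rcases List.mem_cons.1 hs' with rfl | h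
    · exact (Finset.single_le_sum (f := fun k => |ξ s' k|) (fun i _ => abs_nonneg _)
        (Finset.mem_univ k)).trans (le_max_right _ _)
    · exact (hC _ h k).trans (le_max_left _ _)

lemma Coords.bound {m : ℕ} {τ : (Fin m → ℤ) → G} {ξ : S → Fin m → ℝ}
    {M : Matrix (Fin m) (Fin m) ℝ} (h : Coords N τ ξ M) {l : List S} {C : ℝ}
    (hC : ∀ s ∈ l, ∀ k, |ξ s k| ≤ C) {a : Fin m → ℤ} {k : Fin m}
    (hk : ∃ s ∈ l.map (τ a • ·), ∃ s' ∈ l.map (τ a • ·), sg (ξ s k) ≠ sg (ξ s' k)) :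
    |M.mulVec (fun i => (a i : ℝ)) k| ≤ 3 * C := by
  obtain ⟨s, hs, s', hs', hne⟩ := hk
  simp only [List.mem_map] at hs hs'
  obtain ⟨s, hs, rfl⟩ := hs
  obtain ⟨s', hs', rfl⟩ := hs'
  have h1 := abs_le_of_sg_ne hne
  rw [h.trans, h.trans] at h1
  simp only [Pi.add_apply, add_sub_add_right_eq_sub] at h1
  have h2 := abs_le.1 (hC s hs k)
  have h3 := abs_le.1 (hC s' hs' k)
  have h4 : |ξ s k - ξ s' k| ≤ 2 * C := abs_le.2 ⟨by linarith, by linarith⟩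
  have h5 := abs_le.1 (h1.trans h4)
  exact abs_le.2 ⟨by linarith, by linarith⟩

lemma Coords.finite {m : ℕ} {τ : (Fin m → ℤ) → G} {ξ : S → Fin m → ℝ}
    {M : Matrix (Fin m) (Fin m) ℝ} (h : Coords N τ ξ M) (l : List S) :
    {a : Fin m → ℤ | ∀ k, ∃ s ∈ l.map (τ a • ·), ∃ s' ∈ l.map (τ a • ·),
      sg (ξ s k) ≠ sg (ξ s' k)}.Finite := by
  obtain ⟨C, hC⟩ := exists_bound ξ l
  exact (finite_mulVec_le h.det (3 * C)).subset fun a ha k => h.bound hC (ha k)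

lemma Coords.finOn {m : ℕ} {τ : (Fin m → ℤ) → G} {ξ : S → Fin m → ℝ}
    {M : Matrix (Fin m) (Fin m) ℝ} (h : Coords N τ ξ M) (f : List S → ℤ) :
    FinOn τ (cupds (signs ξ) f) := fun l =>
  (h.finite l).subset fun a ha k => exists_ne_of_cupds_ne_zero ha (fun s => sg (ξ s k))
    (by simp [signs])

lemma signs_inv {m : ℕ} {ξ : S → Fin m → ℝ} (h : ∀ a ∈ N, ∀ s, ξ (a • s) = ξ s) :
    ∀ H ∈ signs ξ, ∀ a ∈ N, ∀ s, H (a • s) = H s := by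
  intro H hH a ha s
  obtain ⟨k, rfl⟩ := mem_signs hH
  simp only [h a ha s]

lemma sumtr_zsmul {ι : Type*} {τ : ι → G} {f : List S → ℤ} (hf : FinOn τ f) (k : ℤ) :
    sumtr τ (k • f) = k • sumtr τ f := by
  funext l; exact sumtr_map f (zsmulAddGroupHom k) hf l

lemma finsum_fin_succ {m : ℕ} (f : (Fin (m + 1) → ℤ) → ℤ) (hf : (Function.support f).Finite) :
    ∑ᶠ a, f a = ∑ᶠ (k : ℤ) (a : Fin m → ℤ), f (Fin.cons k a) := by
  rw [← finsum_comp_equiv (Fin.consEquiv fun _ => ℤ)]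
  rw [finsum_curry]
  · rfl
  · exact hf.preimage (Equiv.injective _).injOn

/-- Comparison of the sum over `t`-translates of `cupd H ψ` with the standard one. -/
lemma jump {t : G} (ht : t ∈ Subgroup.normalizer (N : Set G)) {χ : S → ℤ}
    (hN : ∀ a ∈ N, ∀ s, χ (a • s) = χ s)
    {H : S → ℤ} (hHN : ∀ a ∈ N, ∀ s, H (a • s) = H s) (hχ : ∀ s, χ (t • s) = χ s + 1)
    (c₀ c₁ : ℤ) (hD : ∀ s, {m : ℤ | H (t ^ m • s) - c₀ - c₁ * hstep χ (t ^ m • s) ≠ 0}.Finite)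
    (hHf : ∀ s s', {m : ℤ | H (t ^ m • s) ≠ H (t ^ m • s')}.Finite)
    {k : ℕ} {ψ : List S → ℤ} (h1 : Coch k ψ) (h2 : Inv N ψ) (h3 : cobd ψ = 0) :
    Coh (N ⊔ Subgroup.zpowers t) (k + 1) (sumtr (fun m : ℤ => t ^ m) (cupd H ψ))
      (c₁ • sumtr (fun m : ℤ => t ^ m) (cupd (hstep χ) ψ)) := by
  set D : S → ℤ := fun s => H s - c₀ - c₁ * hstep χ s with hDdef
  have hfin := finOn_hmul (τ := fun m : ℤ => t ^ m) (D := D) hD ψ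
  refine ⟨sumtr (fun m : ℤ => t ^ m) (hmul D ψ), by simpa using (h1.hmul D).sumtr, ?_, ?_⟩
  · rw [Inv, sup_le_iff, Subgroup.zpowers_le, mem_stab]
    refine ⟨Inv.sumtr (Inv.hmul h2 fun a ha s => ?_) fun m => zpow_mem ht m, ?_⟩
    · simp only [hDdef, hHN a ha, hstep, hN a ha]
    · have := sumtr_inv (τ := fun m : ℤ => t ^ m) (zpow_add t) (hmul D ψ) 1
      simpa using this
  · have hz : hmul D (0 : List S → ℤ) = 0 := by
      funext l; rcases l with _ | ⟨s, l⟩ <;> simp [hmul_cons]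
    rw [cobd_sumtr hfin, cobd_hmul _ _ h1.nil, h3, hz, add_zero]
    have f1 := finOn_cupd_hstep hχ ψ
    have f2 := finOn_cupd (τ := fun m : ℤ => t ^ m) hHf ψ
    have e : cupd D ψ = cupd H ψ - c₁ • cupd (hstep χ) ψ := by
      rw [← cupd_mul_left, cupd_sub_left]
      funext l
      rcases l with _ | ⟨s, _ | ⟨s₁, l⟩⟩ <;> simp [cupd_cons_cons, hDdef]
      left; ring
    have f3 : FinOn (fun m : ℤ => t ^ m) (c₁ • cupd (hstep χ) ψ) :=
      f1.map (zsmulAddGroupHom c₁)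
    rw [e, sumtr_sub f2 f3, sumtr_zsmul f1]
    abel

lemma BlockData.zpow {m : ℕ} {τ σ : (Fin m → ℤ) → G} (h : BlockData N τ σ) (a) (k : ℤ) :
    τ (k • a) = τ a ^ k := by
  let φ : Multiplicative (Fin m → ℤ) →* G :=
    { toFun := fun a => τ a.toAdd, map_one' := h.zero, map_mul' := fun a b => h.add _ _ }
  exact map_zpow φ (Multiplicative.ofAdd a) k

lemma floor_hstep_fin (t : G) (x : S → ℝ) (hx : ∀ s, x (t • s) = x s + 1) :
    (∀ s s', {m : ℤ | sg (x (t ^ m • s)) ≠ sg (x (t ^ m • s'))}.Finite) ∧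
    ∀ s, {m : ℤ | sg (x (t ^ m • s)) - (-1) - 2 * hstep (fun s => ⌊x s⌋) (t ^ m • s) ≠ 0}.Finite :=
        by
  have hz : ∀ (m : ℤ) s, x (t ^ m • s) = x s + m := by
    intro m s
    induction m using Int.induction_on with
    | zero => simp
    | succ i ih => rw [add_comm, zpow_add, zpow_one, mul_smul, hx, ih]; push_cast; ring
    | pred i ih =>
      rw [show t ^ (-(i : ℤ)) = t * t ^ (-(i : ℤ) - 1) by rw [← zpow_one_add]; congr 1; ring,
        mul_smul, hx] at ih
      push_cast at ih ⊢
      linarith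
  constructor
  · intro s s'
    refine (finite_of_abs_le (x s) |x s - x s'|).subset fun m hm => ?_
    have := abs_le_of_sg_ne hm
    rwa [hz, hz, add_sub_add_right_eq_sub] at this
  · intro s
    refine (finite_of_abs_le (x s) 0).subset fun m hm => ?_
    simp only [Set.mem_ofPred_eq, hz, hstep] at hm ⊢
    by_contra hcon
    have h0 : x s + m ≠ 0 := fun h => hcon (by rw [h]; simp)
    apply hm
    rcases lt_or_gt_of_ne h0 with h | h
    · rw [sg_neg h, if_neg]
      · simp
      · rw [Int.floor_nonneg]; linarith
    · rw [sg_pos h, if_pos (Int.floor_nonneg.2 h.le)]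
      norm_num

end Block

section Block

variable {S : Type*} {G : Type*} [Group G] [MulAction G S]
variable {N : Subgroup G} {n : ℕ}

lemma sumtr_fin_succ {m : ℕ} {τ : (Fin (m + 1) → ℤ) → G} (t : G) {τ' : (Fin m → ℤ) → G}
    (h : ∀ k a, τ (Fin.cons k a) = τ' a * t ^ k) {f : List S → ℤ} (hf : FinOn τ f) :
    sumtr τ f = sumtr (fun k : ℤ => t ^ k) (sumtr τ' f) := by
  funext l
  refine (finsum_fin_succ _ (hf l)).trans ?_
  refine finsum_congr fun k => finsum_congr fun a => ?_
  rw [h, tr_mul]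
  rfl

/-- The normalized case of the block theorem. -/
theorem block_one [Nonempty S] {m : ℕ} : ∀ {N : Subgroup G} {n : ℕ} {g : List S → ℤ},
    Fund N n g → ∀ {τ σ : (Fin m → ℤ) → G}, BlockData N τ σ → ∀ {ξ : S → Fin m → ℝ},
    Coords N τ ξ 1 → ∃ g' : List S → ℤ,
      Fund (N ⊔ Subgroup.closure (Set.range τ)) (n + m) g' ∧
      ∀ (κ : ℤ) (f : List S → ℤ), Coh N n f (κ • g) →
        Coh (N ⊔ Subgroup.closure (Set.range τ)) (n + m) (sumtr τ (cupds (signs ξ) f))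
          ((2 ^ m * κ) • g') := by
  induction m with
  | zero =>
    intro N n g hF τ σ hB ξ hξ
    have h0 : ∀ a, τ a = 1 := fun a => by rw [Subsingleton.elim a 0, hB.zero]
    have h1 : N ⊔ Subgroup.closure (Set.range τ) = N := by
      rw [sup_eq_left, Subgroup.closure_le]
      rintro _ ⟨a, rfl⟩
      rw [h0]; exact one_mem N
    rw [h1]
    refine ⟨g, hF, fun κ f hf => ?_⟩
    have : sumtr τ (cupds (signs ξ) f) = f := by
      funext l
      simp only [sumtr, signs, List.finRange_zero, List.map_nil, cupds_nil, h0, tr_one]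
      rw [finsum_unique]
    rw [this]
    simpa using hf
  | succ m ih =>
    intro N n g hF τ σ hB ξ hξ
    set ιm : (Fin m → ℤ) → (Fin (m + 1) → ℤ) := fun a => Fin.cons 0 a with hι
    have ιadd : ∀ a b, ιm (a + b) = ιm a + ιm b := by
      intro a b
      funext i
      refine Fin.cases ?_ (fun i => ?_) i <;> simp [hι]
    set e₀ : Fin (m + 1) → ℤ := Fin.cons 1 0 with he
    have hcons : ∀ (k : ℤ) (a : Fin m → ℤ), Fin.cons k a = ιm a + k • e₀ := by
      intro k a
      funext i
      refine Fin.cases ?_ (fun i => ?_) i <;> simp [hι, he]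
    set t := τ e₀ with ht
    have hB' : BlockData N (fun a => τ (ιm a)) (fun a => σ (ιm a)) :=
      ⟨fun a b => by simp only [ιadd, hB.add], fun a => hB.sq _, fun a b => hB.comm _ _,
        fun a => hB.norm _⟩
    have hcast : ∀ a : Fin m → ℤ, ∀ i, ((ιm a i : ℤ) : ℝ) =
        (Fin.cons 0 (fun i => (a i : ℝ)) : Fin (m + 1) → ℝ) i := by
      intro a i
      refine Fin.cases ?_ (fun i => ?_) i <;> simp [hι]
    have hξ' : Coords N (fun a => τ (ιm a)) (fun s => Fin.tail (ξ s)) 1 := by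
      refine ⟨fun a ha s => by simp only [hξ.inv a ha], fun a s => ?_, by simp⟩
      rw [hξ.trans]
      funext i
      simp [Fin.tail, Matrix.one_mulVec, hι]
    obtain ⟨g₁, hF₁, hg₁⟩ := ih hF hB' hξ'
    set N₁ := N ⊔ Subgroup.closure (Set.range fun a => τ (ιm a)) with hN₁
    have hσ : σ e₀ ∈ Subgroup.normalizer (N₁ : Set G) := by
      have h2 : σ e₀ ∈ Subgroup.normalizer
          ((Subgroup.closure (Set.range fun a => τ (ιm a)) : Subgroup G) : Set G) := by
        have : σ e₀ ∈ Subgroup.centralizer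
          ((Subgroup.closure (Set.range fun a => τ (ιm a)) : Subgroup G) : Set G) := by
          rw [Subgroup.centralizer_closure, Subgroup.mem_centralizer_iff]
          rintro _ ⟨a, rfl⟩
          exact (hB.comm _ _).symm
        rw [Subgroup.mem_normalizer_iff]
        intro x
        rw [Subgroup.mem_centralizer_iff] at this
        constructor
        · intro hx
          rw [← this x hx, mul_inv_cancel_right]; exact hx
        · intro hx
          have := this _ hx
          have h3 : x = σ e₀ * x * (σ e₀)⁻¹ := by
            have h4 := congrArg (fun y => (σ e₀)⁻¹ * y) this
            simp only [inv_mul_cancel_left, inv_mul_cancel_right] at h4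
            exact h4
          rw [h3]; exact hx
      exact Subgroup.normalizer_inf_normalizer_le_normalizer_sup _ _ ⟨hB.norm e₀, h2⟩
    have htn : t ∈ Subgroup.normalizer (N₁ : Set G) := by
      rw [ht, ← hB.sq]; exact mul_mem hσ hσ
    have h0N : ∀ a ∈ N₁, ∀ s, ξ (a • s) 0 = ξ s 0 := by
      intro a ha
      have : N₁ ≤
          ({ carrier := {a | ∀ s, ξ (a • s) 0 = ξ s 0}
             one_mem' := by simp
             mul_mem' := fun {a b} ha hb s => by rw [mul_smul, ha, hb]
             inv_mem' := fun {a} ha s => by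
              have := ha (a⁻¹ • s); rw [smul_inv_smul] at this; exact this.symm } : Subgroup G) :=
                  by
        rw [hN₁, sup_le_iff, Subgroup.closure_le]
        constructor
        · intro a ha s; rw [hξ.inv a ha]
        · rintro _ ⟨a, rfl⟩ s
          simp [hξ.trans, Matrix.one_mulVec, hι]
      exact this ha
    have h0t : ∀ s, ξ (t • s) 0 = ξ s 0 + 1 := by
      intro s; simp [ht, hξ.trans, Matrix.one_mulVec, he]
    have hτt : ∀ k a, τ (Fin.cons k a) = τ (ιm a) * t ^ k := by
      intro k a; rw [hcons, hB.add, hB.zpow]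
    have hNN : N ⊔ Subgroup.closure (Set.range τ) = N₁ ⊔ Subgroup.zpowers t := by
      rw [hN₁, sup_assoc]
      congr 1
      apply le_antisymm
      · rw [Subgroup.closure_le]
        rintro _ ⟨a, rfl⟩
        rw [← Fin.cons_self_tail a, hτt]
        exact Subgroup.mul_mem_sup (Subgroup.subset_closure ⟨_, rfl⟩)
          (Subgroup.zpow_mem_zpowers _ _)
      · rw [sup_le_iff, Subgroup.zpowers_le]
        refine ⟨Subgroup.closure_mono ?_, Subgroup.subset_closure ⟨_, rfl⟩⟩
        rintro _ ⟨a, rfl⟩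
        exact ⟨_, rfl⟩
    set χ : S → ℤ := fun s => ⌊ξ s 0⌋ with hχ
    have hχt : ∀ s, χ (t • s) = χ s + 1 := fun s => by simp [hχ, h0t]
    have hχN : ∀ a ∈ N₁, ∀ s, χ (a • s) = χ s := fun a ha s => by simp only [hχ, h0N a ha]
    have hsq := hF₁.sq hσ
    rw [hB.sq] at hsq
    have hFund := hF₁.step htn hχN hχt hsq
    rw [hNN]
    refine ⟨_, hFund, fun κ f hf => ?_⟩
    rw [sumtr_fin_succ t hτt (hξ.finOn f), signs_succ, cupds_cons]
    set H₀ : S → ℤ := fun s => sg (ξ s 0) with hH₀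
    have e1 : sumtr (fun a => τ (ιm a)) (cupd H₀ (cupds (signs fun s => Fin.tail (ξ s)) f)) =
        cupd H₀ (sumtr (fun a => τ (ιm a)) (cupds (signs fun s => Fin.tail (ξ s)) f)) := by
      have hfin := hξ'.finOn f
      funext l
      simp only [sumtr, tr_cupd]
      have hH : ∀ a, (fun s => H₀ (τ (ιm a) • s)) = H₀ := by
        intro a; funext s
        simp only [hH₀]
        rw [h0N _ (Subgroup.mem_sup_right (Subgroup.subset_closure ⟨a, rfl⟩))]
      simp only [hH]
      exact ((cupds_finsum [H₀] (fun a => tr (τ (ιm a))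
        (cupds (signs fun s => Fin.tail (ξ s)) f)) hfin l).2).symm
    rw [e1]
    obtain ⟨fA, fB⟩ := floor_hstep_fin t (fun s => ξ s 0) h0t
    have hH₀N : ∀ a ∈ N₁, ∀ s, H₀ (a • s) = H₀ s := fun a ha s => by simp only [hH₀, h0N a ha]
    have hcoh := hg₁ κ f hf
    have hc : Coch (n + m) ((2 ^ m * κ) • g₁) := hF₁.coch.zsmul _
    have hJ := jump htn hχN hH₀N hχt (-1) 2 fB fA hF₁.coch hF₁.inv hF₁.closed
    have hJ2 := hJ.zsmul (2 ^ m * κ)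
    refine Coh.trans ?_ (hJ2.trans ?_)
    · obtain ⟨β, b1, b2, hb⟩ := hcoh
      have f1 := finOn_cupd (τ := fun m : ℤ => t ^ m) (H := H₀) fA
      have hp := hF₁.pos
      refine ⟨-sumtr (fun k : ℤ => t ^ k) (cupd H₀ β), ?_, ?_, ?_⟩
      · have := (b1.cupd H₀).sumtr (τ := fun k : ℤ => t ^ k)
        rw [show n + m - 1 + 1 = n + m + 1 - 1 by omega] at this
        exact this.neg
      · rw [Inv, sup_le_iff, Subgroup.zpowers_le, mem_stab]
        refine ⟨(Inv.sumtr (b2.cupd hH₀N) fun m => zpow_mem htn m).neg, ?_⟩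
        have := sumtr_inv (τ := fun m : ℤ => t ^ m) (zpow_add t) (cupd H₀ β) 1
        rw [tr_neg]
        simpa using this
      · rw [hb, cupd_add, sumtr_add (f1 _) (f1 _), cupd_zsmul, sumtr_zsmul (f1 _), cobd_neg,
          cobd_sumtr (f1 _), cobd_cupd _ _ b1.nil]
        congr 1
        funext l
        simp only [sumtr, Pi.neg_apply]
        rw [← finsum_neg_distrib]
        simp [tr]
    · rw [← mul_smul, show (2 : ℤ) ^ m * κ * 2 = 2 ^ (m + 1) * κ by ring]
      exact Coh.refl _

end Block

section Block

variable {S : Type*} {G : Type*} [Group G] [MulAction G S]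
variable {N : Subgroup G} {n : ℕ}

lemma Coh.symm {f g : List S → ℤ} (h : Coh N n f g) : Coh N n g f := by
  obtain ⟨α, a1, a2, rfl⟩ := h
  exact ⟨-α, a1.neg, a2.neg, by rw [cobd_neg]; abel⟩

lemma Coh.neg_of {f g : List S → ℤ} {α : List S → ℤ} (k : ℤ) (h1 : Coch (n - 1) α)
    (h2 : Inv N α) (h : f - g = k • cobd α) : Coh N n f g :=
  ⟨k • α, h1.zsmul k, h2.zsmul k, by rw [cobd_zsmul, ← h]; abel⟩

lemma inv_sumtr_sup {m : ℕ} {τ σ : (Fin m → ℤ) → G} (hB : BlockData N τ σ) {f : List S → ℤ}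
    (hf : Inv N f) : Inv (N ⊔ Subgroup.closure (Set.range τ)) (sumtr τ f) := by
  rw [Inv, sup_le_iff, Subgroup.closure_le]
  refine ⟨Inv.sumtr hf hB.norm', ?_⟩
  rintro _ ⟨b, rfl⟩
  exact sumtr_inv hB.add f b

/-- Two sequences of points are separated by the sign of a coordinate. -/
def Sep (x : S → ℝ) (l : List S) : Prop := ∃ s ∈ l, ∃ s' ∈ l, sg (x s) ≠ sg (x s')

lemma coh_replace {m : ℕ} {τ σ : (Fin m → ℤ) → G} (hB : BlockData N τ σ)
    {ξ ξ' : S → Fin m → ℝ} (k : Fin m) (hk : ∀ s j, j ≠ k → ξ s j = ξ' s j)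
    (h1 : ∀ a ∈ N, ∀ s, ξ (a • s) = ξ s) (h2 : ∀ a ∈ N, ∀ s, ξ' (a • s) = ξ' s)
    (hfin : ∀ l : List S, {a | (∀ j, j ≠ k → Sep (fun s => ξ s j) (l.map (τ a • ·))) ∧
      ∃ s ∈ l, sg (ξ (τ a • s) k) ≠ sg (ξ' (τ a • s) k)}.Finite)
    {f : List S → ℤ} (f1 : FinOn τ (cupds (signs ξ) f)) (f2 : FinOn τ (cupds (signs ξ') f))
    (hc : Coch n f) (hi : Inv N f) (hz : cobd f = 0) :
    Coh (N ⊔ Subgroup.closure (Set.range τ)) (n + m) (sumtr τ (cupds (signs ξ) f))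
      (sumtr τ (cupds (signs ξ') f)) := by
  obtain ⟨L1, L2, hL⟩ := List.append_of_mem (List.mem_finRange k)
  have hnd := List.nodup_finRange m
  rw [hL] at hnd
  have hk1 : ∀ j ∈ L1, j ≠ k := by
    rintro j hj rfl
    rw [List.nodup_append] at hnd
    exact hnd.2.2 j hj j (by simp) rfl
  have hk2 : ∀ j ∈ L2, j ≠ k := by
    rintro j hj rfl
    rw [List.nodup_append, List.nodup_cons] at hnd
    exact hnd.2.1.1 hj
  have hmem : ∀ j, j ≠ k → j ∈ L1 ∨ j ∈ L2 := by
    intro j hj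
    have := List.mem_finRange j
    rw [hL] at this
    simpa [hj] using this
  have hlen : L1.length + L2.length + 1 = m := by
    have := congrArg List.length hL
    simp at this; omega
  set A := L1.map (fun j s => sg (ξ s j)) with hA
  set B := L2.map (fun j s => sg (ξ s j)) with hBB
  have e1 : signs ξ = A ++ (fun s => sg (ξ s k)) :: B := by simp [signs, hL, hA, hBB]
  have e2 : signs ξ' = A ++ (fun s => sg (ξ' s k)) :: B := by
    simp only [signs, hL, hA, hBB, List.map_append, List.map_cons]
    congr 1
    · exact List.map_congr_left fun j hj => by funext s; rw [hk s j (hk1 j hj)]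
    · congr 1
      exact List.map_congr_left fun j hj => by funext s; rw [hk s j (hk2 j hj)]
  set D : S → ℤ := (fun s => sg (ξ s k)) - fun s => sg (ξ' s k) with hD
  set X := cupds B f with hX
  have hXc : Coch (B.length + n) X := hc.cupds B
  have hX0 : cobd X = 0 := by
    rw [hX, cobd_cupds _ _ hc.nil, hz]
    have := cupds_zsmul B 0 f
    rw [zero_smul, zero_smul] at this
    rw [this, smul_zero]
  have hz0 : hmul D (0 : List S → ℤ) = 0 := by
    funext l; rcases l with _ | ⟨s, l⟩ <;> simp [hmul_cons]
  have hDX : cobd (hmul D X) = cupd D X := by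
    rw [cobd_hmul _ _ hXc.nil, hX0, hz0, add_zero]
  have e3 : cupds (signs ξ) f - cupds (signs ξ') f = cupds A (cupd D X) := by
    rw [e1, e2, cupds_append, cupds_append, cupds_cons, cupds_cons, ← hX, hD, ← cupd_sub_left,
      sub_eq_add_neg, sub_eq_add_neg, cupds_add]
    congr 1
    have := cupds_zsmul A (-1) (cupd (fun s => sg (ξ' s k)) X)
    simpa using this.symm
  have e4 : cupds A (cupd D X) = (-1 : ℤ) ^ A.length • cobd (cupds A (hmul D X)) := by
    rw [cobd_cupds _ _ (hXc.hmul D).nil, hDX, ← mul_smul, ← mul_pow]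
    simp
  have hfin' : FinOn τ (cupds A (hmul D X)) := by
    intro l
    refine (hfin l).subset fun a ha => ?_
    have hA' := exists_ne_of_cupds_ne_zero ha
    obtain ⟨l', hl', hne⟩ := exists_suffix_of_cupds_ne_zero ha
    rcases l' with _ | ⟨s, l'⟩
    · simp at hne
    rw [hmul_cons] at hne
    have hXne : X (s :: l') ≠ 0 := fun h => hne (by rw [h, smul_zero])
    have hDne : D s ≠ 0 := fun h => hne (by rw [h, zero_smul])
    have hB' := exists_ne_of_cupds_ne_zero hXne
    refine ⟨fun j hj => ?_, ?_⟩
    · rcases hmem j hj with h | h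
      · exact hA' (fun s => sg (ξ s j)) (List.mem_map.2 ⟨j, h, rfl⟩)
      · obtain ⟨s, hs, s', hs', hne⟩ := hB' (fun s => sg (ξ s j)) (List.mem_map.2 ⟨j, h, rfl⟩)
        exact ⟨s, hl'.subset hs, s', hl'.subset hs', hne⟩
    · have hs := hl'.subset (List.mem_cons_self (a := s) (l := l'))
      obtain ⟨s₀, hs₀, rfl⟩ := List.mem_map.1 hs
      exact ⟨s₀, hs₀, fun h => hDne (by simp [hD, h])⟩
  have hinvA : Inv N (cupds A (hmul D X)) := by
    refine Inv.cupds (Inv.hmul (Inv.cupds hi ?_) ?_) ?_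
    · intro H hH a ha s
      obtain ⟨j, -, rfl⟩ := List.mem_map.1 hH
      simp only [h1 a ha s]
    · intro a ha s
      simp only [hD, Pi.sub_apply, h1 a ha s, h2 a ha s]
    · intro H hH a ha s
      obtain ⟨j, -, rfl⟩ := List.mem_map.1 hH
      simp only [h1 a ha s]
  refine Coh.neg_of ((-1 : ℤ) ^ A.length) (α := sumtr τ (cupds A (hmul D X))) ?_
    (inv_sumtr_sup hB hinvA) ?_
  · have := ((hXc.hmul D).cupds A).sumtr (τ := τ)
    rw [show A.length + (B.length + n) = n + m - 1 by simp [hA, hBB]; omega] at this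
    exact this
  · rw [← sumtr_sub f1 f2, e3, e4, cobd_sumtr hfin', sumtr_zsmul hfin'.cobd]

variable {m : ℕ} {τ σ : (Fin m → ℤ) → G}

/-- Finiteness criterion: all coordinates are bounded at a point of a given sequence. -/
lemma Coords.finite_of_bound {ξ : S → Fin m → ℝ} {M : Matrix (Fin m) (Fin m) ℝ}
    (h : Coords N τ ξ M) (l : List S) (C : ℝ) :
    {a | ∃ s ∈ l, ∀ k, |ξ (τ a • s) k| ≤ C}.Finite := by
  obtain ⟨C₀, hC₀⟩ := exists_bound ξ l
  refine (finite_mulVec_le h.det (C + C₀)).subset ?_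
  rintro a ⟨s, hs, ha⟩ k
  have h1 := abs_le.1 (hC₀ s hs k)
  have h2 := ha k
  rw [h.trans, Pi.add_apply] at h2
  have h3 := abs_le.1 h2
  exact abs_le.2 ⟨by linarith, by linarith⟩

lemma Coords.sep_bound {ξ : S → Fin m → ℝ} {M : Matrix (Fin m) (Fin m) ℝ}
    (h : Coords N τ ξ M) {l : List S} {C : ℝ} (hC : ∀ s ∈ l, ∀ k, |ξ s k| ≤ C) {a : Fin m → ℤ}
    {k : Fin m} (hk : Sep (fun s => ξ s k) (l.map (τ a • ·))) {s : S} (hs : s ∈ l) :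
    |ξ (τ a • s) k| ≤ 4 * C := by
  have h1 := abs_le.1 (h.bound hC hk)
  have h2 := abs_le.1 (hC s hs k)
  rw [h.trans, Pi.add_apply]
  exact abs_le.2 ⟨by linarith, by linarith⟩

lemma Coords.map {ξ : S → Fin m → ℝ} {M : Matrix (Fin m) (Fin m) ℝ} (h : Coords N τ ξ M)
    {A : Matrix (Fin m) (Fin m) ℝ} (hA : A.det ≠ 0) :
    Coords N τ (fun s => A.mulVec (ξ s)) (A * M) :=
  ⟨fun a ha s => by simp only [h.inv a ha], fun a s => by
    rw [h.trans, Matrix.mulVec_add, Matrix.mulVec_mulVec], by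
    rw [Matrix.det_mul]; exact mul_ne_zero hA h.det⟩

lemma coh_offset_one {ξ ξ' : S → Fin m → ℝ} {M : Matrix (Fin m) (Fin m) ℝ}
    (hB : BlockData N τ σ) (h : Coords N τ ξ M) (h' : Coords N τ ξ' M)
    (k : Fin m) (hk : ∀ s j, j ≠ k → ξ s j = ξ' s j) {f : List S → ℤ}
    (hc : Coch n f) (hi : Inv N f) (hz : cobd f = 0) :
    Coh (N ⊔ Subgroup.closure (Set.range τ)) (n + m) (sumtr τ (cupds (signs ξ) f))
      (sumtr τ (cupds (signs ξ') f)) := by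
  refine coh_replace hB k hk h.inv h'.inv (fun l => ?_) (h.finOn f) (h'.finOn f) hc hi hz
  obtain ⟨C, hC⟩ := exists_bound ξ l
  obtain ⟨C', hC'⟩ := exists_bound ξ' l
  refine (h.finite_of_bound l (max (4 * C) (C + C'))).subset ?_
  rintro a ⟨hsep, s, hs, hne⟩
  refine ⟨s, hs, fun j => ?_⟩
  by_cases hj : j = k
  · subst hj
    have h1 := abs_le_of_sg_ne hne
    have h2 : ξ (τ a • s) j - ξ' (τ a • s) j = ξ s j - ξ' s j := by
      rw [h.trans, h'.trans]; simp
    rw [h2] at h1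
    refine h1.trans (le_max_of_le_right ?_)
    exact (abs_sub _ _).trans (add_le_add (hC s hs j) (hC' s hs j))
  · exact (h.sep_bound hC (hsep j hj) hs).trans (le_max_left _ _)

lemma coh_offset {ξ ξ' : S → Fin m → ℝ} {M : Matrix (Fin m) (Fin m) ℝ}
    (hB : BlockData N τ σ) (h : Coords N τ ξ M) (h' : Coords N τ ξ' M)
    {f : List S → ℤ} (hc : Coch n f) (hi : Inv N f) (hz : cobd f = 0) :
    Coh (N ⊔ Subgroup.closure (Set.range τ)) (n + m) (sumtr τ (cupds (signs ξ) f))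
      (sumtr τ (cupds (signs ξ') f)) := by
  have key : ∀ (T : Finset (Fin m)) (ξ : S → Fin m → ℝ), Coords N τ ξ M →
      (∀ s, ∀ j ∉ T, ξ s j = ξ' s j) →
      Coh (N ⊔ Subgroup.closure (Set.range τ)) (n + m) (sumtr τ (cupds (signs ξ) f))
        (sumtr τ (cupds (signs ξ') f)) := by
    intro T
    induction T using Finset.induction_on with
    | empty =>
      intro ξ hξ he
      have : ξ = ξ' := by funext s j; exact he s j (by simp)
      rw [this]; exact Coh.refl _
    | insert k T hk ih =>
      intro ξ hξ he
      have hξ'' : Coords N τ (fun s => Function.update (ξ s) k (ξ' s k)) M := by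
        refine ⟨fun a ha s => by simp only [hξ.inv a ha, h'.inv a ha], fun a s => ?_, h.det⟩
        funext j
        by_cases hj : j = k
        · subst hj; simp [h'.trans]
        · simp [hj, hξ.trans]
      refine (coh_offset_one hB hξ hξ'' k (fun s j hj => by simp [hj]) hc hi hz).trans ?_
      refine ih _ hξ'' fun s j hj => ?_
      by_cases hjk : j = k
      · subst hjk; simp
      · simp only [Function.update_apply, hjk, if_false]
        exact he s j (by simp [hjk, hj])
  exact key Finset.univ ξ h (fun s j hj => absurd (Finset.mem_univ j) hj)

lemma cupds_signs_smul (d : Fin m → ℝ) (ξ : S → Fin m → ℝ) (f : List S → ℤ) (L : List (Fin m)) :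
    cupds (L.map fun k s => sg (d k * ξ s k)) f =
      (L.map fun k => sg (d k)).prod • cupds (L.map fun k s => sg (ξ s k)) f := by
  induction L with
  | nil => simp
  | cons k L ih =>
    simp only [List.map_cons, cupds_cons, ih, cupd_zsmul, List.prod_cons]
    simp only [sg_mul, cupd_mul_left]
    rw [smul_smul, mul_comm]

lemma sg_one : sg 1 = 1 := sg_pos one_pos

lemma sg_prod {ι : Type*} (s : Finset ι) (x : ι → ℝ) : sg (∏ i ∈ s, x i) = ∏ i ∈ s, sg (x i) := by
  induction s using Finset.cons_induction with
  | empty => simp [sg_one]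
  | cons a s ha ih => rw [Finset.prod_cons, Finset.prod_cons, sg_mul, ih]

lemma coh_linear (hB : BlockData N τ σ) {f : List S → ℤ} (hc : Coch n f) (hi : Inv N f)
    (hz : cobd f = 0) (A : Matrix (Fin m) (Fin m) ℝ) (hA : A.det ≠ 0) :
    ∀ (ξ : S → Fin m → ℝ) (M : Matrix (Fin m) (Fin m) ℝ), Coords N τ ξ M →
    Coh (N ⊔ Subgroup.closure (Set.range τ)) (n + m)
      (sumtr τ (cupds (signs fun s => A.mulVec (ξ s)) f))
      (sg A.det • sumtr τ (cupds (signs ξ) f)) := by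
  refine Matrix.diagonal_transvection_induction_of_det_ne_zero (fun A => ∀ (ξ : S → Fin m → ℝ)
    (M : Matrix (Fin m) (Fin m) ℝ), Coords N τ ξ M →
    Coh (N ⊔ Subgroup.closure (Set.range τ)) (n + m)
      (sumtr τ (cupds (signs fun s => A.mulVec (ξ s)) f))
      (sg A.det • sumtr τ (cupds (signs ξ) f))) A hA ?_ ?_ ?_
  · intro d hd ξ M h
    have : cupds (signs fun s => (Matrix.diagonal d).mulVec (ξ s)) f =
        sg (Matrix.diagonal d).det • cupds (signs ξ) f := by
      simp only [signs, Matrix.mulVec_diagonal, cupds_signs_smul, Matrix.det_diagonal, sg_prod]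
      rw [← List.ofFn_eq_map, List.prod_ofFn]
    rw [this, sumtr_zsmul (h.finOn f)]
    exact Coh.refl _
  · rintro ⟨i, j, hij, c⟩ ξ M h
    rw [Matrix.TransvectionStruct.toMatrix_mk]
    have hdet : (Matrix.transvection i j c).det = 1 := Matrix.det_transvection_of_ne i j hij c
    rw [hdet, sg_one, one_smul]
    have h' := h.map (A := Matrix.transvection i j c) (by rw [hdet]; exact one_ne_zero)
    have hval : ∀ s k, (Matrix.transvection i j c).mulVec (ξ s) k =
        ξ s k + if k = i then c * ξ s j else 0 := by
      intro s k
      rw [Matrix.transvection, Matrix.add_mulVec, Matrix.one_mulVec, Pi.add_apply]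
      congr 1
      rw [Matrix.single_mulVec]
      by_cases hk : k = i
      · subst hk; simp
      · simp [hk]
    refine Coh.symm (coh_replace hB i (fun s k hk => by rw [hval, if_neg hk, add_zero]) h.inv h'.inv
      (fun l => ?_) (h.finOn f) (h'.finOn f) hc hi hz)
    obtain ⟨C, hC⟩ := exists_bound ξ l
    refine (h.finite_of_bound l (max (4 * C) (|c| * (4 * C)))).subset ?_
    rintro a ⟨hsep, s, hs, hne⟩
    refine ⟨s, hs, fun k => ?_⟩
    by_cases hk : k = i
    · subst hk
      have h1 := abs_le_of_sg_ne hne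
      rw [hval, if_pos rfl, sub_add_cancel_left, abs_neg, abs_mul] at h1
      refine h1.trans (le_max_of_le_right ?_)
      exact mul_le_mul_of_nonneg_left (h.sep_bound hC (hsep j hij.symm) hs) (abs_nonneg _)
    · exact (h.sep_bound hC (hsep k hk) hs).trans (le_max_left _ _)
  · intro A B hA hB' ihA ihB ξ M h
    have h1 := ihA _ _ (h.map hB')
    have h2 := (ihB ξ M h).zsmul (sg A.det)
    rw [Matrix.det_mul, sg_mul, mul_smul]
    simp only [Matrix.mulVec_mulVec] at h1
    exact h1.trans h2

/-- The sum over a subgroup. -/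
noncomputable def SN (N : Subgroup G) (f : List S → ℤ) : List S → ℤ :=
  sumtr (Subtype.val : N → G) f

/-- Finiteness of the sum over a subgroup. -/
def FS (N : Subgroup G) (f : List S → ℤ) : Prop := FinOn (Subtype.val : N → G) f

lemma BlockData.mem_sup_iff (hB : BlockData N τ σ) (x : G) :
    x ∈ N ⊔ Subgroup.closure (Set.range τ) ↔ ∃ y ∈ N, ∃ a, y * τ a = x := by
  let φ : Multiplicative (Fin m → ℤ) →* G :=
    { toFun := fun a => τ a.toAdd, map_one' := hB.zero, map_mul' := fun a b => hB.add _ _ }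
  have h1 : Subgroup.closure (Set.range τ) = φ.range := by
    rw [show Set.range τ = (φ.range : Set G) from rfl, Subgroup.closure_eq]
  rw [h1]
  have h2 : φ.range ≤ Subgroup.normalizer (N : Set G) := by
    rintro _ ⟨a, rfl⟩; exact hB.norm' _
  rw [← SetLike.mem_coe, Subgroup.coe_mul_of_right_le_normalizer_left _ _ h2, Set.mem_mul]
  constructor
  · rintro ⟨y, hy, _, ⟨a, rfl⟩, rfl⟩; exact ⟨y, hy, a.toAdd, rfl⟩
  · rintro ⟨y, hy, a, rfl⟩; exact ⟨y, hy, τ a, ⟨Multiplicative.ofAdd a, rfl⟩, rfl⟩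

/-- Parametrization of the extended group. -/
noncomputable def blockEquiv [Nonempty S] (hB : BlockData N τ σ) {ξ : S → Fin m → ℝ}
    {M : Matrix (Fin m) (Fin m) ℝ} (h : Coords N τ ξ M) :
    (Fin m → ℤ) × N ≃ ↥(N ⊔ Subgroup.closure (Set.range τ)) :=
  Equiv.ofBijective (fun p => ⟨p.2 * τ p.1, (hB.mem_sup_iff _).2 ⟨_, p.2.2, _, rfl⟩⟩) (by
    constructor
    · rintro ⟨a, y⟩ ⟨b, z⟩ hab
      simp only [Subtype.mk.injEq] at hab
      obtain ⟨s⟩ := ‹Nonempty S›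
      have h1 := congrArg (fun x : G => ξ (x • s)) hab
      simp only [mul_smul] at h1
      rw [h.inv _ y.2, h.inv _ z.2, h.trans, h.trans] at h1
      have h2 := Matrix.mulVec_injective_of_isUnit
        ((Matrix.isUnit_iff_isUnit_det _).2 (isUnit_iff_ne_zero.2 h.det)) (add_left_cancel h1)
      have h3 : a = b := by
        funext i; have := congrFun h2 i; simpa using this
      subst h3
      exact Prod.ext rfl (Subtype.ext (mul_right_cancel hab))
    · rintro ⟨x, hx⟩
      obtain ⟨y, hy, a, rfl⟩ := (hB.mem_sup_iff _).1 hx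
      exact ⟨(a, ⟨y, hy⟩), rfl⟩)

lemma SN_block [Nonempty S] (hB : BlockData N τ σ) {ξ : S → Fin m → ℝ}
    {M : Matrix (Fin m) (Fin m) ℝ} (h : Coords N τ ξ M) {φ : List S → ℤ} (hφ : FS N φ) :
    FS (N ⊔ Subgroup.closure (Set.range τ)) (cupds (signs ξ) φ) ∧
    SN (N ⊔ Subgroup.closure (Set.range τ)) (cupds (signs ξ) φ) =
      sumtr τ (cupds (signs ξ) (SN N φ)) := by
  have htr : ∀ p : (Fin m → ℤ) × N, tr (blockEquiv hB h p : G) (cupds (signs ξ) φ) =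
      tr (τ p.1) (cupds (signs ξ) (tr (p.2 : G) φ)) := by
    intro p
    change tr ((p.2 : G) * τ p.1) _ = _
    rw [tr_mul, tr_cupds (p.2 : G)]
    congr 2
    conv_rhs => rw [← List.map_id (signs ξ)]
    refine List.map_congr_left fun H hH => ?_
    funext s
    exact signs_inv h.inv H hH _ p.2.2 s
  have hin : ∀ l, (Function.support fun i : N => cupds (signs ξ) (tr (i : G) φ) l).Finite ∧ _ :=
    fun l => cupds_finsum (signs ξ) (fun i : N => tr (i : G) φ) hφ l
  have hfin : ∀ l, (Function.support fun p : (Fin m → ℤ) × N =>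
      tr (τ p.1) (cupds (signs ξ) (tr (p.2 : G) φ)) l).Finite := by
    intro l
    refine Set.Finite.subset (Set.Finite.biUnion (h.finite l) fun a _ =>
      ((Set.finite_singleton a).prod (hin (l.map (τ a • ·))).1)) ?_
    rintro ⟨a, y⟩ hp
    simp only [Set.mem_iUnion]
    refine ⟨a, fun k => exists_ne_of_cupds_ne_zero hp (fun s => sg (ξ s k)) (by simp [signs]),
      ⟨rfl, hp⟩⟩
  constructor
  · intro l
    have := (hfin l).image (blockEquiv hB h)
    refine this.subset fun x hx => ?_
    refine ⟨(blockEquiv hB h).symm x, ?_, by simp⟩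
    rw [Function.mem_support, ← htr, Equiv.apply_symm_apply]
    exact hx
  · funext l
    simp only [SN, sumtr]
    rw [← finsum_comp_equiv (blockEquiv hB h)]
    simp only [htr]
    rw [finsum_curry _ (hfin l)]
    refine finsum_congr fun a => ?_
    exact ((hin (l.map (τ a • ·))).2).symm

/-- The block theorem. -/
theorem block [Nonempty S] {g : List S → ℤ} (hF : Fund N n g) (hB : BlockData N τ σ)
    {ξ₁ : S → Fin m → ℝ} {M₁ : Matrix (Fin m) (Fin m) ℝ} (h₁ : Coords N τ ξ₁ M₁) :
    ∃ g' : List S → ℤ, Fund (N ⊔ Subgroup.closure (Set.range τ)) (n + m) g' ∧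
      ∀ (ξ : S → Fin m → ℝ) (M : Matrix (Fin m) (Fin m) ℝ), Coords N τ ξ M →
      ∀ (φ : List S → ℤ) (κ : ℤ), FS N φ → Coh N n (SN N φ) (κ • g) →
        FS (N ⊔ Subgroup.closure (Set.range τ)) (cupds (signs ξ) φ) ∧
        Coh (N ⊔ Subgroup.closure (Set.range τ)) (n + m)
          (SN (N ⊔ Subgroup.closure (Set.range τ)) (cupds (signs ξ) φ))
          ((2 ^ m * sg M.det * κ) • g') := by
  have hinv : ∀ {M : Matrix (Fin m) (Fin m) ℝ}, M.det ≠ 0 → M⁻¹.det ≠ 0 := by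
    intro M hM
    exact (Matrix.isUnit_nonsing_inv_det M (isUnit_iff_ne_zero.2 hM)).ne_zero
  have hnorm : ∀ {ξ : S → Fin m → ℝ} {M : Matrix (Fin m) (Fin m) ℝ}, Coords N τ ξ M →
      Coords N τ (fun s => M⁻¹.mulVec (ξ s)) 1 := by
    intro ξ M h
    have := h.map (hinv h.det)
    rwa [Matrix.nonsing_inv_mul _ (isUnit_iff_ne_zero.2 h.det)] at this
  obtain ⟨g', hF', hg'⟩ := block_one hF hB (hnorm h₁)
  refine ⟨g', hF', fun ξ M h φ κ hφ hcoh => ?_⟩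
  obtain ⟨hfs, heq⟩ := SN_block hB h hφ
  refine ⟨hfs, ?_⟩
  rw [heq]
  set f := SN N φ
  have hc : Coch n f := hcoh.coch hF.pos (hF.coch.zsmul κ)
  have hi : Inv N f := hcoh.inv (hF.inv.zsmul κ)
  have hz : cobd f = 0 := hcoh.closed (by rw [cobd_zsmul, hF.closed, smul_zero])
  have c1 := coh_linear hB hc hi hz M h.det _ _ (hnorm h)
  have e1 : (fun s => M.mulVec (M⁻¹.mulVec (ξ s))) = ξ := by
    funext s
    rw [Matrix.mulVec_mulVec, Matrix.mul_nonsing_inv _ (isUnit_iff_ne_zero.2 h.det),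
      Matrix.one_mulVec]
  rw [e1] at c1
  have c2 := (coh_offset hB (hnorm h) (hnorm h₁) hc hi hz).zsmul (sg M.det)
  have c3 := (hg' κ f hcoh).zsmul (sg M.det)
  have := (c1.trans c2).trans c3
  rw [smul_smul, show sg M.det * (2 ^ m * κ) = 2 ^ m * sg M.det * κ by ring] at this
  exact this

end Block

section Bridge

lemma cobd_ofFn {S M : Type*} [AddCommGroup M] : ∀ {n : ℕ} (f : List S → M) (v : Fin (n + 1) → S),
    cobd f (List.ofFn v) = ∑ i : Fin (n + 1), (-1 : ℤ) ^ (i : ℕ) • f (List.ofFn (v ∘ i.succAbove))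
        := by
  intro n
  induction n with
  | zero => intro f v; simp [cobd_cons]
  | succ n ih =>
    intro f v
    rw [List.ofFn_succ, cobd_cons, ih, sub_eq_add_neg, ← Finset.sum_neg_distrib]
    conv_rhs => rw [Fin.sum_univ_succ]
    congr 1
    · simp [Function.comp_def]
    · refine Finset.sum_congr rfl fun i _ => ?_
      rw [List.ofFn_succ (f := v ∘ i.succ.succAbove)]
      simp only [Function.comp_def, Fin.succ_succAbove_zero, Fin.succ_succAbove_succ, Fin.val_succ,
        pow_succ]
      simp

variable {Γ : Type} [Group Γ]

/-- The inhomogeneous cochain of a homogeneous one. -/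
def inhom (c : List Γ → ℚ) (n : ℕ) : (Fin n → Γ) → ℚ := fun g => c (List.ofFn (Fin.partialProd g))

lemma inv_smul_ofFn {c : List Γ → ℚ} (hc : Inv (⊤ : Subgroup Γ) c) (a : Γ) {n : ℕ}
    (v : Fin n → Γ) : c (List.ofFn fun i => a * v i) = c (List.ofFn v) := by
  have := congrFun (mem_stab.1 (hc (Subgroup.mem_top a))) (List.ofFn v)
  rw [← this]
  simp only [tr, List.map_ofFn, Function.comp_def, smul_eq_mul]

lemma d_inhom {c : List Γ → ℚ} (hc : Inv (⊤ : Subgroup Γ) c) (n : ℕ) (g : Fin (n + 1) → Γ) :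
    inhomogeneousCochains.d (Rep.trivial ℚ Γ ℚ) n (inhom c n) g = inhom (cobd c) (n + 1) g := by
  rw [inhomogeneousCochains.d_hom_apply]
  simp only [inhom]
  conv_rhs => rw [cobd_ofFn, Fin.sum_univ_succ]
  congr 1
  · have h1 : (Fin.partialProd g ∘ Fin.succAbove 0) =
        fun i => g 0 * Fin.partialProd (fun i => g i.succ) i := by
      funext i
      simp only [Function.comp_apply, Fin.succAbove_zero]
      exact Fin.partialProd_succ' g i
    rw [h1, inv_smul_ofFn hc]
    simp
  · refine Finset.sum_congr rfl fun j _ => ?_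
    rw [Fin.partialProd_contractNth]
    simp

/-- The homogeneous cochain of an inhomogeneous one. -/
noncomputable def hom (m : ℕ) (β : (Fin m → Γ) → ℚ) : List Γ → ℚ := fun l =>
  if h : l.length = m + 1 then
    β fun i => (l.get (i.castSucc.cast h.symm))⁻¹ * l.get (i.succ.cast h.symm)
  else 0

lemma hom_ofFn (m : ℕ) (β : (Fin m → Γ) → ℚ) (v : Fin (m + 1) → Γ) :
    hom m β (List.ofFn v) = β fun i => (v i.castSucc)⁻¹ * v i.succ := by
  rw [hom, dif_pos (List.length_ofFn)]
  simp [-List.ofFn_succ]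
  rfl

lemma coch_hom (m : ℕ) (β : (Fin m → Γ) → ℚ) : Coch (m + 1) (hom m β) := by
  intro l h
  have : l.length = m + 1 := by by_contra h'; simp [hom, h'] at h
  exact ⟨this, by rintro rfl; simp at this⟩

lemma inv_hom (m : ℕ) (β : (Fin m → Γ) → ℚ) : Inv (⊤ : Subgroup Γ) (hom m β) := by
  intro a _
  rw [mem_stab]; funext l
  simp [tr, hom, mul_assoc]

lemma inhom_hom (m : ℕ) (β : (Fin m → Γ) → ℚ) : inhom (hom m β) m = β := by
  funext g
  simp only [inhom, hom_ofFn, Fin.partialProd_right_inv]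

lemma eq_zero_of_inhom {m : ℕ} {c : List Γ → ℚ} (hc : Coch (m + 1) c)
    (hi : Inv (⊤ : Subgroup Γ) c) (h : inhom c m = 0) : c = 0 := by
  funext l
  by_contra hl
  obtain ⟨h1, -⟩ := hc l hl
  obtain ⟨v, rfl⟩ : ∃ v : Fin (m + 1) → Γ, l = List.ofFn v :=
    ⟨fun i => l.get (i.cast h1.symm), by
      apply List.ext_get <;> simp [h1, -List.ofFn_succ]⟩
  apply hl
  have h2 := Fin.partialProd_left_inv v
  rw [← h2]
  have h3 := inv_smul_ofFn hi (v 0) (Fin.partialProd fun i : Fin m => (v i.castSucc)⁻¹ * v i.succ)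
  refine Eq.trans ?_ (h3.trans (congrFun h _))
  rfl

open CategoryTheory in
lemma exists_of_π_eq_zero {m : ℕ} {A : Rep ℚ Γ} (z : groupCohomology.cocycles A (m + 1))
    (h : groupCohomology.π A (m + 1) z = 0) :
    ∃ β : (Fin m → Γ) → A, inhomogeneousCochains.d A m β = groupCohomology.iCocycles A (m + 1) z :=
        by
  set C := groupCohomology.inhomogeneousCochains A
  have hex := ShortComplex.exact_of_g_is_cokernel
    (ShortComplex.mk (C.toCycles m (m + 1)) (C.homologyπ (m + 1)) (by simp))
    (C.homologyIsCokernel m (m + 1) (by simp))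
  rw [ShortComplex.moduleCat_exact_iff] at hex
  obtain ⟨β, hβ⟩ := hex z h
  refine ⟨β, ?_⟩
  have h1 : C.d m (m + 1) β = C.iCycles (m + 1) (C.toCycles m (m + 1) β) := by
    rw [← ConcreteCategory.comp_apply, HomologicalComplex.toCycles_i]
  rw [← groupCohomology.inhomogeneousCochains.d_def]
  exact h1.trans (congrArg _ hβ)

/-- Linear independence of cohomology classes of homogeneous cocycles. -/
theorem card_le_rank {ι : Type} [Fintype ι] {m : ℕ} (c : ι → List Γ → ℚ)
    (hc : ∀ i, Coch (m + 2) (c i)) (hi : ∀ i, Inv (⊤ : Subgroup Γ) (c i))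
    (hz : ∀ i, cobd (c i) = 0)
    (hind : ∀ (a : ι → ℚ) (β : List Γ → ℚ), Coch (m + 1) β → Inv (⊤ : Subgroup Γ) β →
      ∑ i, a i • c i = cobd β → a = 0) :
    (Fintype.card ι : Cardinal) ≤
      Module.rank ℚ (groupCohomology (Rep.trivial ℚ Γ ℚ) (m + 1)) := by
  have hd : ∀ i, inhomogeneousCochains.d (Rep.trivial ℚ Γ ℚ) (m + 1) (inhom (c i) (m + 1)) = 0 := by
    intro i; funext g
    rw [d_inhom (hi i), hz i]; rfl
  let z : ι → groupCohomology.cocycles (Rep.trivial ℚ Γ ℚ) (m + 1) := fun i =>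
    groupCohomology.cocyclesMk (inhom (c i) (m + 1)) (hd i)
  let y : ι → groupCohomology (Rep.trivial ℚ Γ ℚ) (m + 1) := fun i =>
    groupCohomology.π _ _ (z i)
  have hy : LinearIndependent ℚ y := by
    rw [Fintype.linearIndependent_iff]
    intro a ha
    have h1 : groupCohomology.π (Rep.trivial ℚ Γ ℚ) (m + 1) (∑ i, a i • z i) = 0 := by
      rw [← ha, map_sum]
      exact Finset.sum_congr rfl fun i _ => map_smul _ _ _
    obtain ⟨β, hβ⟩ := exists_of_π_eq_zero _ h1
    have h2 : groupCohomology.iCocycles (Rep.trivial ℚ Γ ℚ) (m + 1) (∑ i, a i • z i) =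
        ∑ i, a i • inhom (c i) (m + 1) := by
      rw [map_sum]
      refine Finset.sum_congr rfl fun i _ => ?_
      rw [map_smul]
      congr 1
      exact groupCohomology.iCocycles_mk _ _
    rw [h2] at hβ
    have hsc : Coch (m + 2) (∑ i, a i • c i) := by
      refine Finset.sum_induction _ (Coch (m + 2)) (fun _ _ h h' => h.add h') Coch.zero ?_
      intro i _
      exact (hc i).map (DistribSMul.toAddMonoidHom ℚ (a i))
    have hsi : Inv (⊤ : Subgroup Γ) (∑ i, a i • c i) := by
      refine Finset.sum_induction _ (Inv ⊤) (fun _ _ h h' => h.add h') Inv.zero ?_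
      intro i _
      exact (hi i).map (DistribSMul.toAddMonoidHom ℚ (a i))
    have h3 : ∑ i, a i • c i - cobd (hom m β) = 0 := by
      refine eq_zero_of_inhom (m := m + 1) (hsc.sub (coch_hom m β).cobd)
        (hsi.sub (inv_hom m β).cobd) ?_
      funext g
      have h4 := congrFun hβ g
      have h5 := d_inhom (inv_hom m β) m g
      rw [inhom_hom] at h5
      rw [h5] at h4
      have h6 : inhom (∑ i, a i • c i) (m + 1) g = (∑ i, a i • inhom (c i) (m + 1)) g := by
        simp [inhom, Finset.sum_apply]
      change inhom (∑ i, a i • c i) (m + 1) g - inhom (cobd (hom m β)) (m + 1) g = 0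
      rw [h6, h4, sub_self]
    exact fun i => congrFun (hind a _ (coch_hom m β) (inv_hom m β) (sub_eq_zero.1 h3)) i
  exact hy.cardinal_le_rank.trans' (by simp)

/-- The same, for a free action. -/
theorem card_le_rank_of_free {S : Type} [Nonempty S] [MulAction Γ S]
    (hfree : ∀ (a : Γ) (s : S), a • s = s → a = 1)
    {ι : Type} [Fintype ι] {m : ℕ} (c : ι → List S → ℚ)
    (hc : ∀ i, Coch (m + 2) (c i)) (hi : ∀ i, Inv (⊤ : Subgroup Γ) (c i))
    (hz : ∀ i, cobd (c i) = 0)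
    (hind : ∀ (a : ι → ℚ) (β : List S → ℚ), Coch (m + 1) β → Inv (⊤ : Subgroup Γ) β →
      ∑ i, a i • c i = cobd β → a = 0) :
    (Fintype.card ι : Cardinal) ≤
      Module.rank ℚ (groupCohomology (Rep.trivial ℚ Γ ℚ) (m + 1)) := by
  obtain ⟨y₀⟩ := ‹Nonempty S›
  have hex : ∀ s : S, ∃ a : Γ, a • (Quotient.out (Quotient.mk (MulAction.orbitRel Γ S) s)) = s := by
    intro s
    have : (MulAction.orbitRel Γ S) (Quotient.out (Quotient.mk (MulAction.orbitRel Γ S) s)) s :=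
      Quotient.mk_out s
    obtain ⟨a, ha⟩ := (MulAction.orbitRel Γ S).symm this
    exact ⟨a, ha⟩
  choose ρ hρ using hex
  have hρe : ∀ (a : Γ) s, ρ (a • s) = a * ρ s := by
    intro a s
    have h1 := hρ (a • s)
    have h2 : Quotient.mk (MulAction.orbitRel Γ S) (a • s) = Quotient.mk _ s :=
      Quotient.sound ⟨a, rfl⟩
    rw [h2] at h1
    have h3 := hρ s
    set t := Quotient.out (Quotient.mk (MulAction.orbitRel Γ S) s)
    have h4 : ((a * ρ s)⁻¹ * ρ (a • s)) • t = t := by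
      rw [mul_smul, h1, inv_smul_eq_iff, mul_smul, h3]
    exact (inv_mul_eq_one.1 (hfree _ _ h4)).symm
  have hcomp : ∀ (f : List S → ℚ), Inv (⊤ : Subgroup Γ) f →
      Inv (⊤ : Subgroup Γ) (fun l : List Γ => f (l.map (· • y₀))) := by
    intro f hf a _
    rw [mem_stab]; funext l
    have := congrFun (mem_stab.1 (hf (Subgroup.mem_top a))) (l.map (· • y₀))
    simp only [tr, List.map_map] at this ⊢
    rw [← this]
    congr 2
    funext x
    simp [mul_smul]
  refine card_le_rank (fun i l => c i (l.map (· • y₀))) (fun i => (hc i).comp _)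
    (fun i => hcomp _ (hi i)) (fun i => ?_) fun a β hβ hβi h => ?_
  · funext l
    rw [cobd_comp (fun x : Γ => x • y₀), hz]; rfl
  · set c' : List S → ℚ := ∑ i, a i • c i with hc'
    have hc'z : cobd c' = 0 := by
      rw [hc', cobd_sum]
      exact Finset.sum_eq_zero fun i _ => by rw [cobd_smul, hz, smul_zero]
    have hc'c : Coch (m + 2) c' := by
      refine Finset.sum_induction _ (Coch (m + 2)) (fun _ _ h h' => h.add h') Coch.zero ?_
      intro i _
      exact (hc i).map (DistribSMul.toAddMonoidHom ℚ (a i))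
    have hc'i : Inv (⊤ : Subgroup Γ) c' := by
      refine Finset.sum_induction _ (Inv ⊤) (fun _ _ h h' => h.add h') Inv.zero ?_
      intro i _
      exact (hi i).map (DistribSMul.toAddMonoidHom ℚ (a i))
    have hcx : (fun l : List Γ => c' (l.map (· • y₀))) = cobd β := by
      rw [← h]; funext l; simp [hc', Finset.sum_apply]
    set u : S → S := fun s => ρ s • y₀ with hu
    refine hind a ((fun l => β (l.map ρ)) - prism id u c') ?_ ?_ ?_
    · exact (hβ.comp ρ).sub (hc'c.prism (by omega) _ _)
    · refine Inv.sub ?_ ?_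
      · intro b _
        rw [mem_stab]; funext l
        have := congrFun (mem_stab.1 (hβi (Subgroup.mem_top b))) (l.map ρ)
        simp only [tr, List.map_map] at this ⊢
        rw [← this]
        congr 2
        funext x
        simp [hρe]
      · intro b _
        rw [mem_stab]; funext l
        have h1 := prism_equivariant b id u (fun s => rfl)
          (fun s => by simp only [hu, hρe, mul_smul]) c' l
        have h2 : (fun l => c' (l.map (b • ·))) = c' := mem_stab.1 (hc'i (Subgroup.mem_top b))
        rw [h2] at h1
        exact h1
    · rw [← hc', cobd_sub]
      funext l
      have h1 := prism_formula id u c' l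
      have hp : prism id u (cobd c') l = 0 := by
        rw [hc'z]
        have := prism_sub id u (0 : List S → ℚ) 0
        rw [sub_zero] at this
        have := congrFun this l
        simp only [Pi.sub_apply] at this
        linarith
      rw [hp, add_zero, List.map_id] at h1
      have h2 : cobd (fun l => β (l.map ρ)) l = cobd β (l.map ρ) := cobd_comp ρ β l
      have h3 := congrFun hcx (l.map ρ)
      simp only [List.map_map] at h3
      have h4 : c' (l.map u) = cobd β (l.map ρ) := h3
      rw [Pi.sub_apply, h2, ← h1, h4]
      ring

end Bridge

section Blocks

variable {S : Type*} {G : Type*} [Group G] [MulAction G S] {ι : Type*} {m : ℕ}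

/-- The subgroup generated by `N` and a list of blocks. -/
def blockGroup (N : Subgroup G) (τ : ι → (Fin m → ℤ) → G) (L : List ι) : Subgroup G :=
  L.foldr (fun i N => N ⊔ Subgroup.closure (Set.range (τ i))) N

/-- The iterated cup product over a list of blocks of coordinates. -/
noncomputable def blockCup (ξ : ι → S → Fin m → ℝ) (L : List ι) (φ : List S → ℤ) : List S → ℤ :=
  L.foldr (fun i ψ => cupds (signs (ξ i)) ψ) φ

@[simp] lemma blockGroup_nil (N : Subgroup G) (τ : ι → (Fin m → ℤ) → G) :
    blockGroup N τ [] = N := rfl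
@[simp] lemma blockGroup_cons (N : Subgroup G) (τ : ι → (Fin m → ℤ) → G) (i L) :
    blockGroup N τ (i :: L) = blockGroup N τ L ⊔ Subgroup.closure (Set.range (τ i)) := rfl
@[simp] lemma blockCup_nil (ξ : ι → S → Fin m → ℝ) (φ : List S → ℤ) : blockCup ξ [] φ = φ := rfl
@[simp] lemma blockCup_cons (ξ : ι → S → Fin m → ℝ) (i L) (φ : List S → ℤ) :
    blockCup ξ (i :: L) φ = cupds (signs (ξ i)) (blockCup ξ L φ) := rfl

lemma blockGroup_le_iff {N N' : Subgroup G} {τ : ι → (Fin m → ℤ) → G} {L : List ι} :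
    blockGroup N τ L ≤ N' ↔ N ≤ N' ∧ ∀ i ∈ L, ∀ a, τ i a ∈ N' := by
  induction L with
  | nil => simp
  | cons i L ih =>
    rw [blockGroup_cons, sup_le_iff, ih, Subgroup.closure_le]
    simp [Set.range_subset_iff]
    tauto

lemma blockCup_eq_cupds (ξ : ι → S → Fin m → ℝ) (L : List ι) (φ : List S → ℤ) :
    blockCup ξ L φ = cupds (L.flatMap fun i => signs (ξ i)) φ := by
  induction L with
  | nil => rfl
  | cons i L ih => rw [blockCup_cons, ih, List.flatMap_cons, cupds_append]

theorem blocks [Nonempty S] {N : Subgroup G} {n : ℕ} {τ σ : ι → (Fin m → ℤ) → G}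
    (L : List ι)
    (hB : ∀ i L', i :: L' <:+ L → BlockData (blockGroup N τ L') (τ i) (σ i))
    {ξ₁ : ι → S → Fin m → ℝ} {M₁ : ι → Matrix (Fin m) (Fin m) ℝ}
    (h₁ : ∀ i L', i :: L' <:+ L → Coords (blockGroup N τ L') (τ i) (ξ₁ i) (M₁ i))
    {g : List S → ℤ} (hF : Fund N n g) :
    ∃ g' : List S → ℤ, Fund (blockGroup N τ L) (n + m * L.length) g' ∧
      ∀ (ξ : ι → S → Fin m → ℝ) (M : ι → Matrix (Fin m) (Fin m) ℝ),
      (∀ i L', i :: L' <:+ L → Coords (blockGroup N τ L') (τ i) (ξ i) (M i)) →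
      ∀ (φ : List S → ℤ) (κ : ℤ), FS N φ → Coh N n (SN N φ) (κ • g) →
        FS (blockGroup N τ L) (blockCup ξ L φ) ∧
        Coh (blockGroup N τ L) (n + m * L.length) (SN (blockGroup N τ L) (blockCup ξ L φ))
          (((L.map fun i => 2 ^ m * sg (M i).det).prod * κ) • g') := by
  induction L with
  | nil => exact ⟨g, by simpa using hF, fun ξ M _ φ κ h1 h2 => ⟨h1, by simpa using h2⟩⟩
  | cons i L ih =>
    obtain ⟨g₁, hF₁, H₁⟩ := ih (fun j L' h => hB j L' (h.trans (List.suffix_cons i L)))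
      (fun j L' h => h₁ j L' (h.trans (List.suffix_cons i L)))
    obtain ⟨g₂, hF₂, H₂⟩ := block hF₁ (hB i L List.suffix_rfl) (h₁ i L List.suffix_rfl)
    have e : n + m * L.length + m = n + m * (i :: L).length := by
      rw [List.length_cons, mul_add, mul_one, add_assoc]
    rw [e] at hF₂ H₂
    refine ⟨g₂, hF₂, fun ξ M h φ κ h1 h2 => ?_⟩
    obtain ⟨h3, h4⟩ := H₁ ξ M (fun j L' h' => h j L' (h'.trans (List.suffix_cons i L))) φ κ h1 h2
    have h5 := H₂ (ξ i) (M i) (h i L List.suffix_rfl) _ _ h3 h4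
    rw [List.map_cons, List.prod_cons, mul_assoc]
    exact h5

end Blocks

section Duality

variable {S : Type*} {G : Type*} [Group G] [MulAction G S]

lemma cobd_truncate (k : ℕ) (α : List S → ℚ) (l : List S) :
    cobd (fun l' => if l'.length = k then α l' else 0) l =
      if l.length = k + 1 then cobd α l else 0 := by
  induction l generalizing k α with
  | nil => simp
  | cons s l ih =>
    simp only [cobd_cons, List.length_cons, add_left_inj]
    rcases k with _ | k
    · have : (fun l' : List S => if l'.length + 1 = 0 then α (s :: l') else 0) = 0 := by
        funext l'; simp
      rw [this, cobd_zero]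
      by_cases h : l.length = 0
      · have : l = [] := List.length_eq_zero_iff.1 h
        subst this; simp
      · simp [h]
    · have := ih k (fun l' => α (s :: l'))
      simp only [add_left_inj] at this ⊢
      rw [this]
      split_ifs <;> simp

/-- A cochain which is not the coboundary of an invariant cochain is detected by a finite cycle. -/
theorem exists_chain {N : Subgroup G} {n : ℕ} (hn : n ≠ 0) {g : List S → ℚ} (hg : Coch (n + 1) g)
    (h : ∀ α : List S → ℚ, Coch n α → Inv N α → g ≠ cobd α) :
    ∃ z : List S →₀ ℚ, (∀ α : List S → ℚ, Inv N α →
        Finsupp.linearCombination ℚ (cobd α) z = 0) ∧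
      Finsupp.linearCombination ℚ g z ≠ 0 := by
  classical
  let P : Submodule ℚ (List S →₀ ℚ) := Submodule.span ℚ
    {x | ∃ a ∈ N, ∃ l : List S, x = Finsupp.single (l.map (a • ·)) 1 - Finsupp.single l 1}
  let δ : List S → (List S →₀ ℚ) ⧸ P := fun l => P.mkQ (Finsupp.single l 1)
  let bd : (List S →₀ ℚ) →ₗ[ℚ] (List S →₀ ℚ) ⧸ P := Finsupp.linearCombination ℚ (cobd δ)
  have hδ : ∀ a ∈ N, ∀ l : List S, δ (l.map (a • ·)) = δ l := by
    intro a ha l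
    rw [← sub_eq_zero]
    simp only [δ, ← map_sub]
    rw [Submodule.mkQ_apply, Submodule.Quotient.mk_eq_zero]
    exact Submodule.subset_span ⟨a, ha, l, rfl⟩
  by_contra! hz
  have key : ∀ z ∈ LinearMap.ker bd, Finsupp.linearCombination ℚ g z = 0 := by
    intro z hzk
    refine hz z fun α hα => ?_
    have hP : P ≤ LinearMap.ker (Finsupp.linearCombination ℚ α) := by
      rw [Submodule.span_le]
      rintro x ⟨a, ha, l, rfl⟩
      have := congrFun (mem_stab.1 (hα ha)) l
      simp only [tr] at this
      simp [this]
    let φ : ((List S →₀ ℚ) ⧸ P) →ₗ[ℚ] ℚ := P.liftQ _ hP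
    have h1 : Finsupp.linearCombination ℚ (cobd α) = φ ∘ₗ bd := by
      ext l
      have := cobd_map φ.toAddMonoidHom δ l
      simp only [LinearMap.toAddMonoidHom_coe] at this
      simp only [bd, LinearMap.comp_apply, Finsupp.lsingle_apply,
        Finsupp.linearCombination_single, one_smul, ← this]
      congr 1
      funext l'
      simp [φ, δ]
    rw [h1, LinearMap.comp_apply, LinearMap.mem_ker.1 hzk, map_zero]
  have h2 : (Finsupp.linearCombination ℚ g : (List S →₀ ℚ) →ₗ[ℚ] ℚ) ∈
      (LinearMap.ker bd).dualAnnihilator := by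
    rw [Submodule.mem_dualAnnihilator]; exact key
  rw [← LinearMap.range_dualMap_eq_dualAnnihilator_ker] at h2
  obtain ⟨φ, hφ⟩ := h2
  have hα : g = cobd fun l => φ (δ l) := by
    funext l
    have h3 := LinearMap.congr_fun hφ (Finsupp.single l 1)
    have := cobd_map φ.toAddMonoidHom δ l
    simp only [LinearMap.toAddMonoidHom_coe] at this
    rw [this]
    simpa [bd] using h3.symm
  refine h (fun l => if l.length = n then φ (δ l) else 0) ?_ ?_ ?_
  · intro l hl
    have : l.length = n := by by_contra h'; simp [h'] at hl
    exact ⟨this, by rintro rfl; exact hn this.symm⟩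
  · intro a ha
    rw [mem_stab]; funext l
    simp [tr, hδ a ha]
  · funext l
    rw [cobd_truncate, ← hα]
    split_ifs with h'
    · rfl
    · by_contra h3; exact h' (hg l h3).1

end Duality

section Iwasawa

variable {K : Type*} [Field K] {n : ℕ}

lemma det_bound (v : AbsoluteValue K ℝ) (M : Matrix (Fin n) (Fin n) K) (x y : Fin n → ℝ)
    (h : ∀ i j, v (M i j) ≤ x i * y j) :
    v M.det ≤ n.factorial * ((∏ i, x i) * ∏ i, y i) := by
  rw [Matrix.det_apply']
  refine (v.sum_le _ _).trans ?_
  have key : ∀ σ ∈ (Finset.univ : Finset (Equiv.Perm (Fin n))),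
      v (((Equiv.Perm.sign σ : ℤ) : K) * ∏ i, M (σ i) i) ≤ (∏ i, x i) * ∏ i, y i := by
    intro σ _
    rw [map_mul, map_prod]
    have h1 : v ((Equiv.Perm.sign σ : ℤ) : K) = 1 := by
      rcases Int.units_eq_one_or (Equiv.Perm.sign σ) with h | h <;> simp [h]
    rw [h1, one_mul, ← Equiv.prod_comp σ x, ← Finset.prod_mul_distrib]
    exact Finset.prod_le_prod (fun i _ => v.nonneg _) fun i _ => h _ _
  refine (Finset.sum_le_card_nsmul _ _ _ key).trans_eq ?_
  rw [Finset.card_univ, Fintype.card_perm, Fintype.card_fin, nsmul_eq_mul]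

lemma inv_bound (v : AbsoluteValue K ℝ) {C ε : ℝ} (hC : 1 ≤ C) (hε : 0 < ε)
    (W : Matrix (Fin n) (Fin n) K) (x y : Fin n → ℝ) (hx : ∀ i, 0 < x i) (hy : ∀ i, 0 < y i)
    (h : ∀ i j, v (W i j) * y j ≤ C * x i) (hd : ε * ∏ i, x i ≤ v W.det * ∏ i, y i) (i j : Fin n) :
    v (W⁻¹ i j) * x j ≤ n.factorial * C ^ n / ε * y i := by
  have hP : 0 < ∏ i, x i := Finset.prod_pos fun i _ => hx i
  have hQ : 0 < ∏ i, y i := Finset.prod_pos fun i _ => hy i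
  have hdet : 0 < v W.det := by
    by_contra h0
    have : v W.det = 0 := le_antisymm (not_lt.1 h0) (v.nonneg _)
    rw [this, zero_mul] at hd
    exact absurd hd (not_le.2 (mul_pos hε hP))
  have hadj : v (W.adjugate i j) ≤
      n.factorial * (C ^ n * (y i * (∏ i, x i) / x j) * (∏ i, y i)⁻¹) := by
    rw [Matrix.adjugate_apply]
    refine (det_bound v _ (fun a => C * Function.update x j (y i) a) (fun b => (y b)⁻¹) ?_).trans_eq
        ?_
    · intro a b
      rw [← div_eq_mul_inv, le_div_iff₀ (hy b)]
      by_cases ha : a = j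
      · subst ha
        by_cases hb : b = i
        · subst hb; simpa using le_mul_of_one_le_left (hy b).le hC
        · simp [hb]
          exact mul_nonneg (by linarith) (hy i).le
      · simpa [ha, Matrix.updateRow_ne] using h a b
    · rw [Finset.prod_mul_distrib, Finset.prod_const, Finset.card_univ, Fintype.card_fin,
        Finset.prod_inv_distrib]
      have : ∏ a, Function.update x j (y i) a = y i * (∏ i, x i) / x j := by
        rw [Finset.prod_update_of_mem (Finset.mem_univ j), eq_div_iff (hx j).ne', mul_assoc]
        congr 1
        rw [Finset.sdiff_singleton_eq_erase, Finset.prod_erase_mul _ _ (Finset.mem_univ j)]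
      rw [this]
  have h1 : W⁻¹ i j = (W.det)⁻¹ * W.adjugate i j := by
    rw [Matrix.inv_def, Ring.inverse_eq_inv', Matrix.smul_apply, smul_eq_mul]
  rw [h1, map_mul, map_inv₀]
  have h2 : (v W.det)⁻¹ ≤ (∏ i, y i) / (ε * ∏ i, x i) := by
    rw [inv_le_comm₀ hdet (by positivity), inv_div, div_le_iff₀ hQ]
    exact hd
  calc (v W.det)⁻¹ * v (W.adjugate i j) * x j
      ≤ (∏ i, y i) / (ε * ∏ i, x i) *
        (n.factorial * (C ^ n * (y i * (∏ i, x i) / x j) * (∏ i, y i)⁻¹)) * x j := by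
        have := hx j
        gcongr
    _ = _ := by
        have := (hx j).ne'
        have := hP.ne'
        have := hQ.ne'
        field_simp

/-- Upper unitriangular matrices. -/
def Unitri (U : Matrix (Fin n) (Fin n) K) : Prop := (∀ i j, j < i → U i j = 0) ∧ ∀ i, U i i = 1

lemma Unitri.det {U : Matrix (Fin n) (Fin n) K} (hU : Unitri U) : U.det = 1 := by
  rw [Matrix.det_of_isUpperTriangular (fun i j h => hU.1 i j h)]
  simp [hU.2]

lemma Unitri.mul {U V : Matrix (Fin n) (Fin n) K} (hU : Unitri U) (hV : Unitri V) :
    Unitri (U * V) := by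
  constructor
  · intro i j hij
    rw [Matrix.mul_apply]
    refine Finset.sum_eq_zero fun l _ => ?_
    rcases lt_or_ge l i with h | h
    · rw [hU.1 i l h, zero_mul]
    · rw [hV.1 l j (hij.trans_le h), mul_zero]
  · intro i
    rw [Matrix.mul_apply, Finset.sum_eq_single i]
    · rw [hU.2, hV.2, one_mul]
    · intro l _ hl
      rcases lt_or_gt_of_ne hl with h | h
      · rw [hU.1 i l h, zero_mul]
      · rw [hV.1 l i h, mul_zero]
    · simp

/-- A weak form of the Iwasawa decomposition, defined over the base field. -/
theorem exists_iwasawa (v : AbsoluteValue K ℝ) (h : Matrix (Fin n) (Fin n) K) (hdet : h.det ≠ 0)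
    (a : Fin n → ℝ) (ha : ∀ i, 0 < a i) :
    ∃ (U X : Matrix (Fin n) (Fin n) K) (α : Fin n → ℝ), Unitri U ∧ h = U * X ∧ (∀ i, 0 < α i) ∧
      (∀ i j, v (X i j) * a j ≤ α i) ∧ ∏ i, α i = v h.det * ∏ i, a i := by
  have step : ∀ t ≤ n, ∃ (U X : Matrix (Fin n) (Fin n) K) (p : Fin n → Fin n), Unitri U ∧
      h = U * X ∧ ∀ i : Fin n, n - t ≤ i → (∀ j, v (X i j) * a j ≤ v (X i (p i)) * a (p i)) ∧
        X i (p i) ≠ 0 ∧ ∀ l < i, X l (p i) = 0 := by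
    intro t
    induction t with
    | zero =>
      intro _
      refine ⟨1, h, id, ⟨fun i j hij => Matrix.one_apply_ne hij.ne', fun i => Matrix.one_apply_eq
          i⟩,
        by rw [one_mul], fun i hi => absurd i.2 (by omega)⟩
    | succ t ih =>
      intro ht
      obtain ⟨U, X, p, hU, hh, hX⟩ := ih (by omega)
      let k : Fin n := ⟨n - (t + 1), by omega⟩
      have hXdet : X.det ≠ 0 := by
        rw [hh, Matrix.det_mul, hU.det, one_mul] at hdet; exact hdet
      have : Nonempty (Fin n) := ⟨k⟩
      obtain ⟨q, hq⟩ := Finite.exists_max fun j => v (X k j) * a j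
      have hq0 : X k q ≠ 0 := by
        intro h0
        refine hXdet (Matrix.det_eq_zero_of_row_eq_zero k fun j => ?_)
        have h1 := hq j
        rw [h0, map_zero, zero_mul] at h1
        have h2 : v (X k j) ≤ 0 := by
          by_contra h3
          exact absurd h1 (not_le.2 (mul_pos (not_le.1 h3) (ha j)))
        exact v.eq_zero.1 (le_antisymm h2 (v.nonneg _))
      let c : Fin n → K := fun l => if l < k then X l q / X k q else 0
      let E : Matrix (Fin n) (Fin n) K := 1 + Matrix.vecMulVec c (Pi.single k 1)
      let X' : Matrix (Fin n) (Fin n) K := fun l j => X l j - c l * X k j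
      have hck : c k = 0 := by simp [c]
      have hE : Unitri E := by
        constructor
        · intro i j hij
          simp only [E, Matrix.add_apply, Matrix.one_apply_ne hij.ne', Matrix.vecMulVec_apply,
            zero_add]
          by_cases hj : j = k
          · subst hj; simp [c, hij.le]
          · simp [hj]
        · intro i
          simp only [E, Matrix.add_apply, Matrix.one_apply_eq, Matrix.vecMulVec_apply]
          by_cases hj : i = k
          · rw [hj, hck]; simp
          · simp [hj]
      have hEX : X = E * X' := by
        rw [show E * X' = X' + Matrix.vecMulVec c (Pi.single k 1) * X' by
          simp only [E, add_mul, one_mul]]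
        ext l j
        rw [Matrix.add_apply, Matrix.mul_apply, Finset.sum_eq_single k]
        · simp [X', hck, Matrix.vecMulVec_apply]
        · intro b _ hb; simp [hb, Matrix.vecMulVec_apply]
        · simp
      refine ⟨U * E, X', Function.update p k q, hU.mul hE, by rw [mul_assoc, ← hEX, hh], ?_⟩
      intro i hi
      by_cases hik : i = k
      · rw [hik]
        have hrow : ∀ j, X' k j = X k j := fun j => by simp [X', hck]
        simp only [Function.update_self, hrow]
        refine ⟨hq, hq0, fun l hl => ?_⟩
        simp [X', c, hl, hq0]
      · have hik' : k < i := by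
          refine lt_of_le_of_ne ?_ (Ne.symm hik)
          rw [Fin.le_def]; exact hi
        have hrow : ∀ j, X' i j = X i j := fun j => by simp [X', c, hik'.le]
        rw [Function.update_of_ne hik]
        have hki : n - (t + 1) < (i : ℕ) := hik'
        obtain ⟨h1, h2, h3⟩ := hX i (by omega)
        simp only [hrow]
        refine ⟨h1, h2, fun l hl => ?_⟩
        simp [X', h3 l hl, h3 k hik']
  obtain ⟨U, X, p, hU, hh, hX⟩ := step n le_rfl
  replace hX := fun i => hX i (by omega)
  have hinj : Function.Injective p := by
    intro i l hil
    by_contra hne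
    rcases lt_or_gt_of_ne hne with h | h
    · exact (hX i).2.1 (hil ▸ (hX l).2.2 i h)
    · exact (hX l).2.1 (hil ▸ (hX i).2.2 l h)
  refine ⟨U, X, fun i => v (X i (p i)) * a (p i), hU, hh,
    fun i => mul_pos (v.pos (hX i).2.1) (ha _), fun i j => (hX i).1 j, ?_⟩
  let e : Equiv.Perm (Fin n) := Equiv.ofBijective p (Finite.injective_iff_bijective.1 hinj)
  rw [Finset.prod_mul_distrib, show ∏ i, a (p i) = ∏ i, a i from Equiv.prod_comp e a]
  congr 1
  have h1 : (X.submatrix id e).det = ∏ i, X i (p i) :=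
    Matrix.det_of_isLowerTriangular _ fun i j hij => (hX j).2.2 i hij
  rw [Matrix.det_permute'] at h1
  rw [← map_prod, ← h1, hh, Matrix.det_mul, hU.det, one_mul, map_mul]
  have h2 : v ((Equiv.Perm.sign e : ℤ) : K) = 1 := by
    rcases Int.units_eq_one_or (Equiv.Perm.sign e) with h | h <;> simp [h]
  rw [h2, one_mul]

end Iwasawa

section Basis

variable {E : Type*} [NormedAddCommGroup E] [NormedSpace ℝ E] {m : ℕ}

lemma exists_norm_le_of_repr (b : Module.Basis (Fin m) ℝ E) :
    ∃ c : ℝ, 0 ≤ c ∧ ∀ x R, (∀ j, |b.repr x j| ≤ R) → ‖x‖ ≤ c * R := by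
  refine ⟨∑ j, ‖b j‖, by positivity, fun x R h => ?_⟩
  conv_lhs => rw [← b.sum_repr x]
  refine (norm_sum_le _ _).trans ?_
  rw [Finset.sum_mul]
  refine Finset.sum_le_sum fun j _ => ?_
  rw [norm_smul, mul_comm]
  exact mul_le_mul_of_nonneg_left (h j) (norm_nonneg _)

lemma exists_repr_le_of_norm (b : Module.Basis (Fin m) ℝ E) :
    ∃ c : ℝ, 0 ≤ c ∧ ∀ x j, |b.repr x j| ≤ c * ‖x‖ := by
  have : FiniteDimensional ℝ E := b.finiteDimensional_of_finite
  let f : E →L[ℝ] (Fin m → ℝ) := LinearMap.toContinuousLinearMap b.equivFun.toLinearMap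
  refine ⟨‖f‖, norm_nonneg _, fun x j => ?_⟩
  have h1 := (norm_le_pi_norm (f x) j).trans (f.le_opNorm x)
  simpa [f] using h1

/-- Coordinates all of which change sign along a list of small diameter are bounded. -/
lemma exists_norm_le_of_sg_ne (b : Module.Basis (Fin m) ℝ E) :
    ∃ c : ℝ, 0 ≤ c ∧ ∀ {S : Type} (x : S → E) (l : List S) (R : ℝ),
      (∀ j, ∃ s ∈ l, ∃ s' ∈ l, sg (b.repr (x s) j) ≠ sg (b.repr (x s') j)) →
      (∀ s ∈ l, ∀ s' ∈ l, ‖x s - x s'‖ ≤ R) → ∀ s ∈ l, ‖x s‖ ≤ c * R := by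
  obtain ⟨c₁, hc₁, H₁⟩ := exists_norm_le_of_repr b
  obtain ⟨c₂, hc₂, H₂⟩ := exists_repr_le_of_norm b
  refine ⟨c₁ * (2 * c₂), by positivity, fun x l R hs hR s hsl => ?_⟩
  rw [mul_assoc]
  refine H₁ _ _ fun j => ?_
  obtain ⟨t, ht, t', ht', hne⟩ := hs j
  have h1 : |b.repr (x t) j| ≤ c₂ * R := by
    refine (abs_le_of_sg_ne hne).trans ?_
    rw [← Finsupp.sub_apply, ← map_sub]
    exact (H₂ _ j).trans (mul_le_mul_of_nonneg_left (hR t ht t' ht') hc₂)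
  have h2 : |b.repr (x s) j - b.repr (x t) j| ≤ c₂ * R := by
    rw [← Finsupp.sub_apply, ← map_sub]
    exact (H₂ _ j).trans (mul_le_mul_of_nonneg_left (hR s hsl t ht) hc₂)
  have h3 := abs_add_le (b.repr (x s) j - b.repr (x t) j) (b.repr (x t) j)
  rw [sub_add_cancel] at h3
  linarith

end Basis

section Places

open NumberField NumberField.InfinitePlace NumberField.mixedEmbedding NumberField.Units
  NumberField.Units.dirichletUnitTheorem
open scoped Classical

variable {K : Type*} [Field K]

/-- A family of field elements indexed by the infinite places, as a vector of the mixed space. -/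
noncomputable def rootVec (u : InfinitePlace K → K) : mixedSpace K :=
  (fun w => w.1.embedding_of_isReal w.2 (u w.1), fun w => w.1.embedding (u w.1))

lemma rootVec_sub (u u' : InfinitePlace K → K) :
    rootVec u - rootVec u' = rootVec fun w => u w - u' w := by
  ext <;> simp [rootVec]

lemma rootVec_const (x : K) : (rootVec fun _ => x) = mixedEmbedding K x := by
  ext <;> simp [rootVec]

lemma normAtPlace_rootVec (u : InfinitePlace K → K) (w : InfinitePlace K) :
    normAtPlace w (rootVec u) = w (u w) := by
  rcases isReal_or_isComplex w with h | h
  · rw [normAtPlace_apply_of_isReal h]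
    exact norm_embedding_of_isReal h (u w)
  · rw [normAtPlace_apply_of_isComplex h]
    exact norm_embedding_eq w (u w)

variable [NumberField K]

lemma norm_rootVec_le {u : InfinitePlace K → K} {R : ℝ} (h : ∀ w : InfinitePlace K, w (u w) ≤ R) :
    ‖rootVec u‖ ≤ R := by
  rw [norm_eq_sup'_normAtPlace]
  exact Finset.sup'_le _ _ fun w _ => by rw [normAtPlace_rootVec]; exact h w

lemma le_norm_rootVec (u : InfinitePlace K → K) (w : InfinitePlace K) : w (u w) ≤ ‖rootVec u‖ := by
  rw [norm_eq_sup'_normAtPlace, ← normAtPlace_rootVec u w]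
  exact Finset.le_sup' (fun w => normAtPlace w (rootVec u)) (Finset.mem_univ w)

/-- The weighted mean of a function on the infinite places. -/
noncomputable def mean : (InfinitePlace K → ℝ) →ₗ[ℝ] ℝ :=
  (∑ w : InfinitePlace K, (w.mult : ℝ))⁻¹ • ∑ w : InfinitePlace K, (w.mult : ℝ) • LinearMap.proj w

lemma sum_mult_pos : 0 < ∑ w : InfinitePlace K, (w.mult : ℝ) :=
  Finset.sum_pos (fun w _ => by exact_mod_cast mult_pos) Finset.univ_nonempty

lemma mean_mul (x : InfinitePlace K → ℝ) :
    (∑ w : InfinitePlace K, (w.mult : ℝ)) * mean x = ∑ w : InfinitePlace K, w.mult * x w := by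
  simp only [mean, LinearMap.smul_apply, LinearMap.sum_apply, LinearMap.proj_apply, smul_eq_mul]
  rw [mul_inv_cancel_left₀ sum_mult_pos.ne']

lemma mean_const (c : ℝ) : mean (K := K) (fun _ => c) = c := by
  have := mean_mul (K := K) (fun _ => c)
  rw [← Finset.sum_mul] at this
  exact mul_left_cancel₀ sum_mult_pos.ne' this

lemma abs_mean_le {x : InfinitePlace K → ℝ} {R : ℝ} (h : ∀ w, |x w| ≤ R) : |mean x| ≤ R := by
  have h1 : ∀ y : InfinitePlace K → ℝ, (∀ w, y w ≤ R) → mean y ≤ R := fun y hy => by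
    have h2 : ∑ w : InfinitePlace K, w.mult * y w ≤ (∑ w : InfinitePlace K, (w.mult : ℝ)) * R := by
      rw [Finset.sum_mul]
      exact Finset.sum_le_sum fun w _ => mul_le_mul_of_nonneg_left (hy w) (Nat.cast_nonneg _)
    rw [← mean_mul] at h2
    exact le_of_mul_le_mul_left h2 sum_mult_pos
  rw [abs_le]
  have h3 := h1 (-x) fun w => (neg_le_abs _).trans (h w)
  rw [map_neg] at h3
  exact ⟨by linarith, h1 x fun w => (le_abs_self _).trans (h w)⟩

/-- Projection of functions on the infinite places to the logarithmic space, killing constants. -/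
noncomputable def logVec : (InfinitePlace K → ℝ) →ₗ[ℝ] logSpace K :=
  LinearMap.pi fun w => (w.1.mult : ℝ) • (LinearMap.proj w.1 - mean)

lemma logVec_apply (x : InfinitePlace K → ℝ) (w) :
    logVec x w = w.1.mult * (x w.1 - mean x) := rfl

lemma logVec_const (c : ℝ) : logVec (K := K) (fun _ => c) = 0 := by
  ext w; simp [logVec_apply, mean_const]

lemma logVec_unit (ε : (𝓞 K)ˣ) :
    logVec (fun w : InfinitePlace K => Real.log (w (ε : K))) = logEmbedding K (Additive.ofMul ε) :=
        by
  ext w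
  have h : mean (fun w : InfinitePlace K => Real.log (w (ε : K))) = 0 := by
    refine mul_left_cancel₀ (sum_mult_pos (K := K)).ne' ?_
    rw [mean_mul, mul_zero, Units.sum_mult_mul_log]
  rw [logVec_apply, h, sub_zero, logEmbedding_component]

lemma norm_logVec_le {x : InfinitePlace K → ℝ} {R : ℝ} (h : ∀ w, |x w| ≤ R) :
    ‖logVec x‖ ≤ 4 * R := by
  have hR : 0 ≤ R := (abs_nonneg _).trans (h w₀)
  refine (pi_norm_le_iff_of_nonneg (by positivity)).2 fun w => ?_
  have h1 : (w.1.mult : ℝ) ≤ 2 := by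
    have : w.1.mult ≤ 2 := by rw [mult]; split_ifs <;> norm_num
    exact_mod_cast this
  rw [logVec_apply, norm_mul, Real.norm_natCast, Real.norm_eq_abs]
  have h2 := abs_sub (x w.1) (mean x)
  have h3 := abs_mean_le h
  have h4 := h w.1
  calc (w.1.mult : ℝ) * |x w.1 - mean x| ≤ 2 * (R + R) := by
        gcongr; linarith
    _ = _ := by ring

lemma exists_sub_mean_le : ∃ c : ℝ, 0 ≤ c ∧ ∀ (x : InfinitePlace K → ℝ) (w : InfinitePlace K),
    |x w - mean x| ≤ c * ‖logVec x‖ := by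
  refine ⟨∑ w : InfinitePlace K, 1, by positivity, fun x w => ?_⟩
  have hz : ∑ w : InfinitePlace K, (w.mult : ℝ) * (x w - mean x) = 0 := by
    simp only [mul_sub, Finset.sum_sub_distrib, ← Finset.sum_mul, mean_mul, sub_self]
  have hN : ∀ w ≠ w₀, |(w.mult : ℝ) * (x w - mean x)| ≤ ‖logVec x‖ := fun w hw =>
    norm_le_pi_norm (logVec x) ⟨w, hw⟩
  have h1 : |(w.mult : ℝ) * (x w - mean x)| ≤ (∑ w : InfinitePlace K, 1) * ‖logVec x‖ := by
    rw [Finset.sum_mul]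
    simp only [one_mul]
    by_cases hw : w = w₀
    · rw [← Finset.add_sum_erase _ _ (Finset.mem_univ w)] at hz
      rw [eq_neg_of_add_eq_zero_left hz, abs_neg]
      refine (Finset.abs_sum_le_sum_abs _ _).trans ?_
      refine (Finset.sum_le_sum fun w' hw' => hN w' ?_).trans
        (Finset.sum_le_sum_of_subset_of_nonneg (Finset.erase_subset _ _) fun _ _ _ => norm_nonneg _)
      rw [← hw]; exact Finset.ne_of_mem_erase hw'
    · exact (hN w hw).trans
        (Finset.single_le_sum (f := fun _ => ‖logVec x‖) (fun _ _ => norm_nonneg _) (Finset.mem_univ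
            w))
  refine le_trans ?_ h1
  rw [abs_mul, Nat.abs_cast]
  exact le_mul_of_one_le_left (abs_nonneg _) (by exact_mod_cast (mult_pos : 0 < w.mult))

variable (K) in
/-- Numbering of the integral basis. -/
noncomputable def ringIdx :
    Module.Free.ChooseBasisIndex ℤ (𝓞 K) ≃ Fin (Module.finrank ℚ K) :=
  Fintype.equivFinOfCardEq (by
    rw [← Module.finrank_eq_card_chooseBasisIndex, RingOfIntegers.rank])

variable (K) in
/-- A basis of the mixed space spanning the ring of integers. -/
noncomputable def rootBasis : Module.Basis (Fin (Module.finrank ℚ K)) ℝ (mixedSpace K) :=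
  (latticeBasis K).reindex (ringIdx K)

variable (K) in
/-- An integral basis. -/
noncomputable def fieldBasis : Module.Basis (Fin (Module.finrank ℚ K)) ℚ K :=
  (integralBasis K).reindex (ringIdx K)

lemma rootBasis_repr (x : K) (j) :
    (rootBasis K).repr (mixedEmbedding K x) j = ((fieldBasis K).repr x j : ℝ) := by
  simp [rootBasis, fieldBasis, latticeBasis_repr_apply]

variable (K) in
/-- A basis of the logarithmic space spanning the unit lattice. -/
noncomputable def torusBasis : Module.Basis (Fin (Units.rank K)) ℝ (logSpace K) :=
  (basisUnitLattice K).ofZLatticeBasis ℝ (unitLattice K)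

lemma torusBasis_apply (j) :
    torusBasis K j = logEmbedding K (Additive.ofMul (fundSystem K j)) := by
  rw [torusBasis, Module.Basis.ofZLatticeBasis_apply, logEmbedding_fundSystem]

end Places

section IwasawaData

variable {K : Type*} [Field K] {n : ℕ}

/-- The pair `(U, α)` is a weak Iwasawa datum of `h`. -/
structure IsIwasawa (v : AbsoluteValue K ℝ) (a : Fin n → ℝ) (h U : Matrix (Fin n) (Fin n) K)
    (α : Fin n → ℝ) : Prop where
  unitri : Unitri U
  pos : ∀ i, 0 < α i
  le : ∃ X, h = U * X ∧ ∀ i j, v (X i j) * a j ≤ α i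
  prod : ∏ i, α i = v h.det * ∏ i, a i

lemma Unitri.inv {U : Matrix (Fin n) (Fin n) K} (hU : Unitri U) : Unitri U⁻¹ := by
  have hd : IsUnit U.det := by rw [hU.det]; exact isUnit_one
  have hb : U.BlockTriangular id := fun i j h => hU.1 i j h
  let := Matrix.invertibleOfIsUnitDet U hd
  have hb' : U⁻¹.BlockTriangular id := Matrix.blockTriangular_inv_of_blockTriangular hb
  refine ⟨fun i j h => hb' h, fun i => ?_⟩
  have h1 := congrFun (congrFun (Matrix.mul_nonsing_inv U hd) i) i
  rw [Matrix.mul_apply, Finset.sum_eq_single i, hU.2, one_mul, Matrix.one_apply_eq] at h1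
  · exact h1
  · intro l _ hl
    rcases lt_or_gt_of_ne hl with h | h
    · rw [hU.1 i l h, zero_mul]
    · rw [hb' (show id i < id l from h), mul_zero]
  · simp

lemma mul_bound (v : AbsoluteValue K ℝ) {P Q : Matrix (Fin n) (Fin n) K} {x y z : Fin n → ℝ}
    {C D : ℝ} (hy : ∀ i, 0 < y i) (hz : ∀ i, 0 < z i)
    (hP : ∀ i j, v (P i j) * y j ≤ C * x i)
    (hQ : ∀ i j, v (Q i j) * z j ≤ D * y i) (i j : Fin n) :
    v ((P * Q) i j) * z j ≤ n * C * D * x i := by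
  rw [Matrix.mul_apply]
  calc v (∑ l, P i l * Q l j) * z j ≤ (∑ l, v (P i l * Q l j)) * z j :=
        mul_le_mul_of_nonneg_right (v.sum_le _ _) (hz j).le
    _ = ∑ l, v (P i l) * (v (Q l j) * z j) := by
        rw [Finset.sum_mul]; exact Finset.sum_congr rfl fun l _ => by rw [map_mul, mul_assoc]
    _ ≤ ∑ l : Fin n, C * D * x i := Finset.sum_le_sum fun l _ => by
        have hD : 0 ≤ D := by
          by_contra hD
          have h1 := hQ l j
          have h2 : 0 ≤ v (Q l j) * z j := mul_nonneg (v.nonneg _) (hz j).le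
          nlinarith [hy l]
        calc v (P i l) * (v (Q l j) * z j) ≤ v (P i l) * (D * y l) :=
              mul_le_mul_of_nonneg_left (hQ l j) (v.nonneg _)
          _ = D * (v (P i l) * y l) := by ring
          _ ≤ D * (C * x i) := mul_le_mul_of_nonneg_left (hP i l) hD
          _ = _ := by ring
    _ = _ := by simp; ring

lemma IsIwasawa.exists_quot {v : AbsoluteValue K ℝ} {a : Fin n → ℝ} (ha : ∀ i, 0 < a i)
    {h U h' U' W : Matrix (Fin n) (Fin n) K} {α α' : Fin n → ℝ} (H : IsIwasawa v a h U α)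
    (H' : IsIwasawa v a h' U' α') (hW : h' = h * W) {C : ℝ}
    (hC : ∀ i j, v (W i j) * a j ≤ C * a i) :
    ∃ Z, U' = U * Z ∧ Unitri Z ∧ ∀ i j, v (Z i j) * α' j ≤ n * (n * C) * n.factorial * α i := by
  obtain ⟨X, hX, hX'⟩ := H.le
  obtain ⟨Y, hY, hY'⟩ := H'.le
  have hU : IsUnit U.det := by rw [H.unitri.det]; exact isUnit_one
  have hdet : v Y.det * ∏ i, a i = ∏ i, α' i := by
    rw [H'.prod, hY, Matrix.det_mul, H'.unitri.det, one_mul]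
  have hYd : IsUnit Y.det := by
    rw [isUnit_iff_ne_zero]
    intro h0
    rw [h0, map_zero, zero_mul] at hdet
    exact (Finset.prod_pos fun i _ => H'.pos i).ne hdet
  refine ⟨U⁻¹ * U', ?_, H.unitri.inv.mul H'.unitri, ?_⟩
  · rw [← mul_assoc, Matrix.mul_nonsing_inv _ hU, one_mul]
  · have e : U⁻¹ * U' = X * W * Y⁻¹ := by
      have h1 : U * (X * W) = U' * Y := by rw [← mul_assoc, ← hX, ← hW, hY]
      have h2 : X * W = U⁻¹ * U' * Y := by
        rw [mul_assoc, ← h1, ← mul_assoc, Matrix.nonsing_inv_mul _ hU, one_mul]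
      rw [h2, mul_assoc, Matrix.mul_nonsing_inv _ hYd, mul_one]
    rw [e]
    have hinv := inv_bound v le_rfl one_pos Y α' a H'.pos ha (fun i j => by simpa using hY' i j)
      (by rw [one_mul, hdet])
    have h0 : ∀ i : Fin n, 0 ≤ n * C := by
      intro i
      have := hC i i
      have h2 : 0 ≤ v (W i i) * a i := mul_nonneg (v.nonneg _) (ha i).le
      have h3 : 0 ≤ C := by by_contra h; nlinarith [ha i]
      positivity
    intro i j
    refine mul_bound v ha H'.pos (fun i j => ?_) (fun i j => ?_) i j
    · have := mul_bound (C := 1) v ha ha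
        (fun i j => by simpa using hX' i j) hC i j
      simpa using this
    · simpa using hinv i j

theorem exists_isIwasawa (v : AbsoluteValue K ℝ) (h : Matrix (Fin n) (Fin n) K) (hdet : h.det ≠ 0)
    (a : Fin n → ℝ) (ha : ∀ i, 0 < a i) :
    ∃ (U : Matrix (Fin n) (Fin n) K) (α : Fin n → ℝ), IsIwasawa v a h U α ∧
      ((∀ i j, j < i → h i j = 0) →
        (∀ i j, U i j = h i j / h j j) ∧ ∀ i, α i = v (h i i) * a i) := by
  by_cases ht : ∀ i j, j < i → h i j = 0
  · have hd : h.det = ∏ i, h i i := Matrix.det_of_isUpperTriangular fun i j hij => ht i j hij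
    have h0 : ∀ i, h i i ≠ 0 := fun i => by
      rw [hd] at hdet; exact Finset.prod_ne_zero_iff.1 hdet i (Finset.mem_univ _)
    refine ⟨Matrix.of fun i j => h i j / h j j, fun i => v (h i i) * a i, ⟨⟨fun i j hij => ?_, fun i
        => ?_⟩,
      fun i => mul_pos (v.pos (h0 i)) (ha i), ⟨Matrix.diagonal fun i => h i i, ?_, ?_⟩, ?_⟩,
      fun _ => ⟨fun _ _ => rfl, fun _ => rfl⟩⟩
    · simp [ht i j hij]
    · exact div_self (h0 i)
    · ext i j
      rw [Matrix.mul_diagonal, Matrix.of_apply, div_mul_cancel₀ _ (h0 j)]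
    · intro i j
      rw [Matrix.diagonal_apply]
      split_ifs with hij
      · rw [hij]
      · rw [map_zero, zero_mul]; exact mul_nonneg (v.nonneg _) (ha i).le
    · rw [Finset.prod_mul_distrib, hd, map_prod]
  · obtain ⟨U, X, α, h1, h2, h3, h4, h5⟩ := exists_iwasawa v h hdet a ha
    exact ⟨U, α, ⟨h1, h3, ⟨X, h2, h4⟩, h5⟩, fun h => absurd h ht⟩

end IwasawaData

section Bounds

open NumberField NumberField.InfinitePlace NumberField.mixedEmbedding NumberField.Units
  NumberField.Units.dirichletUnitTheorem
open scoped Classical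

variable {K : Type} [Field K] [NumberField K] {k : ℕ}

/-- If the torus coordinates change sign along a list then the diagonal parts are nearly scalar. -/
lemma exists_diag_bound (C D : ℝ) (hC : 1 ≤ C) (hD : 1 ≤ D) : ∃ C' : ℝ, 1 ≤ C' ∧ ∀ {S : Type}
    (l : List S)
    (α : S → InfinitePlace K → Fin (k + 1) → ℝ) (δ : S → InfinitePlace K → ℝ) (e : ℝ), l ≠ [] → 0 <
        e →
    (∀ s ∈ l, ∀ w i, 0 < α s w i) →
    (∀ s ∈ l, ∀ w, ∏ i, α s w i = δ s w * e ∧ δ s w ≤ D ∧ 1 ≤ D * δ s w) →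
    (∀ s ∈ l, ∀ s' ∈ l, ∀ w i, α s' w i ≤ C * α s w i) →
    (∀ (i : Fin k) j, ∃ s ∈ l, ∃ s' ∈ l,
      sg ((torusBasis K).repr (logVec fun w => Real.log (α s w i.castSucc)) j) ≠
      sg ((torusBasis K).repr (logVec fun w => Real.log (α s' w i.castSucc)) j)) →
    ∃ t : Fin (k + 1) → ℝ, (∀ i, 0 < t i) ∧
      ∀ s ∈ l, ∀ w i, α s w i ≤ C' * t i ∧ t i ≤ C' * α s w i := by
  obtain ⟨c₁, hc₁, H₁⟩ := exists_norm_le_of_sg_ne (torusBasis K)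
  obtain ⟨c₂, hc₂, H₂⟩ := exists_sub_mean_le (K := K)
  set R := Real.log C
  have hR : 0 ≤ R := Real.log_nonneg hC
  have hlD : 0 ≤ Real.log D := Real.log_nonneg hD
  set R' := c₂ * (c₁ * (4 * R)) + R
  have hR' : 0 ≤ R' := by positivity
  set R'' := 2 * Real.log D + k * R' + R'
  have hR'' : 0 ≤ R'' := by positivity
  refine ⟨Real.exp R'', Real.one_le_exp hR'', fun l α δ e hl he hα hp hm hs => ?_⟩
  obtain ⟨s₀, hs₀⟩ := List.exists_mem_of_ne_nil l hl
  let x := fun s i w => Real.log (α s w i)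
  have hx : ∀ s ∈ l, ∀ s' ∈ l, ∀ i w, |x s i w - x s' i w| ≤ R := by
    have h1 : ∀ s ∈ l, ∀ s' ∈ l, ∀ i w, x s' i w ≤ R + x s i w := fun s h s' h' i w => by
      have := Real.log_le_log (hα s' h' w i) (hm s h s' h' w i)
      rwa [Real.log_mul (by linarith) (hα s h w i).ne'] at this
    intro s h s' h' i w
    rw [abs_le]
    constructor <;> linarith [h1 s h s' h' i w, h1 s' h' s h i w]
  let y := fun i => mean (x s₀ i)
  have hk : ∀ s ∈ l, ∀ (i : Fin k) w, |x s i.castSucc w - y i.castSucc| ≤ R' := by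
    intro s h i w
    have h1 := H₁ (fun s => logVec (x s i.castSucc)) l (4 * R) (hs i) (fun s h s' h' => by
      rw [← map_sub]
      exact norm_logVec_le fun w => hx s h s' h' _ w) s h
    have h2 := (H₂ (x s i.castSucc) w).trans (mul_le_mul_of_nonneg_left h1 hc₂)
    have h3 : |mean (x s i.castSucc) - y i.castSucc| ≤ R := by
      rw [← map_sub]
      exact abs_mean_le fun w => hx s h s₀ hs₀ _ w
    have h4 := abs_sub_le (x s i.castSucc w) (mean (x s i.castSucc)) (y i.castSucc)
    linarith
  have hsum : ∀ s ∈ l, ∀ w, |∑ i, x s i w - Real.log e| ≤ Real.log D := by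
    intro s h w
    obtain ⟨h1, h2, h3⟩ := hp s h w
    have h4 : 0 < δ s w := by
      by_contra h4
      have : D * δ s w ≤ 0 := mul_nonpos_of_nonneg_of_nonpos (by linarith) (not_lt.1 h4)
      linarith
    rw [← Real.log_prod (fun i _ => (hα s h w i).ne'), h1, Real.log_mul h4.ne' he.ne',
      add_sub_cancel_right, abs_le]
    have h5 := Real.log_le_log one_pos h3
    rw [Real.log_one, Real.log_mul (by linarith) h4.ne'] at h5
    exact ⟨by linarith, Real.log_le_log h4 h2⟩
  have hy : |∑ i, y i - Real.log e| ≤ Real.log D := by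
    have h1 : ∑ i, y i - Real.log e = mean (fun w => ∑ i, x s₀ i w - Real.log e) := by
      have : (fun w => ∑ i, x s₀ i w - Real.log e) = ∑ i, x s₀ i - fun w => Real.log e := by
        ext w; simp
      rw [this, map_sub, map_sum, mean_const]
    rw [h1]
    exact abs_mean_le fun w => hsum s₀ hs₀ w
  have hall : ∀ s ∈ l, ∀ i w, |x s i w - y i| ≤ R'' := by
    intro s h i w
    induction i using Fin.lastCases with
    | cast i =>
      refine (hk s h i w).trans ?_
      have : 0 ≤ k * R' := by positivity
      simp only [R'']
      linarith
    | last =>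
      have h1 := hsum s h w
      rw [Fin.sum_univ_castSucc] at h1 hy
      have h2 : |∑ i : Fin k, (x s i.castSucc w - y i.castSucc)| ≤ k * R' := by
        refine (Finset.abs_sum_le_sum_abs _ _).trans ?_
        refine (Finset.sum_le_card_nsmul _ _ _ fun i _ => hk s h i w).trans_eq ?_
        simp
      rw [Finset.sum_sub_distrib] at h2
      rw [abs_le] at h1 h2 hy ⊢
      simp only [R'']
      constructor <;> linarith [h1.1, h1.2, h2.1, h2.2, hy.1, hy.2]
  refine ⟨fun i => Real.exp (y i), fun i => Real.exp_pos _, fun s h w i => ?_⟩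
  have h1 := abs_le.1 (hall s h i w)
  have h2 : α s w i = Real.exp (x s i w) := (Real.exp_log (hα s h w i)).symm
  rw [h2, ← Real.exp_add, ← Real.exp_add, Real.exp_le_exp, Real.exp_le_exp]
  constructor <;> linarith [h1.1, h1.2]

/-- If the root coordinates change sign along a list then the unipotent parts are bounded. -/
lemma exists_unip_bound (C : ℝ) (hC : 1 ≤ C) : ∃ C' : ℝ, 1 ≤ C' ∧ ∀ {S : Type} (l : List S)
    (U : S → InfinitePlace K → Matrix (Fin (k + 1)) (Fin (k + 1)) K) (t : Fin (k + 1) → ℝ),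
    (∀ i, 0 < t i) → (∀ s ∈ l, ∀ w, Unitri (U s w)) →
    (∀ s ∈ l, ∀ s' ∈ l, ∀ w, ∃ Z, U s' w = U s w * Z ∧ Unitri Z ∧
      ∀ i j, w (Z i j) * t j ≤ C * t i) →
    (∀ i j : Fin (k + 1), i < j → ∀ q, ∃ s ∈ l, ∃ s' ∈ l,
      sg ((rootBasis K).repr (rootVec fun w => U s w i j) q) ≠
      sg ((rootBasis K).repr (rootVec fun w => U s' w i j) q)) →
    ∀ s ∈ l, ∀ (w : InfinitePlace K) i j, w (U s w i j) * t j ≤ C' * t i := by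
  obtain ⟨c, hc, H⟩ := exists_norm_le_of_sg_ne (rootBasis K)
  suffices h : ∀ N : ℕ, ∃ C' : ℝ, 1 ≤ C' ∧ ∀ {S : Type} (l : List S)
    (U : S → InfinitePlace K → Matrix (Fin (k + 1)) (Fin (k + 1)) K) (t : Fin (k + 1) → ℝ),
    (∀ i, 0 < t i) → (∀ s ∈ l, ∀ w, Unitri (U s w)) →
    (∀ s ∈ l, ∀ s' ∈ l, ∀ w, ∃ Z, U s' w = U s w * Z ∧ Unitri Z ∧
      ∀ i j, w (Z i j) * t j ≤ C * t i) →
    (∀ i j : Fin (k + 1), i < j → ∀ q, ∃ s ∈ l, ∃ s' ∈ l,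
      sg ((rootBasis K).repr (rootVec fun w => U s w i j) q) ≠
      sg ((rootBasis K).repr (rootVec fun w => U s' w i j) q)) →
    ∀ s ∈ l, ∀ (w : InfinitePlace K) i (j : Fin (k + 1)), (j : ℕ) < N → w (U s w i j) * t j ≤ C' * t
        i by
    obtain ⟨C', h1, h2⟩ := h (k + 1)
    exact ⟨C', h1, fun l U t ht hU hZ hs s h w i j => h2 l U t ht hU hZ hs s h w i j j.2⟩
  intro N
  induction N with
  | zero => exact ⟨1, le_rfl, fun l U t _ _ _ _ s _ w i j h => absurd h (by omega)⟩
  | succ N ih =>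
    obtain ⟨C₁, hC₁, H₁⟩ := ih
    refine ⟨C₁ + c * ((k + 1) * (C₁ * C)), by
      have : 0 ≤ c * ((k + 1) * (C₁ * C)) := by positivity
      linarith, fun l U t ht hU hZ hs s h w i j hj => ?_⟩
    have h0 : 0 ≤ c * ((k + 1) * (C₁ * C)) := by positivity
    rcases lt_or_ge i j with hij | hij
    · by_cases hjN : (j : ℕ) < N
      · refine (H₁ l U t ht hU hZ hs s h w i j hjN).trans ?_
        nlinarith [ht i]
      have key : ∀ s ∈ l, ∀ s' ∈ l, ∀ w : InfinitePlace K,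
          w (U s' w i j - U s w i j) ≤ (k + 1) * (C₁ * C) * t i / t j := by
        intro s h s' h' w
        obtain ⟨Z, hZ1, hZ2, hZ3⟩ := hZ s h s' h' w
        have e : U s' w i j - U s w i j = ∑ q ∈ Finset.univ.erase j, U s w i q * Z q j := by
          rw [hZ1, Matrix.mul_apply, ← Finset.add_sum_erase _ _ (Finset.mem_univ j), hZ2.2, mul_one,
            add_sub_cancel_left]
        rw [e, le_div_iff₀ (ht j)]
        calc w (∑ q ∈ Finset.univ.erase j, U s w i q * Z q j) * t j
            ≤ (∑ q ∈ Finset.univ.erase j, w (U s w i q * Z q j)) * t j :=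
              mul_le_mul_of_nonneg_right (w.1.sum_le _ _) (ht j).le
          _ = ∑ q ∈ Finset.univ.erase j, w (U s w i q) * (w (Z q j) * t j) := by
              rw [Finset.sum_mul]
              exact Finset.sum_congr rfl fun q _ => by rw [map_mul, mul_assoc]
          _ ≤ ∑ q ∈ Finset.univ.erase j, C₁ * C * t i := by
              refine Finset.sum_le_sum fun q hq => ?_
              rcases lt_or_gt_of_ne (Finset.ne_of_mem_erase hq) with hqj | hqj
              · calc w (U s w i q) * (w (Z q j) * t j) ≤ w (U s w i q) * (C * t q) :=
                      mul_le_mul_of_nonneg_left (hZ3 q j) (apply_nonneg _ _)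
                  _ = C * (w (U s w i q) * t q) := by ring
                  _ ≤ C * (C₁ * t i) := by
                      refine mul_le_mul_of_nonneg_left ?_ (by linarith)
                      exact H₁ l U t ht hU hZ hs s h w i q (by
                        have : (q : ℕ) < j := hqj
                        omega)
                  _ = _ := by ring
              · rw [hZ2.1 q j hqj, map_zero, zero_mul, mul_zero]
                have := ht i
                positivity
          _ ≤ ∑ q : Fin (k + 1), C₁ * C * t i := by
              have := ht i
              exact Finset.sum_le_sum_of_subset_of_nonneg (Finset.erase_subset _ _)
                fun _ _ _ => by positivity
          _ = _ := by simp; ring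
      have h2 := H (fun s => rootVec fun w => U s w i j) l _ (hs i j hij) (fun s h s' h' => by
        rw [rootVec_sub]
        exact norm_rootVec_le fun w => key s' h' s h w) s h
      have h3 := (le_norm_rootVec (fun w => U s w i j) w).trans h2
      rw [← mul_div_assoc, le_div_iff₀ (ht j)] at h3
      have := ht i
      nlinarith
    · rcases hij.eq_or_lt with rfl | hij
      · rw [(hU s h w).2, map_one]
        nlinarith [ht j]
      · rw [(hU s h w).1 i j hij, map_zero, zero_mul]
        have := ht i
        positivity

end Bounds

section RootList

/-- The positive roots, ordered by decreasing column from the tail on. -/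
def rootList (n : ℕ) : List (Fin n × Fin n) :=
  ((Finset.univ.filter fun p : Fin n ×ₗ (Fin n)ᵒᵈ =>
    OrderDual.ofDual (ofLex p).2 < (ofLex p).1).sort (· ≤ ·)).map
      fun p => (OrderDual.ofDual (ofLex p).2, (ofLex p).1)

lemma mem_rootList {n : ℕ} {p : Fin n × Fin n} : p ∈ rootList n ↔ p.1 < p.2 := by
  simp only [rootList, List.mem_map, Finset.mem_sort, Finset.mem_filter, Finset.mem_univ, true_and]
  constructor
  · rintro ⟨q, hq, rfl⟩
    exact hq
  · intro h
    exact ⟨toLex (p.2, OrderDual.toDual p.1), h, rfl⟩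

lemma pairwise_rootList (n : ℕ) : (rootList n).Pairwise fun p q =>
    p.2 < q.2 ∨ (p.2 = q.2 ∧ q.1 < p.1) := by
  rw [rootList, List.pairwise_map]
  refine (Finset.sortedLT_sort _).pairwise.imp ?_
  intro p q h
  rcases Prod.Lex.lt_iff.1 h with h | ⟨h1, h2⟩
  · exact Or.inl h
  · exact Or.inr ⟨h1, h2⟩

lemma nodup_rootList (n : ℕ) : (rootList n).Nodup :=
  (pairwise_rootList n).imp fun {p q} h e => by
    subst e; rcases h with h | h
    · exact lt_irrefl _ h
    · exact lt_irrefl _ h.2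

lemma prod_rootList {n : ℕ} {M : Type*} [CommMonoid M] (f : Fin n × Fin n → M) :
    ((rootList n).map f).prod = ∏ j, ∏ i ∈ Finset.Iio j, f (i, j) := by
  rw [← List.prod_toFinset f (nodup_rootList n), Finset.prod_sigma']
  refine Finset.prod_nbij' (fun p => ⟨p.2, p.1⟩) (fun p => (p.2, p.1)) ?_ ?_ ?_ ?_ ?_ <;>
    simp [mem_rootList]

lemma length_rootList (n : ℕ) : (rootList n).length = n * (n - 1) / 2 := by
  rw [← List.toFinset_card_of_nodup (nodup_rootList n)]
  have : (rootList n).toFinset.card = ∑ j : Fin n, (j : ℕ) := by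
    rw [show (rootList n).toFinset = (Finset.univ.sigma fun j : Fin n => Finset.Iio j).map
      ⟨fun p => (p.2, p.1), fun p q h => by
        obtain ⟨p1, p2⟩ := p; obtain ⟨q1, q2⟩ := q; simp at h; simp [h]⟩ by
        ext p; simp [mem_rootList]
        constructor
        · intro h; exact ⟨p.2, p.1, h, rfl⟩
        · rintro ⟨a, b, h, rfl⟩; exact h]
    rw [Finset.card_map, Finset.card_sigma]
    simp
  rw [this, Fin.sum_univ_eq_sum_range (fun i => i), Finset.sum_range_id]

end RootList

section BigCup

variable {S S' : Type*} {k m r : ℕ}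

/-- The cup product of all torus and root coordinates. -/
noncomputable def bigCup (ξ : Fin k → S → Fin r → ℝ)
    (η : Fin (k + 1) × Fin (k + 1) → S → Fin m → ℝ) : List S → ℤ :=
  blockCup ξ (List.finRange k) (blockCup η (rootList (k + 1)) unitCochain)

lemma blockCup_comp {ι : Type*} (u : S → S') (ξ : ι → S' → Fin m → ℝ) (L : List ι) (φ : List S' → ℤ)
    (l : List S) : blockCup ξ L φ (l.map u) =
      blockCup (fun i s => ξ i (u s)) L (fun l => φ (l.map u)) l := by
  rw [blockCup_eq_cupds, blockCup_eq_cupds, cupds_comp, List.map_flatMap]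
  simp only [signs, List.map_map, Function.comp_def]

lemma unitCochain_map (u : S → S') :
    (fun l : List S => unitCochain (l.map u)) = unitCochain := by
  funext l; simp [unitCochain]

lemma bigCup_comp (u : S → S') (ξ : Fin k → S' → Fin r → ℝ)
    (η : Fin (k + 1) × Fin (k + 1) → S' → Fin m → ℝ) (l : List S) :
    bigCup ξ η (l.map u) = bigCup (fun i s => ξ i (u s)) (fun p s => η p (u s)) l := by
  rw [bigCup, blockCup_comp, bigCup]
  congr 1
  funext l
  rw [blockCup_comp, unitCochain_map]

lemma length_flatMap_signs {ι : Type*} (ξ : ι → S → Fin m → ℝ) (L : List ι) :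
    (L.flatMap fun i => signs (ξ i)).length = m * L.length := by
  induction L with
  | nil => simp
  | cons i L ih => simp [ih]; ring

lemma coch_bigCup (ξ : Fin k → S → Fin r → ℝ)
    (η : Fin (k + 1) × Fin (k + 1) → S → Fin m → ℝ) :
    Coch (r * k + m * ((k + 1) * k / 2) + 1) (bigCup ξ η) := by
  rw [bigCup, blockCup_eq_cupds, blockCup_eq_cupds]
  have := (coch_unitCochain.cupds ((rootList (k + 1)).flatMap fun i => signs (η i))).cupds
    ((List.finRange k).flatMap fun i => signs (ξ i))
  rw [length_flatMap_signs, length_flatMap_signs, length_rootList, List.length_finRange,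
    ← add_assoc] at this
  exact this

lemma cobd_bigCup (ξ : Fin k → S → Fin r → ℝ)
    (η : Fin (k + 1) × Fin (k + 1) → S → Fin m → ℝ) : cobd (bigCup ξ η) = 0 := by
  rw [bigCup, blockCup_eq_cupds, blockCup_eq_cupds, ← cupds_append, cobd_cupds _ _
      (by simp [unitCochain]),
    cobd_unitCochain]
  have : ∀ Hs : List (S → ℤ), cupds Hs (0 : List S → ℤ) = 0 := fun Hs => by
    by_contra h
    obtain ⟨l, hl⟩ := Function.ne_iff.1 h
    obtain ⟨l', -, h'⟩ := exists_suffix_of_cupds_ne_zero hl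
    exact h' rfl
  rw [this, smul_zero]

lemma sg_ne_of_bigCup_ne_zero {ξ : Fin k → S → Fin r → ℝ}
    {η : Fin (k + 1) × Fin (k + 1) → S → Fin m → ℝ} {l : List S} (h : bigCup ξ η l ≠ 0) :
    (∀ i j, ∃ s ∈ l, ∃ s' ∈ l, sg (ξ i s j) ≠ sg (ξ i s' j)) ∧
    ∀ p : Fin (k + 1) × Fin (k + 1), p.1 < p.2 → ∀ j,
      ∃ s ∈ l, ∃ s' ∈ l, sg (η p s j) ≠ sg (η p s' j) := by
  rw [bigCup, blockCup_eq_cupds, blockCup_eq_cupds, ← cupds_append] at h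
  have h1 := exists_ne_of_cupds_ne_zero h
  constructor
  · intro i j
    exact h1 (fun s => sg (ξ i s j)) (List.mem_append_left _ (List.mem_flatMap.2
      ⟨i, List.mem_finRange i, List.mem_map.2 ⟨j, List.mem_finRange j, rfl⟩⟩))
  · intro p hp j
    exact h1 (fun s => sg (η p s j)) (List.mem_append_right _ (List.mem_flatMap.2
      ⟨p, mem_rootList.2 hp, List.mem_map.2 ⟨j, List.mem_finRange j, rfl⟩⟩))

end BigCup

section LocalClass

open NumberField NumberField.InfinitePlace NumberField.mixedEmbedding NumberField.Units
  NumberField.Units.dirichletUnitTheorem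
open scoped Classical

variable {K : Type} [Field K] [NumberField K] {k : ℕ} {a : Fin (k + 1) → ℝ}

/-- The unipotent part of a chosen weak Iwasawa decomposition. -/
noncomputable def iwU (ha : ∀ i, 0 < a i) (g : GL (Fin (k + 1)) K) (w : InfinitePlace K) :
    Matrix (Fin (k + 1)) (Fin (k + 1)) K :=
  (exists_isIwasawa w.1 g.1 (Matrix.GeneralLinearGroup.det_ne_zero g) a ha).choose

/-- The diagonal part of a chosen weak Iwasawa decomposition. -/
noncomputable def iwA (ha : ∀ i, 0 < a i) (g : GL (Fin (k + 1)) K) (w : InfinitePlace K) :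
    Fin (k + 1) → ℝ :=
  (exists_isIwasawa w.1 g.1 (Matrix.GeneralLinearGroup.det_ne_zero g) a ha).choose_spec.choose

lemma isIwasawa_iw (ha : ∀ i, 0 < a i) (g : GL (Fin (k + 1)) K) (w : InfinitePlace K) :
    IsIwasawa w.1 a g.1 (iwU ha g w) (iwA ha g w) :=
  (exists_isIwasawa w.1 g.1 (Matrix.GeneralLinearGroup.det_ne_zero g) a
      ha).choose_spec.choose_spec.1

lemma iw_of_upper (ha : ∀ i, 0 < a i) (g : GL (Fin (k + 1)) K) (w : InfinitePlace K)
    (hg : ∀ i j, j < i → g.1 i j = 0) :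
    (∀ i j, iwU ha g w i j = g.1 i j / g.1 j j) ∧ ∀ i, iwA ha g w i = w (g.1 i i) * a i :=
  (exists_isIwasawa w.1 g.1
    (Matrix.GeneralLinearGroup.det_ne_zero g) a ha).choose_spec.choose_spec.2 hg

/-- The coordinates of a family of logarithms. -/
noncomputable def torusCoord {S : Type} (x : S → InfinitePlace K → Fin (k + 1) → ℝ) (i : Fin k)
    (s : S) : Fin (Units.rank K) → ℝ :=
  (torusBasis K).repr (logVec fun w => Real.log (x s w i.castSucc))

/-- The coordinates of a family of matrix entries. -/
noncomputable def rootCoord {S : Type}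
    (u : S → InfinitePlace K → Matrix (Fin (k + 1)) (Fin (k + 1)) K)
    (p : Fin (k + 1) × Fin (k + 1)) (s : S) : Fin (Module.finrank ℚ K) → ℝ :=
  (rootBasis K).repr (rootVec fun w => u s w p.1 p.2)

/-- The local cocycle on the general linear group. -/
noncomputable def locClass (ha : ∀ i, 0 < a i) : List (GL (Fin (k + 1)) K) → ℤ :=
  bigCup (torusCoord (iwA ha)) (rootCoord (iwU ha))

/-- The local cocycle on upper triangular matrices. -/
noncomputable def triClass {S : Type} (f : S → GL (Fin (k + 1)) K) : List S → ℤ :=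
  bigCup (torusCoord fun s (w : InfinitePlace K) i => w ((f s).1 i i))
    (rootCoord fun s _ => Matrix.of fun i j => (f s).1 i j / (f s).1 j j)

lemma locClass_of_upper {S : Type} (ha : ∀ i, 0 < a i) (f : S → GL (Fin (k + 1)) K)
    (hf : ∀ s i j, j < i → (f s).1 i j = 0) (l : List S) :
    locClass ha (l.map f) = triClass f l := by
  rw [locClass, triClass, bigCup_comp]
  congr 2
  · funext i s j
    simp only [torusCoord]
    have : (fun w => Real.log (iwA ha (f s) w i.castSucc)) =
        (fun w : InfinitePlace K => Real.log (w ((f s).1 i.castSucc i.castSucc))) +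
          fun _ => Real.log (a i.castSucc) := by
      funext w
      have h0 : (f s).1 i.castSucc i.castSucc ≠ 0 := by
        have h1 := Matrix.GeneralLinearGroup.det_ne_zero (f s)
        rw [Matrix.det_of_isUpperTriangular fun i j h => hf s i j h] at h1
        exact Finset.prod_ne_zero_iff.1 h1 _ (Finset.mem_univ _)
      rw [(iw_of_upper ha _ w (hf s)).2, Real.log_mul (by simpa using h0) (ha _).ne']
      rfl
    rw [this, map_add, logVec_const, add_zero]
  · funext p s
    simp only [rootCoord]
    congr 3
    funext w
    rw [(iw_of_upper ha _ w (hf s)).1]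
    rfl

/-- Nonvanishing of the local cocycle forces elements to be bounded up to a diagonal matrix which
does not depend on the place, with constants which do not depend on the weights. -/
theorem locClass_bound (k : ℕ) (C D : ℝ) (hC : 1 ≤ C) (hD : 1 ≤ D) :
    ∃ C' : ℝ, 1 ≤ C' ∧ ∀ {a : Fin (k + 1) → ℝ} (ha : ∀ i, 0 < a i) (l : List (GL (Fin (k + 1)) K)),
      (∀ g ∈ l, ∀ g' ∈ l, ∀ (w : InfinitePlace K) i j, w ((g⁻¹ * g').1 i j) * a j ≤ C * a i) →
      (∀ g ∈ l, ∀ w : InfinitePlace K, w g.1.det ≤ D ∧ 1 ≤ D * w g.1.det) →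
      locClass ha l ≠ 0 → ∃ t : Fin (k + 1) → ℝ, (∀ i, 0 < t i) ∧
        ∀ g ∈ l, ∀ (w : InfinitePlace K) i j, w (g.1 i j) * a j ≤ C' * t i ∧
          w ((g⁻¹).1 i j) * t j ≤ C' * a i := by
  set n := k + 1
  set C₁ : ℝ := n * (n * C) * n.factorial
  have hn1 : (1 : ℝ) ≤ n := by simp [n]
  have hf1 : (1 : ℝ) ≤ n.factorial := by exact_mod_cast n.factorial_pos
  have hC₁ : 1 ≤ C₁ := by
    have : 1 ≤ n * C := by nlinarith
    have : 1 ≤ n * (n * C) := by nlinarith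
    simp only [C₁]; nlinarith
  obtain ⟨C₂, hC₂, H₂⟩ := exists_diag_bound (K := K) (k := k) C₁ D hC₁ hD
  obtain ⟨C₃, hC₃, H₃⟩ := exists_unip_bound (K := K) (k := k) (C₁ * C₂ * C₂)
    (by nlinarith [mul_le_mul hC₁ hC₂ zero_le_one (by linarith)])
  set C₄ := n * C₃ * C₂
  have hC₄ : 1 ≤ C₄ := by
    have : 1 ≤ n * C₃ := by nlinarith
    simp only [C₄]; nlinarith
  set C₅ := n.factorial * C₄ ^ n / (1 / C₂ ^ n)
  refine ⟨max C₄ C₅, le_max_of_le_left hC₄, fun {a} ha l hm hdet hF => ?_⟩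
  have hl : l ≠ [] := (coch_bigCup _ _ l hF).2
  obtain ⟨hs1, hs2⟩ := sg_ne_of_bigCup_ne_zero hF
  have hZ : ∀ g ∈ l, ∀ g' ∈ l, ∀ w : InfinitePlace K, ∃ Z, iwU ha g' w = iwU ha g w * Z ∧ Unitri Z ∧
      ∀ i j, w (Z i j) * iwA ha g' w j ≤ C₁ * iwA ha g w i := fun g h g' h' w =>
    (isIwasawa_iw ha g w).exists_quot ha (isIwasawa_iw ha g' w) (W := (g⁻¹ * g').1)
      (by rw [← Units.val_mul, mul_inv_cancel_left]) (hm g h g' h' w)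
  obtain ⟨t, ht, hαt⟩ := H₂ l (iwA ha) (fun g w => w g.1.det) (∏ i, a i) hl
    (Finset.prod_pos fun i _ => ha i) (fun g _ w => (isIwasawa_iw ha g w).pos)
    (fun g hg w => ⟨(isIwasawa_iw ha g w).prod, hdet g hg w⟩)
    (fun g h g' h' w i => by
      obtain ⟨Z, -, h2, h3⟩ := hZ g h g' h' w
      have := h3 i i
      rwa [h2.2, map_one, one_mul] at this) hs1
  have hU := H₃ l (iwU ha) t ht (fun g _ w => (isIwasawa_iw ha g w).unitri) (fun g h g' h' w => by
      obtain ⟨Z, h1, h2, h3⟩ := hZ g h g' h' w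
      refine ⟨Z, h1, h2, fun i j => ?_⟩
      calc w (Z i j) * t j ≤ w (Z i j) * (C₂ * iwA ha g' w j) :=
            mul_le_mul_of_nonneg_left (hαt g' h' w j).2 (apply_nonneg _ _)
        _ = C₂ * (w (Z i j) * iwA ha g' w j) := by ring
        _ ≤ C₂ * (C₁ * (C₂ * t i)) := by
            refine mul_le_mul_of_nonneg_left ((h3 i j).trans ?_) (by linarith)
            exact mul_le_mul_of_nonneg_left (hαt g h w i).1 (by linarith)
        _ = _ := by ring) (fun i j hij q => hs2 (i, j) hij q)
  have hb : ∀ g ∈ l, ∀ (w : InfinitePlace K) i j, w (g.1 i j) * a j ≤ C₄ * t i := by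
    intro g hg w
    obtain ⟨X, hX, hX'⟩ := (isIwasawa_iw ha g w).le
    rw [hX]
    exact mul_bound w.1 ht ha (hU g hg w)
      (fun i j => (hX' i j).trans (hαt g hg w i).1)
  refine ⟨t, ht, fun g hg w i j => ⟨(hb g hg w i j).trans
    (mul_le_mul_of_nonneg_right (le_max_left _ _) (ht i).le), ?_⟩⟩
  have h1 : (g⁻¹).1 = g.1⁻¹ := Matrix.coe_units_inv g
  rw [h1]
  refine (inv_bound w.1 hC₄ (ε := 1 / C₂ ^ n) (by positivity) g.1 t a ht ha (hb g hg w) ?_ i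
      j).trans
    (mul_le_mul_of_nonneg_right (le_max_right _ _) (ha i).le)
  rw [← (isIwasawa_iw ha g w).prod, one_div, inv_mul_le_iff₀ (by positivity)]
  calc ∏ i, t i ≤ ∏ i, (C₂ * iwA ha g w i) :=
        Finset.prod_le_prod (fun i _ => (ht i).le) fun i _ => (hαt g hg w i).2
    _ = _ := by rw [Finset.prod_mul_distrib, Finset.prod_const, Finset.card_univ, Fintype.card_fin]

end LocalClass

section Generalities

lemma mem_normalizer_of_conj {G : Type*} [Group G] {N : Subgroup G} {g : G}
    (h : ∀ x ∈ N, g * x * g⁻¹ ∈ N) (h' : ∀ x ∈ N, g⁻¹ * x * g ∈ N) :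
    g ∈ Subgroup.normalizer (N : Set G) := by
  rw [Subgroup.mem_normalizer_iff]
  refine fun x => ⟨h x, fun hx => ?_⟩
  have := h' _ hx
  simpa [mul_assoc] using this

lemma mem_normalizer_blockGroup {G : Type*} [Group G] {ι : Type*} {m : ℕ} {N : Subgroup G}
    {τ : ι → (Fin m → ℤ) → G} {L : List ι} {g : G}
    (hN : ∀ x ∈ N, g * x * g⁻¹ ∈ blockGroup N τ L ∧ g⁻¹ * x * g ∈ blockGroup N τ L)
    (h : ∀ i ∈ L, ∀ a, g * τ i a * g⁻¹ ∈ blockGroup N τ L ∧ g⁻¹ * τ i a * g ∈ blockGroup N τ L) :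
    g ∈ Subgroup.normalizer (blockGroup N τ L : Set G) := by
  have h1 : blockGroup N τ L ≤ (blockGroup N τ L).comap (MulAut.conj g).toMonoidHom :=
    blockGroup_le_iff.2 ⟨fun x hx => (hN x hx).1, fun i hi a => (h i hi a).1⟩
  have h2 : blockGroup N τ L ≤ (blockGroup N τ L).comap (MulAut.conj g⁻¹).toMonoidHom := by
    refine blockGroup_le_iff.2 ⟨fun x hx => ?_, fun i hi a => ?_⟩
    · simpa using (hN x hx).2
    · simpa using (h i hi a).2
  refine mem_normalizer_of_conj (fun x hx => h1 hx) fun x hx => ?_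
  simpa using h2 hx

/-- The subgroup of elements whose action preserves a function. -/
def fixer {G S T : Type*} [Group G] [MulAction G S] (ξ : S → T) : Subgroup G where
  carrier := {a | ∀ s, ξ (a • s) = ξ s}
  one_mem' s := by rw [one_smul]
  mul_mem' {a b} ha hb s := by rw [mul_smul, ha, hb]
  inv_mem' {a} ha s := by rw [← ha, smul_inv_smul]

lemma mem_blockGroup {G : Type*} [Group G] {ι : Type*} {m : ℕ} {N : Subgroup G}
    {τ : ι → (Fin m → ℤ) → G} {L : List ι} {i : ι} (hi : i ∈ L) (a) : τ i a ∈ blockGroup N τ L :=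
  (blockGroup_le_iff.1 le_rfl).2 i hi a

lemma mem_suffix_rootList {n : ℕ} {p x : Fin n × Fin n} {L : List (Fin n × Fin n)}
    (h : p :: L <:+ rootList n) :
    x ∈ L ↔ x.1 < x.2 ∧ (p.2 < x.2 ∨ (p.2 = x.2 ∧ x.1 < p.1)) := by
  obtain ⟨L', hL⟩ := h
  have hp := pairwise_rootList n
  rw [← hL, List.pairwise_append] at hp
  obtain ⟨-, h1, h2⟩ := hp
  rw [List.pairwise_cons] at h1
  constructor
  · intro hx
    exact ⟨mem_rootList.1 (hL ▸ List.mem_append_right _ (List.mem_cons_of_mem _ hx)), h1.1 x hx⟩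
  · rintro ⟨hx, h3⟩
    have h4 : x ∈ L' ++ p :: L := hL ▸ mem_rootList.2 hx
    rcases List.mem_append.1 h4 with h4 | h4
    · have := h2 x h4 p List.mem_cons_self
      omega
    · rcases List.mem_cons.1 h4 with rfl | h4
      · omega
      · exact h4

lemma lt_of_suffix_rootList {n : ℕ} {p : Fin n × Fin n} {L : List (Fin n × Fin n)}
    (h : p :: L <:+ rootList n) : p.1 < p.2 :=
  mem_rootList.1 (h.subset List.mem_cons_self)

end Generalities

section Borel

open NumberField NumberField.InfinitePlace NumberField.mixedEmbedding NumberField.Units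
  NumberField.Units.dirichletUnitTheorem
open scoped Classical

variable (K : Type) [Field K] (n : ℕ)

/-- The upper triangular subgroup. -/
def borel : Subgroup (GL (Fin n) K) where
  carrier := {g | ∀ i j, j < i → g.1 i j = 0}
  one_mem' i j h := Matrix.one_apply_ne h.ne'
  mul_mem' {g h} hg hh i j hij := by
    rw [Units.val_mul, Matrix.mul_apply]
    refine Finset.sum_eq_zero fun l _ => ?_
    rcases lt_or_ge l i with h | h
    · rw [hg i l h, zero_mul]
    · rw [hh l j (hij.trans_le h), mul_zero]
  inv_mem' {g} hg i j hij := by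
    have hd : IsUnit g.1.det := (Matrix.isUnit_iff_isUnit_det _).1 g.isUnit
    let := Matrix.invertibleOfIsUnitDet g.1 hd
    have hb : g.1.BlockTriangular id := fun i j h => hg i j h
    rw [Matrix.coe_units_inv]
    exact Matrix.blockTriangular_inv_of_blockTriangular hb hij

variable {K n}

/-- The underlying matrix. -/
def toMat : borel K n →* Matrix (Fin n) (Fin n) K := (Units.coeHom _).comp (borel K n).subtype

lemma toMat_apply (b : borel K n) : toMat b = b.1.1 := rfl

lemma toMat_injective : Function.Injective (toMat : borel K n → _) := fun _ _ h =>
  Subtype.ext (Units.ext h)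

lemma toMat_lower (b : borel K n) {i j : Fin n} (h : j < i) : toMat b i j = 0 := b.2 i j h

lemma det_toMat (b : borel K n) : (toMat b).det = ∏ i, toMat b i i :=
  Matrix.det_of_isUpperTriangular fun _ _ h => toMat_lower b h

lemma toMat_diag_ne_zero (b : borel K n) (i : Fin n) : toMat b i i ≠ 0 := by
  have h1 : (toMat b).det ≠ 0 := Matrix.GeneralLinearGroup.det_ne_zero b.1
  rw [det_toMat] at h1
  exact Finset.prod_ne_zero_iff.1 h1 _ (Finset.mem_univ _)

lemma toMat_mul_diag (b c : borel K n) (i : Fin n) :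
    toMat (b * c) i i = toMat b i i * toMat c i i := by
  rw [map_mul, Matrix.mul_apply, Finset.sum_eq_single i]
  · intro l _ hl
    rcases lt_or_gt_of_ne hl with h | h
    · rw [toMat_lower b h, zero_mul]
    · rw [toMat_lower c h, mul_zero]
  · simp

/-- Elementary matrices. -/
def rootElt (p : Fin n × Fin n) (t : K) : borel K n :=
  if h : p.1 < p.2 then
    ⟨⟨Matrix.transvection p.1 p.2 t, Matrix.transvection p.1 p.2 (-t), by
      rw [Matrix.transvection_mul_transvection_same _ _ h.ne, add_neg_cancel,
          Matrix.transvection_zero],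
      by rw [Matrix.transvection_mul_transvection_same _ _ h.ne, neg_add_cancel,
        Matrix.transvection_zero]⟩, by
      intro i j hij
      have : ¬(p.1 = i ∧ p.2 = j) := fun h' => by omega
      simp [Matrix.transvection, hij.ne', this]⟩
  else 1

lemma toMat_rootElt {p : Fin n × Fin n} (h : p.1 < p.2) (t : K) :
    toMat (rootElt p t) = 1 + Matrix.single p.1 p.2 t := by
  rw [rootElt, dif_pos h]; rfl

lemma rootElt_add (p : Fin n × Fin n) (t u : K) :
    rootElt p (t + u) = rootElt p t * rootElt p u := by
  by_cases h : p.1 < p.2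
  · apply toMat_injective
    rw [map_mul, toMat_rootElt h, toMat_rootElt h, toMat_rootElt h]
    simp [mul_add, add_mul, h.ne', Matrix.single_add, add_assoc]
  · simp [rootElt, h]

lemma rootElt_zero (p : Fin n × Fin n) : rootElt p (0 : K) = 1 := by
  have := rootElt_add p (0 : K) 0
  rw [add_zero] at this
  exact left_eq_mul.1 this

lemma rootElt_neg (p : Fin n × Fin n) (t : K) : rootElt p (-t) = (rootElt p t)⁻¹ := by
  rw [eq_inv_iff_mul_eq_one, ← rootElt_add, neg_add_cancel, rootElt_zero]

lemma rootElt_comm {p x : Fin n × Fin n} (hp : p.1 < p.2) (hx : x.1 < x.2) (h : p.2 ≠ x.1)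
    (h' : x.2 ≠ p.1) (t u : K) : rootElt p u * rootElt x t = rootElt x t * rootElt p u := by
  apply toMat_injective
  rw [map_mul, map_mul, toMat_rootElt hp, toMat_rootElt hx]
  simp [mul_add, add_mul, h, h']
  abel

lemma rootElt_commutator {p x : Fin n × Fin n} (hp : p.1 < p.2) (hx : x.1 < x.2) (h : p.2 = x.1)
    (t u : K) : rootElt p u * rootElt x t =
      rootElt (p.1, x.2) (u * t) * rootElt x t * rootElt p u := by
  have h1 : p.1 < x.2 := hp.trans (h ▸ hx)
  obtain ⟨i, j⟩ := p
  obtain ⟨j', l⟩ := x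
  simp only at h hp hx h1
  subst h
  apply toMat_injective
  rw [map_mul, map_mul, map_mul, toMat_rootElt hp, toMat_rootElt hx, toMat_rootElt h1]
  simp [mul_add, add_mul, h1.ne', hx.ne']
  abel

lemma toMat_mul_rootElt_mul {p : Fin n × Fin n} (hp : p.1 < p.2) (t : K) (r s : borel K n)
    (i j : Fin n) : toMat (r * (rootElt p t * s)) i j =
      toMat (r * s) i j + toMat r i p.1 * t * toMat s p.2 j := by
  simp only [map_mul, toMat_rootElt hp, add_mul, mul_add, one_mul, Matrix.add_apply]
  congr 1
  rw [← mul_assoc, Matrix.mul_apply, Finset.sum_eq_single p.2]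
  · simp
  · intro b _ hb; simp [Matrix.mul_single_apply_of_ne, hb]
  · simp

lemma toMat_mul_rootElt_mul_of {p : Fin n × Fin n} (hp : p.1 < p.2) (t : K) (r s : borel K n)
    {i j : Fin n} (h : p.1 < i ∨ j < p.2) : toMat (r * (rootElt p t * s)) i j =
      toMat (r * s) i j := by
  rw [toMat_mul_rootElt_mul hp]
  rcases h with h | h
  · rw [toMat_lower r h]; ring
  · rw [toMat_lower s h]; ring

variable [NumberField K]

/-- Integral linear combinations of the integral basis. -/
noncomputable def lat (a : Fin (Module.finrank ℚ K) → ℤ) : K := ∑ j, a j • fieldBasis K j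

lemma lat_add (a b : Fin (Module.finrank ℚ K) → ℤ) : lat (a + b) = lat a + lat b := by
  simp [lat, add_mul, Finset.sum_add_distrib]

lemma lat_neg (a : Fin (Module.finrank ℚ K) → ℤ) : lat (-a) = -lat a := by
  simp [lat]

lemma repr_lat (a : Fin (Module.finrank ℚ K) → ℤ) (j) : (fieldBasis K).repr (lat a) j = a j := by
  simp only [lat, map_sum, map_zsmul, Module.Basis.repr_self, Finsupp.finsetSum_apply,
    Finsupp.smul_apply, Finsupp.single_apply]
  simp

lemma isIntegral_lat (a : Fin (Module.finrank ℚ K) → ℤ) : IsIntegral ℤ (lat a) := by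
  refine IsIntegral.sum _ fun j _ => IsIntegral.zsmul ?_ _
  rw [fieldBasis, Module.Basis.reindex_apply, integralBasis_apply]
  exact RingOfIntegers.isIntegral_coe _

lemma exists_lat {x : K} (hx : IsIntegral ℤ x) : ∃ a, lat a = x := by
  refine ⟨fun j => (RingOfIntegers.basis K).repr ⟨x, hx⟩ ((ringIdx K).symm j), ?_⟩
  apply (fieldBasis K).repr.injective
  ext j
  rw [repr_lat, fieldBasis, Module.Basis.repr_reindex_apply]
  exact (integralBasis_repr_apply K ⟨x, hx⟩ _).symm

/-- The block of a root. -/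
noncomputable def rootBlock (q : ℕ) (p : Fin n × Fin n) (a : Fin (Module.finrank ℚ K) → ℤ) :
    borel K n := rootElt p (q * lat a)

lemma blockData_root (q : ℕ) {p : Fin n × Fin n} {L : List (Fin n × Fin n)}
    (h : p :: L <:+ rootList n) :
    BlockData (blockGroup (⊥ : Subgroup (borel K n)) (rootBlock (2 * q)) L) (rootBlock (2 * q) p)
      (rootBlock q p) := by
  have hp := lt_of_suffix_rootList h
  refine ⟨fun a b => ?_, fun a => ?_, fun a b => ?_, fun a => ?_⟩
  · rw [rootBlock, lat_add, mul_add, rootElt_add]; rfl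
  · rw [rootBlock, rootBlock, ← rootElt_add]
    congr 1; push_cast; ring
  · rw [rootBlock, rootBlock, ← rootElt_add, add_comm, rootElt_add]
  · have key : ∀ a, ∀ x ∈ L, ∀ b, rootBlock q p a * rootBlock (2 * q) x b * (rootBlock q p a)⁻¹ ∈
        blockGroup (⊥ : Subgroup (borel K n)) (rootBlock (2 * q)) L := by
      intro a x hx b
      have hx' := (mem_suffix_rootList h).1 hx
      by_cases hpx : p.2 = x.1
      · rw [rootBlock, rootBlock, rootElt_commutator hp hx'.1 hpx, mul_inv_cancel_right]
        refine mul_mem ?_ (mem_blockGroup hx b)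
        obtain ⟨c, hc⟩ := exists_lat (K := K) (x := q * lat a * lat b)
          (((map_natCast (algebraMap ℤ K) q ▸ isIntegral_algebraMap (R := ℤ) (x := (q : ℤ)) :
            IsIntegral ℤ (q : K)).mul (isIntegral_lat a)).mul (isIntegral_lat b))
        have : rootElt (p.1, x.2) (q * lat a * ((2 * q : ℕ) * lat b)) =
            rootBlock (K := K) (2 * q) (p.1, x.2) c := by
          rw [rootBlock, hc]; congr 1; ring
        rw [this]
        refine mem_blockGroup ((mem_suffix_rootList h).2 ⟨?_, ?_⟩) c
        · simp only; omega
        · left; simp only; omega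
      · rw [rootBlock, rootBlock, rootElt_comm hp hx'.1 hpx (by omega), mul_inv_cancel_right]
        exact mem_blockGroup hx b
    refine mem_normalizer_blockGroup (fun x hx => ?_) fun x hx b => ⟨key a x hx b, ?_⟩
    · rw [Subgroup.mem_bot.1 hx]; simp
    · have := key (-a) x hx b
      rw [show rootBlock q p (-a) = (rootBlock q p a)⁻¹ by
        rw [rootBlock, lat_neg, mul_neg, rootElt_neg]; rfl, inv_inv] at this
      exact this

end Borel

section Torus

open NumberField NumberField.InfinitePlace NumberField.mixedEmbedding NumberField.Units
  NumberField.Units.dirichletUnitTheorem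
open scoped Classical

variable {K : Type} [Field K] {k : ℕ}

/-- Diagonal matrices. -/
def diagElt (n : ℕ) : (Fin n → Kˣ) →* borel K n where
  toFun d := ⟨⟨Matrix.diagonal fun i => (d i : K), Matrix.diagonal fun i => ((d i)⁻¹ : Kˣ), by simp,
    by simp⟩, fun i j h => Matrix.diagonal_apply_ne _ h.ne'⟩
  map_one' := Subtype.ext (Units.ext (by simp))
  map_mul' d e := Subtype.ext (Units.ext (by simp))

lemma toMat_diagElt {n : ℕ} (d : Fin n → Kˣ) :
    toMat (diagElt n d) = Matrix.diagonal fun i => (d i : K) := rfl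

lemma diagElt_conj {n : ℕ} (d : Fin n → Kˣ) {p : Fin n × Fin n} (hp : p.1 < p.2) (t : K) :
    diagElt n d * rootElt p t * (diagElt n d)⁻¹ = rootElt p ((d p.1 : K) * t * ((d p.2)⁻¹ : Kˣ)) :=
        by
  rw [mul_inv_eq_iff_eq_mul]
  apply toMat_injective
  rw [map_mul, map_mul, toMat_rootElt hp, toMat_rootElt hp, toMat_diagElt]
  simp only [mul_add, add_mul, mul_one, one_mul]
  congr 1
  ext i j
  rw [Matrix.diagonal_mul, Matrix.mul_diagonal, Matrix.single_apply, Matrix.single_apply]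
  split_ifs with h
  · rw [← h.1, ← h.2]; simp [mul_assoc]
  · simp

lemma toMat_mul_diagElt_mul {n : ℕ} (d : Fin n → Kˣ) (r s : borel K n) (i : Fin n) :
    toMat (r * (diagElt n d * s)) i i = d i * toMat (r * s) i i := by
  simp only [toMat_mul_diag, toMat_diagElt, Matrix.diagonal_apply_eq]; ring

/-- The cocharacter supported at an index and at the last index. -/
def cochar (i : Fin k) : Kˣ →* (Fin (k + 1) → Kˣ) where
  toFun u j := if j = i.castSucc then u else if j = Fin.last k then u⁻¹ else 1
  map_one' := by ext j; simp
  map_mul' u v := by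
    ext j
    simp only [Pi.mul_apply]
    split_ifs <;> simp [mul_comm]

lemma cochar_self (i : Fin k) (u : Kˣ) : cochar i u i.castSucc = u := by simp [cochar]
lemma cochar_ne {i j : Fin k} (h : j ≠ i) (u : Kˣ) : cochar i u j.castSucc = 1 := by
  simp [cochar, h, (Fin.castSucc_lt_last j).ne]

variable [NumberField K]

/-- Units parametrized by exponents of fundamental units. -/
noncomputable def fundUnit (a : Fin (Units.rank K) → ℤ) : (𝓞 K)ˣ := ∏ j, fundSystem K j ^ a j

lemma fundUnit_add (a b : Fin (Units.rank K) → ℤ) :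
    fundUnit (K := K) (a + b) = fundUnit a * fundUnit b := by
  simp [fundUnit, zpow_add, Finset.prod_mul_distrib]

lemma fundUnit_neg (a : Fin (Units.rank K) → ℤ) : fundUnit (K := K) (-a) = (fundUnit a)⁻¹ := by
  simp [fundUnit]

lemma fundUnit_nsmul (N : ℕ) (a : Fin (Units.rank K) → ℤ) :
    fundUnit (K := K) (N • a) = fundUnit a ^ N := by
  simp [fundUnit, ← Finset.prod_pow, zpow_mul, mul_comm]

lemma torusBasis_repr_fundUnit (a : Fin (Units.rank K) → ℤ) (j) :
    (torusBasis K).repr (logVec fun w : InfinitePlace K => Real.log (w ((fundUnit a : 𝓞 K) : K))) j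
      = a j := by
  rw [logVec_unit]
  have : logEmbedding K (Additive.ofMul (fundUnit a)) = ∑ j, (a j : ℝ) • torusBasis K j := by
    simp only [torusBasis_apply, fundUnit, ofMul_prod, map_sum, ofMul_zpow, map_zsmul,
        Int.cast_smul_eq_zsmul]
  rw [this, Module.Basis.repr_sum_self]

/-- The block of a torus coordinate. -/
noncomputable def torusBlock (N : ℕ) (i : Fin k) (a : Fin (Units.rank K) → ℤ) : borel K (k + 1) :=
  diagElt _ (cochar i (Units.map (algebraMap (𝓞 K) K).toMonoidHom (fundUnit a ^ N)))

lemma torusBlock_add (N : ℕ) (i : Fin k) (a b : Fin (Units.rank K) → ℤ) :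
    torusBlock N i (a + b) = torusBlock N i a * torusBlock N i b := by
  simp [torusBlock, fundUnit_add, mul_pow]

end Torus

section Cosets

variable {S G : Type} [Group G] [MulAction G S]

/-- A group as a union of cosets. -/
noncomputable def cosetEquiv {α : Type*} [Group α] (s : Subgroup α) : (α ⧸ s) × s ≃ α :=
  Equiv.ofBijective (fun x => x.1.out * x.2) ⟨fun ⟨c, b⟩ ⟨c', b'⟩ h => by
    have h' : c.out * b = c'.out * b' := h
    have e : c = c' := by
      have := congrArg (QuotientGroup.mk (s := s)) h'
      rwa [QuotientGroup.mk_mul_of_mem _ b.2, QuotientGroup.mk_mul_of_mem _ b'.2,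
        QuotientGroup.out_eq', QuotientGroup.out_eq'] at this
    subst e
    rw [Subtype.ext (mul_left_cancel h')], fun x => ⟨⟨x, ⟨(x : α ⧸ s).out⁻¹ * x, by
      rw [← QuotientGroup.eq, QuotientGroup.out_eq']⟩⟩, by simp⟩⟩

lemma finsum_subgroup {M : Type*} [AddCommMonoid M] {α : Type*} [Group α] (s : Subgroup α)
    (f : α → M)
    (hf : (Function.support f).Finite) :
    (∑ᶠ x, f x = ∑ᶠ c : α ⧸ s, ∑ᶠ b : s, f (c.out * b)) ∧
      (Function.support fun c : α ⧸ s => ∑ᶠ b : s, f (c.out * b)).Finite := by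
  let e := cosetEquiv s
  have h1 : (Function.support fun x => f (e x)).Finite := hf.preimage e.injective.injOn
  refine ⟨?_, ?_⟩
  · rw [← finsum_comp_equiv e, finsum_curry _ h1]; rfl
  · refine (h1.image Prod.fst).subset fun c hc => ?_
    obtain ⟨b, hb⟩ : ∃ b : s, f (c.out * b) ≠ 0 := by
      by_contra! hb
      exact hc (by simp [hb])
    exact ⟨(c, b), hb, rfl⟩

theorem exists_chain_of_fund {N Γ : Subgroup G} (hN : N ≤ Γ) {n : ℕ} {g : List S → ℤ} (hF : Fund N
    (n + 2) g)
    {κ : ℤ} (hκ : κ ≠ 0) {F : List S → ℤ}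
    (h : ∀ r ∈ Γ, Coh N (n + 2) (SN N (tr r F)) (κ • g)) :
    ∃ z : List S →₀ ℚ, (∀ α : List S → ℚ, Inv Γ α → Finsupp.linearCombination ℚ (cobd α) z = 0) ∧
      ((∀ l ∈ z.support, (Function.support fun x : Γ => F (l.map (x.1 • ·))).Finite) →
        Finsupp.linearCombination ℚ (fun l => ((∑ᶠ x : Γ, F (l.map (x.1 • ·)) : ℤ) : ℚ)) z ≠ 0) :=
            by
  obtain ⟨z, hz, hz'⟩ := exists_chain (N := N) (n := n + 1) (by simp) (g := scl g (1 : ℚ))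
      (fun l hl => by
    refine hF.coch l fun h => hl ?_
    simp [scl, h]) fun α hα hα' h => one_ne_zero (hF.free ℚ 1 α hα hα' h)
  refine ⟨z, fun α hα => hz α (hα.mono hN), fun hfin => ?_⟩
  have h1 : ∀ r ∈ Γ, Finsupp.linearCombination ℚ (fun l => (SN N (tr r F) l : ℚ)) z =
      κ * Finsupp.linearCombination ℚ (scl g (1 : ℚ)) z := by
    intro r hr
    obtain ⟨α, hα, hα', e⟩ := h r hr
    have h2 := hz (fun l => (Int.castAddHom ℚ) (α l)) (hα'.map _)
    have h3 : cobd (fun l => (Int.castAddHom ℚ) (α l)) = fun l => ((cobd α l : ℤ) : ℚ) :=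
      funext fun l => cobd_map (Int.castAddHom ℚ) α l
    rw [h3, Finsupp.linearCombination_apply, Finsupp.sum] at h2
    simp only [e, Finsupp.linearCombination_apply, Finsupp.sum, Pi.add_apply, Int.cast_add,
        smul_add,
      Finset.sum_add_distrib, h2, add_zero, Finset.mul_sum]
    refine Finset.sum_congr rfl fun l _ => ?_
    simp [scl]; ring
  set v := Finsupp.linearCombination ℚ (scl g (1 : ℚ)) z
  have hv : (κ : ℚ) * v ≠ 0 := mul_ne_zero (by exact_mod_cast hκ) hz'
  let N' := N.subgroupOf Γ
  let e : N' ≃ N := (Subgroup.subgroupOfEquivOfLe hN).toEquiv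
  have h4 : ∀ (l : List S) (c : Γ ⧸ N'), ∑ᶠ b : N', F (l.map ((c.out * b : Γ).1 • ·)) = SN N
      (tr c.out.1 F) l := by
    intro l c
    rw [SN, sumtr, ← finsum_comp_equiv e]
    refine finsum_congr fun b => ?_
    rw [← tr_mul]; rfl
  have h5 := fun l hl => finsum_subgroup N' (fun x : Γ => F (l.map (x.1 • ·))) (hfin l hl)
  simp only [h4] at h5
  have h6 : Finsupp.linearCombination ℚ (fun l => ((∑ᶠ x : Γ, F (l.map (x.1 • ·)) : ℤ) : ℚ)) z =
      ∑ᶠ c : Γ ⧸ N', (κ : ℚ) * v := by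
    have h7 : ∀ c : Γ ⧸ N', (κ : ℚ) * v = ∑ l ∈ z.support, z l * (SN N (tr c.out.1 F) l : ℚ) := fun
        c =>
      (h1 _ c.out.2).symm.trans (by simp [Finsupp.linearCombination_apply, Finsupp.sum])
    rw [finsum_congr h7]
    rw [finsum_sum_comm, Finsupp.linearCombination_apply, Finsupp.sum]
    · refine Finset.sum_congr rfl fun l hl => ?_
      rw [(h5 l hl).1, smul_eq_mul]
      exact (((AddMonoidHom.mulLeft (z l)).comp (Int.castAddHom ℚ)).map_finsum (h5 l hl).2)
    · exact fun l hl => (h5 l hl).2.subset fun c hc h => hc (by simp [h])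
  have h8 : (Set.univ : Set (Γ ⧸ N')).Finite := by
    refine (z.support.finite_toSet.biUnion fun l hl => (h5 l hl).2).subset fun c _ => ?_
    by_contra hc
    refine hv ?_
    rw [← h1 c.out.1 c.out.2, Finsupp.linearCombination_apply]
    refine Finset.sum_eq_zero fun l hl => ?_
    have : SN N (tr c.out.1 F) l = 0 := by
      by_contra h
      exact hc (Set.mem_biUnion hl h)
    simp [this]
  have : Finite (Γ ⧸ N') := Set.finite_univ_iff.1 h8
  have := Fintype.ofFinite (Γ ⧸ N')
  rw [h6, finsum_eq_sum_of_fintype, Finset.sum_const, nsmul_eq_mul]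
  exact mul_ne_zero (by simp) hv

end Cosets
section RootCoords

open NumberField NumberField.InfinitePlace NumberField.mixedEmbedding NumberField.Units
  NumberField.Units.dirichletUnitTheorem
open scoped Classical

variable {K : Type} [Field K] [NumberField K] {k : ℕ}

/-- The root coordinates of a translate. -/
noncomputable def rootXi (r : borel K (k + 1)) :
    Fin (k + 1) × Fin (k + 1) → borel K (k + 1) → Fin (Module.finrank ℚ K) → ℝ :=
  rootCoord fun s _ => Matrix.of fun i j => toMat (r * s) i j / toMat (r * s) j j

/-- The torus coordinates of a translate. -/
noncomputable def torusXi (r : borel K (k + 1)) :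
    Fin k → borel K (k + 1) → Fin (Units.rank K) → ℝ :=
  torusCoord fun s (w : InfinitePlace K) i => w (toMat (r * s) i i)

lemma triClass_eq (r : borel K (k + 1)) :
    triClass (fun s : borel K (k + 1) => (r * s).1) = bigCup (torusXi r) (rootXi r) := rfl

lemma rootXi_apply (r s : borel K (k + 1)) (p j) :
    rootXi r p s j =
      ((fieldBasis K).repr (toMat (r * s) p.1 p.2 / toMat (r * s) p.2 p.2) j : ℝ) := by
  rw [← rootBasis_repr, ← rootVec_const]; rfl

/-- The transition matrix of a root block. -/
noncomputable def rootMat (q : ℕ) (r : borel K (k + 1)) (p : Fin (k + 1) × Fin (k + 1)) :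
    Matrix (Fin (Module.finrank ℚ K)) (Fin (Module.finrank ℚ K)) ℝ :=
  (Algebra.leftMulMatrix (fieldBasis K) (q * (toMat r p.1 p.1 / toMat r p.2 p.2))).map (Rat.castHom
      ℝ)

lemma det_rootMat (q : ℕ) (r : borel K (k + 1)) (p : Fin (k + 1) × Fin (k + 1)) :
    (rootMat q r p).det =
      (Algebra.norm ℚ ((q : K) * (toMat r p.1 p.1 / toMat r p.2 p.2)) : ℚ) := by
  rw [Algebra.norm_eq_matrix_det (fieldBasis K)]
  exact (RingHom.map_det (Rat.castHom ℝ) _).symm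

lemma coords_root {q : ℕ} (hq : q ≠ 0) (r : borel K (k + 1)) {p : Fin (k + 1) × Fin (k + 1)}
    {L : List (Fin (k + 1) × Fin (k + 1))} (h : p :: L <:+ rootList (k + 1)) :
    Coords (blockGroup (⊥ : Subgroup (borel K (k + 1))) (rootBlock q) L) (rootBlock q p)
      (rootXi r p) (rootMat q r p) := by
  have hp := lt_of_suffix_rootList h
  refine ⟨?_, fun a s => ?_, ?_⟩
  · suffices blockGroup (⊥ : Subgroup (borel K (k + 1))) (rootBlock q) L ≤ fixer (rootXi r p) from
        this
    refine blockGroup_le_iff.2 ⟨bot_le, fun x hx a s => ?_⟩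
    have hx' := (mem_suffix_rootList h).1 hx
    funext j
    rw [rootXi_apply, rootXi_apply, smul_eq_mul, rootBlock,
      toMat_mul_rootElt_mul_of hx'.1 _ _ _ (by omega), toMat_mul_rootElt_mul_of hx'.1 _ _ _
          (by omega)]
  · funext j
    rw [Pi.add_apply, rootXi_apply, rootXi_apply, smul_eq_mul, rootBlock,
      toMat_mul_rootElt_mul_of (i := p.2) (j := p.2) hp _ _ _ (Or.inl hp), toMat_mul_rootElt_mul hp,
      add_div, map_add, Finsupp.add_apply, Rat.cast_add]
    congr 1
    have e : toMat r p.1 p.1 * (q * lat a) * toMat s p.2 p.2 / toMat (r * s) p.2 p.2 =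
        (q * (toMat r p.1 p.1 / toMat r p.2 p.2)) * lat a := by
      rw [toMat_mul_diag]
      have := toMat_diag_ne_zero r p.2
      have := toMat_diag_ne_zero s p.2
      field_simp
    rw [e, ← Algebra.leftMulMatrix_mulVec_repr]
    have e2 : ⇑((fieldBasis K).repr (lat a)) = fun j => (a j : ℚ) := funext fun j => repr_lat a j
    rw [e2, rootMat, Matrix.mulVec, Matrix.mulVec, dotProduct, dotProduct, Rat.cast_sum]
    exact Finset.sum_congr rfl fun i _ => by simp
  · rw [det_rootMat]
    have := toMat_diag_ne_zero r p.1
    have := toMat_diag_ne_zero r p.2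
    have : (q : K) ≠ 0 := by exact_mod_cast hq
    simp only [ne_eq, Rat.cast_eq_zero, Algebra.norm_eq_zero_iff]
    positivity

lemma conj_mem_rootGroup {n q : ℕ} {d : Fin n → Kˣ} (h : ∀ j, IsIntegral ℤ (d j : K))
    (h' : ∀ j, IsIntegral ℤ (((d j)⁻¹ : Kˣ) : K)) :
    ∀ x ∈ blockGroup (⊥ : Subgroup (borel K n)) (rootBlock q) (rootList n),
      diagElt n d * x * (diagElt n d)⁻¹ ∈
        blockGroup (⊥ : Subgroup (borel K n)) (rootBlock q) (rootList n) := by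
  suffices blockGroup (⊥ : Subgroup (borel K n)) (rootBlock q) (rootList n) ≤
      (blockGroup (⊥ : Subgroup (borel K n)) (rootBlock q) (rootList n)).comap
        (MulAut.conj (diagElt n d)).toMonoidHom from fun x hx => this hx
  refine blockGroup_le_iff.2 ⟨bot_le, fun p hp a => ?_⟩
  obtain ⟨c, hc⟩ := exists_lat (((h p.1).mul (isIntegral_lat a)).mul (h' p.2))
  have e : diagElt n d * rootBlock q p a * (diagElt n d)⁻¹ = rootBlock q p c := by
    rw [rootBlock, rootBlock, diagElt_conj d (mem_rootList.1 hp), hc]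
    congr 1; ring
  change diagElt n d * rootBlock q p a * (diagElt n d)⁻¹ ∈ blockGroup _ _ _
  rw [e]
  exact mem_blockGroup hp c

lemma blockData_torus (N q : ℕ) {i : Fin k} {L : List (Fin k)} :
    BlockData (blockGroup (blockGroup (⊥ : Subgroup (borel K (k + 1))) (rootBlock q)
        (rootList (k + 1)))
      (torusBlock (2 * N)) L) (torusBlock (2 * N) i) (torusBlock N i) := by
  refine ⟨torusBlock_add _ _, fun a => ?_, fun a b => ?_, fun a => ?_⟩
  · rw [torusBlock, torusBlock, ← map_mul, ← map_mul, ← map_mul, two_mul, pow_add]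
  · rw [torusBlock, torusBlock, ← map_mul, ← map_mul, ← map_mul, ← map_mul, ← map_mul, ← map_mul,
        mul_comm]
  · have h1 : ∀ a j, IsIntegral ℤ ((cochar i (Units.map (algebraMap (𝓞 K) K).toMonoidHom
        (fundUnit a ^ N)) j : Kˣ) : K) := by
      intro a j
      simp only [cochar, MonoidHom.coe_mk, OneHom.coe_mk]
      split_ifs
      · exact RingOfIntegers.isIntegral_coe _
      · rw [← map_inv]
        exact RingOfIntegers.isIntegral_coe _
      · exact isIntegral_one
    have h2 : torusBlock N i (-a) = (torusBlock N i a)⁻¹ := by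
      rw [eq_inv_iff_mul_eq_one, ← torusBlock_add, neg_add_cancel]
      simp [torusBlock, fundUnit]
    have h3 : ∀ a, ∀ x ∈ blockGroup (⊥ : Subgroup (borel K (k + 1))) (rootBlock q)
        (rootList (k + 1)),
        torusBlock N i a * x * (torusBlock N i a)⁻¹ ∈
          blockGroup (⊥ : Subgroup (borel K (k + 1))) (rootBlock q) (rootList (k + 1)) := by
      intro a
      refine conj_mem_rootGroup (h1 a) fun j => ?_
      have := h1 (-a) j
      rwa [fundUnit_neg, inv_pow, map_inv, map_inv] at this
    have h4 := blockGroup_le_iff.1 (le_refl (blockGroup (blockGroup (⊥ : Subgroup (borel K (k + 1)))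
      (rootBlock q) (rootList (k + 1))) (torusBlock (2 * N)) L))
    refine mem_normalizer_blockGroup (fun x hx => ⟨h4.1 (h3 a x hx), h4.1 ?_⟩) fun j hj b => ?_
    · have := h3 (-a) x hx
      rwa [h2, inv_inv] at this
    · have h5 : torusBlock N i a * torusBlock (2 * N) j b = torusBlock (2 * N) j b * torusBlock N i
          a := by
        rw [torusBlock, torusBlock, ← map_mul, ← map_mul, mul_comm]
      rw [h5, mul_inv_cancel_right, mul_assoc, ← h5, inv_mul_cancel_left]
      exact ⟨h4.2 j hj b, h4.2 j hj b⟩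

lemma coords_torus {N q : ℕ} (hN : N ≠ 0) (r : borel K (k + 1)) {i : Fin k} {L : List (Fin k)}
    (h : i :: L <:+ List.finRange k) :
    Coords (blockGroup (blockGroup (⊥ : Subgroup (borel K (k + 1))) (rootBlock q)
        (rootList (k + 1)))
      (torusBlock N) L) (torusBlock N i) (torusXi r i) (Matrix.diagonal fun _ => (N : ℝ)) := by
  have hnd : i ∉ L := by
    obtain ⟨L', hL⟩ := h
    have := List.nodup_finRange k
    rw [← hL] at this
    exact (List.nodup_cons.1 this.of_append_right).1
  refine ⟨?_, fun a s => ?_, ?_⟩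
  · suffices blockGroup (blockGroup (⊥ : Subgroup (borel K (k + 1))) (rootBlock q)
        (rootList (k + 1)))
      (torusBlock N) L ≤ fixer (torusXi r i) from this
    refine blockGroup_le_iff.2 ⟨blockGroup_le_iff.2 ⟨bot_le, fun x hx a s => ?_⟩, fun j hj a s =>
        ?_⟩
    · rw [torusXi, torusCoord, torusCoord, smul_eq_mul]
      have := mem_rootList.1 hx
      simp only [rootBlock, toMat_mul_rootElt_mul_of this _ r s
        (show x.1 < i.castSucc ∨ i.castSucc < x.2 by omega)]
    · rw [torusXi, torusCoord, torusCoord, smul_eq_mul]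
      have hij : i ≠ j := fun h => hnd (h ▸ hj)
      simp only [torusBlock, toMat_mul_diagElt_mul, cochar_ne hij, Units.val_one, one_mul]
  · have e : ∀ w : InfinitePlace K, Real.log (w (toMat (r * (torusBlock N i a * s)) i.castSucc
        i.castSucc))
        = Real.log (w ((fundUnit (N • a) : 𝓞 K) : K)) +
          Real.log (w (toMat (r * s) i.castSucc i.castSucc)) := by
      intro w
      rw [torusBlock, toMat_mul_diagElt_mul, cochar_self, map_mul, Real.log_mul, fundUnit_nsmul]
      · rfl
      · simp
      · simpa using toMat_diag_ne_zero (r * s) i.castSucc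
    funext j
    have e1 := torusBasis_repr_fundUnit (K := K) (N • a) j
    rw [torusXi, Pi.add_apply, torusCoord, torusCoord, smul_eq_mul]
    simp only [e]
    rw [show (fun w : InfinitePlace K => Real.log (w ((fundUnit (N • a) : 𝓞 K) : K)) +
          Real.log (w (toMat (r * s) i.castSucc i.castSucc))) =
          (fun w : InfinitePlace K => Real.log (w ((fundUnit (N • a) : 𝓞 K) : K))) +
          fun w : InfinitePlace K => Real.log (w (toMat (r * s) i.castSucc i.castSucc)) from rfl,
      map_add, map_add, Finsupp.add_apply, e1, Matrix.mulVec_diagonal, add_comm]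
    simp
  · simp [hN]

lemma sg_det_rootMat {q : ℕ} (hq : q ≠ 0) (r : borel K (k + 1)) (p : Fin (k + 1) × Fin (k + 1)) :
    sg (rootMat q r p).det =
      sg (Algebra.norm ℚ (toMat r p.1 p.1) : ℚ) * sg (Algebra.norm ℚ (toMat r p.2 p.2) : ℚ) := by
  have h1 : Algebra.norm ℚ (q : K) = (q : ℚ) ^ Module.finrank ℚ K := by
    rw [← Algebra.norm_algebraMap]; simp
  have h2 : Algebra.norm ℚ (toMat r p.2 p.2) ≠ 0 := by
    simpa [Algebra.norm_eq_zero_iff] using toMat_diag_ne_zero r p.2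
  have h3 : 0 < (q : ℝ) ^ Module.finrank ℚ K := by positivity
  have h4 : (0 : ℝ) < ((Algebra.norm ℚ (toMat r p.2 p.2) : ℚ) : ℝ)⁻¹ *
      ((Algebra.norm ℚ (toMat r p.2 p.2) : ℚ) : ℝ)⁻¹ :=
    mul_self_pos.2 (inv_ne_zero (by exact_mod_cast h2))
  have h6 : Algebra.norm ℚ (toMat r p.1 p.1 / toMat r p.2 p.2) =
      Algebra.norm ℚ (toMat r p.1 p.1) / Algebra.norm ℚ (toMat r p.2 p.2) := by
    rw [eq_div_iff h2, ← map_mul, div_mul_cancel₀ _ (toMat_diag_ne_zero r p.2)]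
  rw [det_rootMat, map_mul, h6, h1, ← sg_mul]
  push_cast
  have h5 : (Algebra.norm ℚ (toMat r p.2 p.2) : ℝ) ≠ 0 := by exact_mod_cast h2
  rw [show (q : ℝ) ^ Module.finrank ℚ K * ((Algebra.norm ℚ (toMat r p.1 p.1) : ℚ) /
      (Algebra.norm ℚ (toMat r p.2 p.2) : ℚ)) = ((q : ℝ) ^ Module.finrank ℚ K *
      (((Algebra.norm ℚ (toMat r p.2 p.2) : ℚ) : ℝ)⁻¹ * ((Algebra.norm ℚ (toMat r p.2 p.2) : ℚ) :
          ℝ)⁻¹)) *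
      (((Algebra.norm ℚ (toMat r p.1 p.1) : ℚ) : ℝ) * ((Algebra.norm ℚ (toMat r p.2 p.2) : ℚ) : ℝ))
          by
    field_simp, sg_mul, sg_pos (mul_pos h3 h4), one_mul]

lemma prod_pairs {n : ℕ} (f : Fin n → ℤ) :
    ((rootList n).map fun p => f p.1 * f p.2).prod = (∏ i, f i) ^ (n - 1) := by
  rw [prod_rootList]
  simp only [Finset.prod_mul_distrib, Finset.prod_const, Fin.card_Iio]
  rw [Finset.prod_comm' (s' := fun i => Finset.Ioi i) (t' := Finset.univ) (by simp)]
  simp only [Finset.prod_const, Fin.card_Ioi]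
  rw [← Finset.prod_mul_distrib, ← Finset.prod_pow]
  refine Finset.prod_congr rfl fun i _ => ?_
  rw [← pow_add]
  congr 1
  omega

theorem exists_local_chain (hk : 1 ≤ k) {Γ : Subgroup (borel K (k + 1))}
    (hdet : ∀ r ∈ Γ, (toMat r).det = 1) {q N : ℕ} (hq : q ≠ 0) (hN : N ≠ 0)
    (h₁ : ∀ p a, rootBlock (2 * q) p a ∈ Γ) (h₂ : ∀ i a, torusBlock (2 * N) i a ∈ Γ) :
    ∃ z : List (borel K (k + 1)) →₀ ℚ,
      (∀ α : List (borel K (k + 1)) → ℚ, Inv Γ α → Finsupp.linearCombination ℚ (cobd α) z = 0) ∧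
      ((∀ l ∈ z.support, (Function.support fun x : Γ =>
          triClass (Subtype.val : borel K (k + 1) → _) (l.map (x.1 • ·))).Finite) →
        Finsupp.linearCombination ℚ (fun l => ((∑ᶠ x : Γ,
          triClass (Subtype.val : borel K (k + 1) → _) (l.map (x.1 • ·)) : ℤ) : ℚ)) z ≠ 0) := by
  obtain ⟨g₁, hF₁, H₁⟩ := blocks (rootList (k + 1))
    (fun p L h => blockData_root q h) (fun p L h => coords_root (by omega) (1 : borel K (k + 1)) h)
    (fund_bot (1 : borel K (k + 1)))
  obtain ⟨g₂, hF₂, H₂⟩ := blocks (List.finRange k)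
    (fun i L h => blockData_torus N (2 * q)) (fun i L h => coords_torus (by omega) (1 : borel K
        (k + 1)) h) hF₁
  obtain ⟨n, hn⟩ : ∃ n, 1 + Module.finrank ℚ K * (rootList (k + 1)).length +
      Units.rank K * (List.finRange k).length = n + 2 := by
    have h3 : 0 < Module.finrank ℚ K * (rootList (k + 1)).length :=
      Nat.mul_pos Module.finrank_pos (List.length_pos_of_mem
        (mem_rootList.2 (show ((0 : Fin (k + 1)), Fin.last k).1 < _ from Fin.lt_def.2 hk)))
    exact ⟨_, (Nat.sub_add_cancel (by omega)).symm⟩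
  rw [hn] at hF₂ H₂
  refine exists_chain_of_fund (blockGroup_le_iff.2 ⟨blockGroup_le_iff.2 ⟨bot_le, fun p _ a => h₁ p
      a⟩,
    fun i _ a => h₂ i a⟩) hF₂
    (κ := 2 ^ (Units.rank K * k) * 2 ^ (Module.finrank ℚ K * (rootList (k + 1)).length))
        (by positivity) fun r hr => ?_
  obtain ⟨h3, h4⟩ := H₁ (rootXi r) (rootMat (2 * q) r) (fun p L h => coords_root (by omega) r h)
    unitCochain 1 (fun l => Set.toFinite _)
    ⟨0, Coch.zero, Inv.zero, by
      rw [cobd_zero, add_zero, one_smul]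
      funext l
      rw [SN, sumtr, finsum_unique]
      simp [tr, default]⟩
  obtain ⟨h5, h6⟩ := H₂ (torusXi r) _ (fun i L h => coords_torus (by omega) r h) _ _ h3 h4
  have e : tr r (triClass (Subtype.val : borel K (k + 1) → _)) = bigCup (torusXi r) (rootXi r) := by
    rw [← triClass_eq]
    funext l
    rw [tr, triClass, bigCup_comp]; rfl
  rw [e]
  suffices ((List.finRange k).map fun i => (2 : ℤ) ^ Units.rank K *
      sg (Matrix.diagonal fun _ : Fin (Units.rank K) => ((2 * N : ℕ) : ℝ)).det).prod *
      (((rootList (k + 1)).map fun p => (2 : ℤ) ^ Module.finrank ℚ K *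
        sg (rootMat (2 * q) r p).det).prod * 1) =
      2 ^ (Units.rank K * k) * 2 ^ (Module.finrank ℚ K * (rootList (k + 1)).length) from this ▸ h6
  have h7 : ∏ i, sg (Algebra.norm ℚ (toMat r i i) : ℚ) = 1 := by
    rw [← sg_prod, ← Rat.cast_prod, ← map_prod, ← det_toMat, hdet r hr, map_one]
    simp [sg_one]
  simp only [Matrix.det_diagonal, Finset.prod_const]
  have h8 := prod_pairs fun i : Fin (k + 1) => sg (Algebra.norm ℚ (toMat r i i) : ℚ)
  rw [h7, one_pow] at h8
  rw [sg_pos (by positivity)]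
  simp only [sg_det_rootMat (show 2 * q ≠ 0 by omega)]
  rw [List.prod_map_mul, List.prod_map_mul, h8]
  simp [pow_mul]

end RootCoords

section Arithmetic

open NumberField NumberField.InfinitePlace NumberField.Units
open scoped Classical

variable (K : Type) [Field K] [NumberField K] (n : ℕ)

/-- The inclusion of the arithmetic group. -/
noncomputable def slIncl : Matrix.SpecialLinearGroup (Fin n) (𝓞 K) →* GL (Fin n) K :=
  Matrix.SpecialLinearGroup.toGL.comp (Matrix.SpecialLinearGroup.map (algebraMap (𝓞 K) K))

variable {K n}

lemma slIncl_apply (γ : Matrix.SpecialLinearGroup (Fin n) (𝓞 K)) (i j) :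
    (slIncl K n γ).1 i j = (γ.1 i j : K) := rfl

lemma slIncl_injective : Function.Injective (slIncl K n) := fun a b h =>
  Subtype.ext (Matrix.ext fun i j => RingOfIntegers.ext (by
    rw [← slIncl_apply, h, slIncl_apply]))

lemma det_slIncl (γ : Matrix.SpecialLinearGroup (Fin n) (𝓞 K)) : (slIncl K n γ).1.det = 1 :=
  (Matrix.SpecialLinearGroup.map (algebraMap (𝓞 K) K) γ).2

lemma mem_range_slIncl {g : GL (Fin n) K} (h : ∀ i j, IsIntegral ℤ (g.1 i j)) (hd : g.1.det = 1) :
    g ∈ (slIncl K n).range := by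
  let M : Matrix (Fin n) (Fin n) (𝓞 K) := Matrix.of fun i j => ⟨g.1 i j, h i j⟩
  have hM : (algebraMap (𝓞 K) K).mapMatrix M = g.1 := by ext i j; rfl
  refine ⟨⟨M, RingOfIntegers.ext ?_⟩, Units.ext hM⟩
  change algebraMap (𝓞 K) K M.det = algebraMap (𝓞 K) K 1
  rw [RingHom.map_det, hM, hd, map_one]

/-- The upper triangular elements conjugate into the arithmetic group. -/
noncomputable def localGroup (f : GL (Fin n) K) : Subgroup (borel K n) :=
  ((slIncl K n).range.comap (MulAut.conj f).toMonoidHom).comap (borel K n).subtype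

lemma mem_localGroup {f : GL (Fin n) K} {b : borel K n} :
    b ∈ localGroup f ↔ f * b * f⁻¹ ∈ (slIncl K n).range := Iff.rfl

lemma det_conj (f g : GL (Fin n) K) : (f * g * f⁻¹).1.det = g.1.det := by
  have : f.1.det * (f⁻¹).1.det = 1 := by
    rw [← Matrix.det_mul, ← Units.val_mul, mul_inv_cancel, Units.val_one, Matrix.det_one]
  rw [Units.val_mul, Units.val_mul, Matrix.det_mul, Matrix.det_mul]
  linear_combination g.1.det * this

lemma det_of_mem_localGroup {f : GL (Fin n) K} {b : borel K n} (h : b ∈ localGroup f) :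
    (toMat b).det = 1 := by
  obtain ⟨γ, hγ⟩ := mem_localGroup.1 h
  rw [toMat_apply, ← det_conj f, ← hγ, det_slIncl]

lemma mem_localGroup_of {f : GL (Fin n) K} {q : ℕ}
    (hq : ∀ a b c d, IsIntegral ℤ ((q : K) * (f.1 a b * (f⁻¹).1 c d))) {b : borel K n}
    (hd : (toMat b).det = 1)
    (h : ∀ i j, ∃ x : K, IsIntegral ℤ x ∧ toMat b i j = (1 : Matrix (Fin n) (Fin n) K) i j + q * x)
        :
    b ∈ localGroup f := by
  choose x hx hbx using h
  rw [mem_localGroup]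
  refine mem_range_slIncl (fun i j => ?_) (by rw [det_conj]; exact hd)
  have e : b.1.1 = 1 + Matrix.of fun i j => q * x i j := Matrix.ext hbx
  rw [Units.val_mul, Units.val_mul, e, mul_add, add_mul, mul_one, ← Units.val_mul, mul_inv_cancel,
    Units.val_one, Matrix.add_apply]
  refine IsIntegral.add ?_ ?_
  · rw [Matrix.one_apply]; split_ifs
    exacts [isIntegral_one, isIntegral_zero]
  · simp only [Matrix.mul_apply, Finset.sum_mul]
    refine IsIntegral.sum _ fun c _ => IsIntegral.sum _ fun d _ => ?_
    have := (hq i d c j).mul (hx d c)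
    convert this using 1
    simp only [Matrix.of_apply]; ring

lemma exists_denominator (g h : Matrix (Fin n) (Fin n) K) : ∃ q : ℕ, q ≠ 0 ∧
    ∀ a b c d, IsIntegral ℤ ((q : K) * (g a b * h c d)) := by
  obtain ⟨y, hy, hi⟩ := exists_integral_multiples ℤ ℚ (Finset.univ.image
    fun x : (Fin n × Fin n) × (Fin n × Fin n) => g x.1.1 x.1.2 * h x.2.1 x.2.2)
  refine ⟨y.natAbs, by simpa using hy, fun a b c d => ?_⟩
  have h1 := hi _ (Finset.mem_image_of_mem _ (Finset.mem_univ ((a, b), (c, d))))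
  rw [zsmul_eq_mul] at h1
  rcases Int.natAbs_eq y with e | e
  · have e' : (y : K) = (y.natAbs : K) := by rw [← Int.cast_natCast, ← e]
    rw [e'] at h1
    exact h1
  · have e' : (y.natAbs : K) = -(y : K) := by
      rw [← Int.cast_natCast, ← Int.cast_neg, eq_neg_iff_add_eq_zero.2 (by omega : (y.natAbs : ℤ) +
          y = 0)]
    rw [e', neg_mul]
    exact h1.neg

lemma exists_unit_pow_sub_one (q : ℕ) (hq : q ≠ 0) : ∃ N : ℕ, N ≠ 0 ∧
    ∀ u : (𝓞 K)ˣ, ∃ x : 𝓞 K, ((u ^ N : (𝓞 K)ˣ) : 𝓞 K) = 1 + q * x := by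
  have hI : (Ideal.span {(q : 𝓞 K)}) ≠ ⊥ := by simpa using hq
  have : Finite (𝓞 K ⧸ Ideal.span {(q : 𝓞 K)}) := Ideal.finiteQuotientOfFreeOfNeBot _ hI
  refine ⟨Nat.card (𝓞 K ⧸ Ideal.span {(q : 𝓞 K)})ˣ, Nat.card_pos.ne', fun u => ?_⟩
  have h1 : (Units.map (Ideal.Quotient.mk (Ideal.span {(q : 𝓞 K)})).toMonoidHom u) ^
    Nat.card (𝓞 K ⧸ Ideal.span {(q : 𝓞 K)})ˣ = 1 := pow_card_eq_one'
  rw [← map_pow, Units.ext_iff] at h1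
  have h2 : Ideal.Quotient.mk (Ideal.span {(q : 𝓞 K)})
      ((u ^ Nat.card (𝓞 K ⧸ Ideal.span {(q : 𝓞 K)})ˣ : (𝓞 K)ˣ) : 𝓞 K) =
        Ideal.Quotient.mk _ 1 := h1
  obtain ⟨x, hx⟩ := Ideal.mem_span_singleton'.1 (Ideal.Quotient.eq.1 h2)
  exact ⟨x, by linear_combination -hx⟩

theorem exists_chain_localGroup {k : ℕ} (hk : 1 ≤ k) (f : GL (Fin (k + 1)) K) :
    ∃ z : List (borel K (k + 1)) →₀ ℚ,
      (∀ α : List (borel K (k + 1)) → ℚ, Inv (localGroup f) α →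
        Finsupp.linearCombination ℚ (cobd α) z = 0) ∧
      ((∀ l ∈ z.support, (Function.support fun x : localGroup f =>
          triClass (Subtype.val : borel K (k + 1) → _) (l.map (x.1 • ·))).Finite) →
        Finsupp.linearCombination ℚ (fun l => ((∑ᶠ x : localGroup f,
          triClass (Subtype.val : borel K (k + 1) → _) (l.map (x.1 • ·)) : ℤ) : ℚ)) z ≠ 0) := by
  obtain ⟨q, hq, hqf⟩ := exists_denominator f.1 (f⁻¹).1
  obtain ⟨N, hN, hNu⟩ := exists_unit_pow_sub_one (K := K) q hq
  refine exists_local_chain hk (fun r => det_of_mem_localGroup) hq hN (fun p a => ?_) fun i a => ?_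
  · by_cases hp : p.1 < p.2
    · refine mem_localGroup_of hqf ?_ fun i j => ?_
      · rw [det_toMat]
        refine Finset.prod_eq_one fun i _ => ?_
        rw [rootBlock, toMat_rootElt hp, Matrix.add_apply, Matrix.single_apply, if_neg (by omega)]
        simp
      · refine ⟨(Matrix.single p.1 p.2 (2 * lat a) : Matrix _ _ K) i j, ?_, ?_⟩
        · rw [Matrix.single_apply]
          split_ifs
          · rw [two_mul]; exact (isIntegral_lat a).add (isIntegral_lat a)
          · exact isIntegral_zero
        · rw [rootBlock, toMat_rootElt hp, Matrix.add_apply, Matrix.single_apply,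
              Matrix.single_apply]
          split_ifs
          · push_cast; ring
          · simp
    · rw [rootBlock, rootElt, dif_neg hp]; exact one_mem _
  · refine mem_localGroup_of hqf ?_ fun l j => ?_
    · rw [torusBlock, toMat_diagElt, Matrix.det_diagonal, Fin.prod_univ_castSucc,
        Finset.prod_eq_single i (fun j _ hj => by rw [cochar_ne hj]; simp) (by simp), cochar_self]
      simp [cochar, (Fin.castSucc_lt_last i).ne']
    · have key : ∀ u : (𝓞 K)ˣ, ∃ x : K, IsIntegral ℤ x ∧
          ((Units.map (algebraMap (𝓞 K) K).toMonoidHom (u ^ (2 * N)) : Kˣ) : K) = 1 + q * x := by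
        intro u
        obtain ⟨x, hx⟩ := hNu (u ^ 2)
        refine ⟨x, RingOfIntegers.isIntegral_coe _, ?_⟩
        rw [pow_mul]
        have := congrArg (algebraMap (𝓞 K) K) hx
        simpa using this
      by_cases hlj : l = j
      · subst hlj
        rw [torusBlock, toMat_diagElt, Matrix.diagonal_apply_eq, Matrix.one_apply_eq]
        simp only [cochar, MonoidHom.coe_mk, OneHom.coe_mk]
        split_ifs
        · exact key _
        · rw [← map_inv, ← inv_pow]; exact key _
        · exact ⟨0, isIntegral_zero, by simp⟩
      · refine ⟨0, isIntegral_zero, ?_⟩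
        rw [torusBlock, toMat_diagElt, Matrix.diagonal_apply_ne _ hlj, Matrix.one_apply_ne hlj]
        simp

end Arithmetic

section Lattice

open scoped nonZeroDivisors
open FractionalIdeal

variable {R K : Type} [CommRing R] [IsDedekindDomain R] [Field K] [Algebra R K] [IsFractionRing R K]

lemma class_eq_of_smul {A B : (FractionalIdeal R⁰ K)ˣ} {x : K} (hx : x ≠ 0)
    (h : (B : FractionalIdeal R⁰ K) = spanSingleton R⁰ x * A) :
    ClassGroup.mk K B = ClassGroup.mk K A := by
  have : B = toPrincipalIdeal R K (Units.mk0 x hx) * A := Units.ext (by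
    rw [h, Units.val_mul, coe_toPrincipalIdeal, Units.val_mk0])
  rw [this, map_mul, ClassGroup.mk_eq_one_iff.2, one_mul]
  rw [coe_toPrincipalIdeal, coe_spanSingleton]
  exact ⟨⟨_, rfl⟩⟩

lemma exists_class (c : ClassGroup R) : ∃ I : Ideal R, ∃ A : (FractionalIdeal R⁰ K)ˣ,
    (A : FractionalIdeal R⁰ K) = I ∧ I ≠ 0 ∧ ClassGroup.mk K A = c := by
  obtain ⟨I, rfl⟩ := ClassGroup.mk0_surjective c
  exact ⟨I, FractionalIdeal.mk0 K I, rfl, nonZeroDivisors.ne_zero I.2, ClassGroup.mk_mk0 K I⟩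

/-- A fractional ideal contained in another one, up to a principal ideal and a coprime part. -/
lemma exists_sup_span_fractional (A : (FractionalIdeal R⁰ K)ˣ) {I : Ideal R} (hI : I ≠ 0) :
    ∃ y : K, (A : FractionalIdeal R⁰ K) * I + spanSingleton R⁰ y = A := by
  obtain ⟨d, J, hd, hJ⟩ := exists_eq_spanSingleton_mul (A : FractionalIdeal R⁰ K)
  have hJ0 : J ≠ 0 := by
    rintro rfl
    exact A.ne_zero (by rw [hJ]; simp)
  obtain ⟨a, ha⟩ := IsDedekindDomain.exists_sup_span_eq (I := J * I) (J := J) Ideal.mul_le_left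
    (mul_ne_zero hJ0 hI)
  refine ⟨(algebraMap R K d)⁻¹ * algebraMap R K a, ?_⟩
  have := congrArg (fun J : Ideal R => (J : FractionalIdeal R⁰ K)) ha
  simp only [coeIdeal_sup, coeIdeal_mul, coeIdeal_span_singleton] at this
  rw [hJ, ← spanSingleton_mul_spanSingleton, mul_assoc, ← mul_add, this]

lemma mem_iff_mul_le (A C : (FractionalIdeal R⁰ K)ˣ) (x : K) :
    x ∈ (A : FractionalIdeal R⁰ K) ↔
      spanSingleton R⁰ x * C ≤ ((A * C : (FractionalIdeal R⁰ K)ˣ) : FractionalIdeal R⁰ K) := by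
  rw [← spanSingleton_le_iff_mem, Units.val_mul]
  refine ⟨fun h => mul_le_mul_left h _, fun h => ?_⟩
  have := mul_le_mul_left h ((C⁻¹ : (FractionalIdeal R⁰ K)ˣ) : FractionalIdeal R⁰ K)
  simpa only [mul_assoc, Units.mul_inv, mul_one] using this

lemma exists_inter_class (A B : (FractionalIdeal R⁰ K)ˣ) (c : ClassGroup R) :
    ∃ (φ : K) (E : (FractionalIdeal R⁰ K)ˣ), ClassGroup.mk K E = c ∧
      ∀ x, x ∈ (E : FractionalIdeal R⁰ K) ↔
        x ∈ (A : FractionalIdeal R⁰ K) ∧ φ * x ∈ (B : FractionalIdeal R⁰ K) := by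
  obtain ⟨I, E, hE, hI, hc⟩ := exists_class (K := K) (c * (ClassGroup.mk K A)⁻¹)
  obtain ⟨y, hy⟩ := exists_sup_span_fractional ((A * E)⁻¹ * B) hI
  refine ⟨y, A * E, by rw [map_mul, hc, mul_comm, inv_mul_cancel_right], fun x => ?_⟩
  rw [mem_iff_mul_le (A * E) ((A * E)⁻¹ * B), mul_inv_cancel_left, ← hy, mul_add, ← sup_eq_add,
    sup_le_iff, mem_iff_mul_le A (A⁻¹ * B), mul_inv_cancel_left, ← hE,
        spanSingleton_mul_spanSingleton,
    spanSingleton_le_iff_mem, mul_comm x y]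
  have : (((A * E)⁻¹ * B : (FractionalIdeal R⁰ K)ˣ) : FractionalIdeal R⁰ K) * E =
    ((A⁻¹ * B : (FractionalIdeal R⁰ K)ˣ) : FractionalIdeal R⁰ K) := by
    rw [← Units.val_mul]; congr 1
    rw [mul_inv]
    rw [mul_assoc, mul_assoc, mul_comm B, inv_mul_cancel_left]
  rw [this]

/-- Steinitz' isomorphism. -/
lemma exists_steinitz (A B : (FractionalIdeal R⁰ K)ˣ) : ∃ D : (FractionalIdeal R⁰ K)ˣ,
    ClassGroup.mk K D = ClassGroup.mk K A * ClassGroup.mk K B ∧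
    Nonempty ((((A : FractionalIdeal R⁰ K) : Submodule R K) × ((B : FractionalIdeal R⁰ K) :
        Submodule R K))
      ≃ₗ[R] R × ((D : FractionalIdeal R⁰ K) : Submodule R K)) := by
  obtain ⟨d, J, hd, hJ⟩ := exists_eq_spanSingleton_mul (B : FractionalIdeal R⁰ K)
  have hJ0 : J ≠ 0 := by
    rintro rfl
    exact B.ne_zero (by rw [hJ]; simp)
  have hd' : algebraMap R K d ≠ 0 := by simpa using hd
  set δ := algebraMap R K d
  obtain ⟨y, hy⟩ := exists_sup_span_fractional A⁻¹ hJ0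
  let J' : (FractionalIdeal R⁰ K)ˣ := toPrincipalIdeal R K (Units.mk0 δ hd') * B
  have hJ' : (J' : FractionalIdeal R⁰ K) = J := by
    rw [Units.val_mul, coe_toPrincipalIdeal, Units.val_mk0, hJ, ← mul_assoc,
      spanSingleton_mul_spanSingleton, mul_inv_cancel₀ hd', spanSingleton_one, one_mul]
  have h1 : (J : FractionalIdeal R⁰ K) + spanSingleton R⁰ y * A = 1 := by
    have := congrArg (fun C => C * (A : FractionalIdeal R⁰ K)) hy
    simp only [add_mul, Units.inv_mul] at this
    rw [← this, mul_right_comm, Units.inv_mul, one_mul]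
  have hone : (1 : K) ∈ ((1 : FractionalIdeal R⁰ K) : Submodule R K) := one_mem_one _
  rw [← h1, coe_add] at hone
  obtain ⟨b, hb, c, hc, hbc⟩ := Submodule.mem_sup.1 hone
  obtain ⟨a, ha, rfl⟩ := mem_singleton_mul.1 hc
  have hya : ∀ x ∈ (A : FractionalIdeal R⁰ K), y * x ∈ (1 : FractionalIdeal R⁰ K) := fun x hx => by
    rw [← h1]
    exact Submodule.mem_sup_right (mul_mem_mul (mem_spanSingleton_self _ _) hx)
  have hmulA : ∀ (C : FractionalIdeal R⁰ K) (x z : K), x ∈ (1 : FractionalIdeal R⁰ K) → z ∈ C →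
      x * z ∈ C := fun C x z hx hz => by
    have := mul_mem_mul hx hz
    rwa [one_mul] at this
  have hJ1 : (J : FractionalIdeal R⁰ K) ≤ 1 := coeIdeal_le_one
  have hB : ∀ z, z ∈ (B : FractionalIdeal R⁰ K) ↔ δ * z ∈ (J : FractionalIdeal R⁰ K) := fun z => by
    rw [hJ, mem_singleton_mul]
    constructor
    · rintro ⟨x, hx, rfl⟩
      rwa [mul_inv_cancel_left₀ hd']
    · intro h
      exact ⟨_, h, by rw [inv_mul_cancel_left₀ hd']⟩
  have hs : ∀ s : R, algebraMap R K s ∈ (1 : FractionalIdeal R⁰ K) := fun s => by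
    rw [mem_one_iff]; exact ⟨s, rfl⟩
  have hDA : (A : FractionalIdeal R⁰ K) * J ≤ A := by
    calc _ ≤ (A : FractionalIdeal R⁰ K) * 1 := mul_le_mul_right hJ1 _
      _ = A := mul_one _
  have hDJ : ∀ t ∈ (A : FractionalIdeal R⁰ K) * J, y * t ∈ (J : FractionalIdeal R⁰ K) := by
    intro t ht
    have : spanSingleton R⁰ y * ((A : FractionalIdeal R⁰ K) * J) ≤ J := by
      rw [← mul_assoc]
      calc _ ≤ (1 : FractionalIdeal R⁰ K) * J :=
            mul_le_mul_left (by rw [← h1]; exact le_sup_right) _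
        _ = J := one_mul _
    exact this (mul_mem_mul (mem_spanSingleton_self _ _) ht)
  refine ⟨A * J', by
    rw [map_mul, class_eq_of_smul (A := B) (B := J') hd' (by
      rw [Units.val_mul, coe_toPrincipalIdeal, Units.val_mk0])], ?_⟩
  have hD : ∀ t : (((A * J' : (FractionalIdeal R⁰ K)ˣ) : FractionalIdeal R⁰ K) : Submodule R K),
      (t : K) ∈ (A : FractionalIdeal R⁰ K) * J := fun t => by
    obtain ⟨t, ht⟩ := t
    rwa [Units.val_mul, hJ'] at ht
  let F : (R × (((A * J' : (FractionalIdeal R⁰ K)ˣ) : FractionalIdeal R⁰ K) : Submodule R K)) →ₗ[R]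
      (((A : FractionalIdeal R⁰ K) : Submodule R K) × ((B : FractionalIdeal R⁰ K) : Submodule R K))
          :=
    { toFun := fun p => (⟨algebraMap R K p.1 * a + p.2,
          Submodule.add_mem _ (hmulA _ _ _ (hs _) ha) (hDA (hD p.2))⟩,
        ⟨δ⁻¹ * (algebraMap R K p.1 * b - y * p.2), (hB _).2 (by
          rw [mul_inv_cancel_left₀ hd']
          exact Submodule.sub_mem _ (hmulA _ _ _ (hs _) hb) (hDJ _ (hD p.2)))⟩)
      map_add' := fun p q => by
        ext
        · simp; ring
        · simp; ring
      map_smul' := fun r p => by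
        ext
        · simp [Algebra.smul_def]; ring
        · simp [Algebra.smul_def]; ring }
  refine ⟨(LinearEquiv.ofBijective F ⟨?_, ?_⟩).symm⟩
  · rintro ⟨s, t⟩ ⟨s', t'⟩ h
    have e1 : algebraMap R K s * a + t = algebraMap R K s' * a + t' :=
      congrArg Subtype.val (congrArg Prod.fst h)
    have e2 : δ⁻¹ * (algebraMap R K s * b - y * t) = δ⁻¹ * (algebraMap R K s' * b - y * t') :=
      congrArg Subtype.val (congrArg Prod.snd h)
    have e3 := mul_left_cancel₀ (inv_ne_zero hd') e2
    have e4 : algebraMap R K s = algebraMap R K s' := by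
      linear_combination e3 + y * e1 - (algebraMap R K s - algebraMap R K s') * hbc
    have e5 : (t : K) = t' := by linear_combination e1 - a * e4
    exact Prod.ext (IsFractionRing.injective R K e4) (Subtype.ext e5)
  · rintro ⟨⟨x, hx⟩, ⟨z, hz⟩⟩
    have h2 : y * x + δ * z ∈ (1 : FractionalIdeal R⁰ K) :=
      Submodule.add_mem _ (hya _ hx) (hJ1 ((hB z).1 hz))
    obtain ⟨s, hs'⟩ := (mem_one_iff _).1 h2
    have h3 : x * b - a * (δ * z) ∈ (((A * J' : (FractionalIdeal R⁰ K)ˣ) : FractionalIdeal R⁰ K) :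
        Submodule R K) := by
      rw [Units.val_mul, hJ']
      exact Submodule.sub_mem _ (mul_mem_mul hx hb) (mul_mem_mul ha ((hB z).1 hz))
    refine ⟨(s, ⟨_, h3⟩), Prod.ext (Subtype.ext ?_) (Subtype.ext ?_)⟩
    · change algebraMap R K s * a + (x * b - a * (δ * z)) = x
      rw [hs']; linear_combination x * hbc
    · change δ⁻¹ * (algebraMap R K s * b - y * (x * b - a * (δ * z))) = z
      rw [hs', show (y * x + δ * z) * b - y * (x * b - a * (δ * z)) = δ * z by
        linear_combination δ * z * hbc, inv_mul_cancel_left₀ hd']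

/-- The membership of `x` in the graded piece of the lattice `L` with indices `j` and `m`. -/
def Graded {n : ℕ} (L : Submodule R (Fin n → K)) (j m : Fin n) (x : K) : Prop :=
  ∃ y ∈ L, y m = x ∧ ∀ r, j ≤ r → r ≠ m → y r = 0

/-- The extension of a lattice by a fractional ideal. -/
def extLattice {n : ℕ} (L : Submodule R (Fin n → K)) (I : Submodule R K) (φ : Fin n → K) :
    Submodule R (Fin (n + 1) → K) where
  carrier := {y | Fin.tail y ∈ L ∧ y 0 - ∑ m, φ m * y m.succ ∈ I}
  add_mem' := fun {y z} hy hz => ⟨L.add_mem hy.1 hz.1, by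
    have := I.add_mem hy.2 hz.2
    convert this using 1
    simp only [Pi.add_apply, mul_add, Finset.sum_add_distrib]; ring⟩
  zero_mem' := ⟨L.zero_mem, by simp⟩
  smul_mem' := fun r y hy => ⟨L.smul_mem r hy.1, by
    have := I.smul_mem r hy.2
    convert this using 1
    simp only [Pi.smul_apply, mul_smul_comm, smul_sub, Finset.smul_sum]⟩

/-- An extension of a lattice splits. -/
def extEquiv {n : ℕ} (L : Submodule R (Fin n → K)) (I : Submodule R K) (φ : Fin n → K) :
    extLattice L I φ ≃ₗ[R] I × L where
  toFun y := (⟨_, y.2.2⟩, ⟨_, y.2.1⟩)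
  invFun p := ⟨Fin.cons (p.1.1 + ∑ m, φ m * p.2.1 m) p.2.1, by
    refine ⟨by rw [Fin.tail_cons]; exact p.2.2, ?_⟩
    simp only [Fin.cons_zero, Fin.cons_succ, add_sub_cancel_right]
    exact p.1.2⟩
  left_inv y := by
    refine Subtype.ext (funext fun i => ?_)
    refine Fin.cases ?_ (fun i => ?_) i
    · simp [Fin.tail]
    · simp [Fin.tail]
  right_inv p := by
    refine Prod.ext (Subtype.ext ?_) (Subtype.ext ?_)
    · simp
    · simp
  map_add' y z := by
    refine Prod.ext (Subtype.ext ?_) (Subtype.ext rfl)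
    simp only [Submodule.coe_add, Pi.add_apply, mul_add, Finset.sum_add_distrib, Prod.fst_add]; ring
  map_smul' r y := by
    refine Prod.ext (Subtype.ext ?_) (Subtype.ext rfl)
    simp [smul_sub, Finset.smul_sum]

lemma graded_ext_zero {n : ℕ} {L : Submodule R (Fin n → K)} {I : Submodule R K} {φ : Fin n → K}
    {x : K} : Graded (extLattice L I φ) 0 0 x ↔ x ∈ I := by
  constructor
  · rintro ⟨y, hy, rfl, h⟩
    have := hy.2
    rwa [Finset.sum_eq_zero fun m _ => by rw [h _ (Fin.zero_le _) (Fin.succ_ne_zero m), mul_zero],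
      sub_zero] at this
  · intro hx
    refine ⟨Fin.cons x 0, ⟨?_, ?_⟩, rfl, fun r _ hr => ?_⟩
    · rw [Fin.tail_cons]; exact L.zero_mem
    · simpa using hx
    · obtain ⟨r, rfl⟩ := Fin.exists_succ_eq.2 hr
      rfl

lemma graded_ext_zero_succ {n : ℕ} {L : Submodule R (Fin (n + 1) → K)} {I : Submodule R K}
    {φ : Fin (n + 1) → K} {m : Fin (n + 1)} {x : K} :
    Graded (extLattice L I φ) 0 m.succ x ↔ Graded L 0 m x ∧ φ m * x ∈ I := by
  constructor
  · rintro ⟨y, hy, rfl, h⟩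
    refine ⟨⟨_, hy.1, rfl, fun r _ hr => h r.succ (Fin.zero_le _) fun e => hr (Fin.succ_injective _
        e)⟩,
      ?_⟩
    have := hy.2
    rw [Finset.sum_eq_single m (fun r _ hr => by
      rw [h r.succ (Fin.zero_le _) fun e => hr (Fin.succ_injective _ e), mul_zero]) (by simp),
      h 0 (Fin.zero_le _) (Fin.succ_ne_zero m).symm, zero_sub] at this
    exact neg_mem_iff.1 this
  · rintro ⟨⟨y, hy, rfl, h⟩, hI⟩
    refine ⟨Fin.cons 0 y, ⟨hy, ?_⟩, rfl, fun r _ hr => ?_⟩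
    · simp only [Fin.cons_zero, Fin.cons_succ]
      rw [Finset.sum_eq_single m (fun r _ hr => by rw [h r (Fin.zero_le _) hr, mul_zero]) (by simp),
        zero_sub]
      exact neg_mem hI
    · revert hr
      refine Fin.cases (fun _ => rfl) (fun r hr => ?_) r
      exact h r (Fin.zero_le _) fun e => hr (congrArg _ e)

lemma graded_ext_succ_succ {n : ℕ} {L : Submodule R (Fin n → K)} {I : Submodule R K}
    {φ : Fin n → K} {j m : Fin n} {x : K} :
    Graded (extLattice L I φ) j.succ m.succ x ↔ Graded L j m x := by
  constructor
  · rintro ⟨y, hy, rfl, h⟩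
    exact ⟨_, hy.1, rfl, fun r hr hm => h r.succ (Fin.succ_le_succ_iff.2 hr)
      fun e => hm (Fin.succ_injective _ e)⟩
  · rintro ⟨y, hy, rfl, h⟩
    refine ⟨Fin.cons (∑ m, φ m * y m) y, ⟨hy, ?_⟩, rfl, fun r hj hr => ?_⟩
    · simp
    · revert hr hj
      refine Fin.cases (fun h => absurd h (by simp)) (fun r hj hr => ?_) r
      exact h r (Fin.succ_le_succ_iff.1 hj) fun e => hr (congrArg _ e)

/-- There are lattices whose graded pieces have prescribed ideal classes. -/
theorem exists_lattice : ∀ (k : ℕ) (e : Fin (k + 1) → Fin (k + 1) → ClassGroup R),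
    ∃ L : Submodule R (Fin (k + 1) → K),
      (∀ j m, j ≤ m → ∃ E : (FractionalIdeal R⁰ K)ˣ, ClassGroup.mk K E = e j m ∧
        ∀ x, x ∈ (E : FractionalIdeal R⁰ K) ↔ Graded L j m x) ∧
      ∃ D : (FractionalIdeal R⁰ K)ˣ, ClassGroup.mk K D = ∏ j, e j j ∧
        Nonempty (L ≃ₗ[R] (Fin k → R) × ((D : FractionalIdeal R⁰ K) : Submodule R K)) := by
  intro k
  induction k with
  | zero =>
    intro e
    have hsub : Subsingleton (Fin (0 + 1)) := inferInstanceAs (Subsingleton (Fin 1))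
    obtain ⟨-, D, -, -, hD⟩ := exists_class (K := K) (e 0 0)
    have eq : extLattice (⊥ : Submodule R (Fin 0 → K)) (D : FractionalIdeal R⁰ K) 0 ≃ₗ[R]
      (Fin 0 → R) × ((D : FractionalIdeal R⁰ K) : Submodule R K) :=
      (extEquiv _ _ _).trans ((LinearEquiv.prodComm R _ _).trans
        (LinearEquiv.prodCongr (LinearEquiv.ofSubsingleton _ _) (LinearEquiv.refl R _)))
    refine ⟨extLattice ⊥ (D : FractionalIdeal R⁰ K) 0, fun j m _ => ⟨D, ?_, fun x => ?_⟩, D, ?_,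
        ⟨eq⟩⟩
    · rw [hD, Subsingleton.elim j 0, Subsingleton.elim m 0]
    · rw [Subsingleton.elim j 0, Subsingleton.elim m 0, graded_ext_zero]; rfl
    · simp [hD]
  | succ k ih =>
    intro e
    obtain ⟨L, hL, D, hD, ⟨eq⟩⟩ := ih fun j m => e j.succ m.succ
    obtain ⟨-, I, -, -, hI⟩ := exists_class (K := K) (e 0 0)
    choose E hE hE' using fun m => hL 0 m (Fin.zero_le m)
    choose φ F hF hF' using fun m => exists_inter_class (E m) I (e 0 m.succ)
    obtain ⟨D', hD', ⟨eq'⟩⟩ := exists_steinitz I D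
    refine ⟨extLattice L (I : FractionalIdeal R⁰ K) φ, fun j m => ?_, D', ?_, ⟨?_⟩⟩
    · refine Fin.cases ?_ (fun m => ?_) m
      · intro h
        rw [Fin.le_zero_iff.1 h]
        exact ⟨I, hI, fun x => by rw [graded_ext_zero]; rfl⟩
      · refine Fin.cases ?_ (fun j => ?_) j
        · intro h
          exact ⟨F m, hF m, fun x => by rw [graded_ext_zero_succ, hF', hE']; rfl⟩
        · intro h
          obtain ⟨E, h1, h2⟩ := hL j m (Fin.succ_le_succ_iff.1 h)
          exact ⟨E, h1, fun x => by rw [graded_ext_succ_succ, h2]⟩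
    · rw [hD', hI, hD]
      exact (Fin.prod_univ_succ fun j => e j j).symm
    · let SI : Submodule R K := (I : FractionalIdeal R⁰ K)
      let SD : Submodule R K := (D : FractionalIdeal R⁰ K)
      let SD' : Submodule R K := (D' : FractionalIdeal R⁰ K)
      have e1 : extLattice L SI φ ≃ₗ[R] SI × L := extEquiv _ _ _
      have e2 : (SI × L) ≃ₗ[R] SI × ((Fin k → R) × SD) := (LinearEquiv.refl R SI).prodCongr eq
      have e3 : (SI × ((Fin k → R) × SD)) ≃ₗ[R] (SI × (Fin k → R)) × SD :=
        (LinearEquiv.prodAssoc R _ _ _).symm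
      have e4 : ((SI × (Fin k → R)) × SD) ≃ₗ[R] ((Fin k → R) × SI) × SD :=
        (LinearEquiv.prodComm R _ _).prodCongr (LinearEquiv.refl R SD)
      have e5 : (((Fin k → R) × SI) × SD) ≃ₗ[R] (Fin k → R) × (SI × SD) :=
        LinearEquiv.prodAssoc R _ _ _
      have e6 : ((Fin k → R) × (SI × SD)) ≃ₗ[R] (Fin k → R) × (R × SD') :=
        (LinearEquiv.refl R (Fin k → R)).prodCongr eq'
      have e7 : ((Fin k → R) × (R × SD')) ≃ₗ[R] ((Fin k → R) × R) × SD' :=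
        (LinearEquiv.prodAssoc R _ _ _).symm
      have e8 : (((Fin k → R) × R) × SD') ≃ₗ[R] (Fin (k + 1) → R) × SD' :=
        ((LinearEquiv.prodComm R _ _).trans
          (Fin.consLinearEquiv R (fun _ : Fin (k + 1) => R))).prodCongr (LinearEquiv.refl R SD')
      exact e1.trans (e2.trans (e3.trans (e4.trans (e5.trans (e6.trans (e7.trans e8))))))

lemma nonempty_equiv_of_class_eq_one {D : (FractionalIdeal R⁰ K)ˣ} (h : ClassGroup.mk K D = 1) :
    Nonempty (((D : FractionalIdeal R⁰ K) : Submodule R K) ≃ₗ[R] R) := by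
  obtain ⟨⟨a, ha⟩⟩ := ClassGroup.mk_eq_one_iff.1 h
  have ha0 : a ≠ 0 := by
    rintro rfl
    refine D.ne_zero (coeToSubmodule_injective ?_)
    exact ha.trans (by simp)
  exact ⟨(LinearEquiv.ofEq _ _ ha).trans (LinearEquiv.toSpanNonzeroSingleton R K a ha0).symm⟩

/-- A free lattice is the preimage of the standard one under a linear automorphism. -/
lemma exists_gl_of_free {n : ℕ} (L : Submodule R (Fin n → K)) (eq : L ≃ₗ[R] (Fin n → R)) :
    ∃ f : GL (Fin n) K, ∀ y, y ∈ L ↔ ∃ z : Fin n → R, f.1.mulVec y = fun i => algebraMap R K (z i)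
        := by
  let b : Fin n → Fin n → K := fun i => (eq.symm (Pi.single i 1) : L).1
  have hb : LinearIndependent R b := by
    have h1 : LinearIndependent R fun i : Fin n => (Pi.single i 1 : Fin n → R) :=
      Pi.linearIndependent_single_one _ _
    have h2 := h1.map' (L.subtype ∘ₗ eq.symm.toLinearMap) (by
      rw [LinearMap.ker_eq_bot]
      exact Subtype.val_injective.comp eq.symm.injective)
    exact h2
  have hbK : LinearIndependent K b := (LinearIndependent.iff_fractionRing R K).1 hb
  let g : Matrix (Fin n) (Fin n) K := (Matrix.of b).transpose
  have hg : IsUnit g := by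
    rw [← Matrix.linearIndependent_cols_iff_isUnit]
    exact hbK
  have hgz : ∀ z : Fin n → R, g.mulVec (fun i => algebraMap R K (z i)) = (eq.symm z).1 := fun z =>
      by
    have hz : z = ∑ i, z i • (Pi.single i 1 : Fin n → R) := by
      funext j
      simp [Finset.sum_apply, Pi.single_apply]
    conv_rhs => rw [hz, map_sum]
    rw [AddSubmonoidClass.coe_finsetSum]
    funext j
    simp only [Matrix.mulVec, dotProduct, Finset.sum_apply]
    refine Finset.sum_congr rfl fun i _ => ?_
    rw [map_smul, Submodule.coe_smul, Pi.smul_apply, Algebra.smul_def, mul_comm]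
    rfl
  refine ⟨hg.unit⁻¹, fun y => ?_⟩
  have h1 : (hg.unit⁻¹ : GL (Fin n) K).1 * g = 1 :=
    hg.unit.inv_mul
  have h2 : g * (hg.unit⁻¹ : GL (Fin n) K).1 = 1 :=
    hg.unit.mul_inv
  constructor
  · intro hy
    refine ⟨eq ⟨y, hy⟩, ?_⟩
    have := hgz (eq ⟨y, hy⟩)
    rw [LinearEquiv.symm_apply_apply] at this
    change g.mulVec _ = y at this
    refine (congrArg _ this.symm).trans ?_
    rw [Matrix.mulVec_mulVec, h1, Matrix.one_mulVec]
  · rintro ⟨z, hz⟩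
    have : y = (eq.symm z).1 := by
      rw [← hgz, ← hz, Matrix.mulVec_mulVec, h2, Matrix.one_mulVec]
    rw [this]
    exact (eq.symm z).2

/-- The classes `1, c 0, c 1, …, 1`. -/
def padClass {G : Type} [CommGroup G] {k : ℕ} (c : Fin k → G) : ℕ → G
  | 0 => 1
  | j + 1 => if h : j < k then c ⟨j, h⟩ else 1

lemma exists_lattice_of_classes {k : ℕ} (c : Fin k → ClassGroup R) :
    ∃ f : GL (Fin (k + 1)) K, ∃ L : Submodule R (Fin (k + 1) → K),
      (∀ y, y ∈ L ↔ ∃ z : Fin (k + 1) → R, f.1.mulVec y = fun i => algebraMap R K (z i)) ∧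
      ∀ j m : Fin (k + 1), j ≤ m → ∃ E : (FractionalIdeal R⁰ K)ˣ,
        ClassGroup.mk K E = (if j = m then padClass c ((j : ℕ) + 1) else 1) * (padClass c j)⁻¹ ∧
        ∀ x, x ∈ (E : FractionalIdeal R⁰ K) ↔ Graded L j m x := by
  classical
  obtain ⟨L, hL, D, hD, ⟨eq⟩⟩ := exists_lattice (R := R) (K := K) k fun j m =>
    (if j = m then padClass c ((j : ℕ) + 1) else 1) * (padClass c j)⁻¹
  have hD1 : ClassGroup.mk K D = 1 := by
    rw [hD]
    simp only [if_true, ← div_eq_mul_inv]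
    rw [Fin.prod_univ_eq_prod_range (fun j => padClass c (j + 1) / padClass c j) (k + 1),
      Finset.prod_range_div]
    simp [padClass]
  obtain ⟨eD⟩ := nonempty_equiv_of_class_eq_one hD1
  obtain ⟨f, hf⟩ := exists_gl_of_free L (eq.trans (((LinearEquiv.refl R _).prodCongr eD).trans
    ((LinearEquiv.prodComm R _ _).trans (Fin.consLinearEquiv R (fun _ : Fin (k + 1) => R)))))
  exact ⟨f, L, hf, hL⟩

end Lattice

section Rigid

open scoped nonZeroDivisors
open FractionalIdeal

variable {R K : Type} [CommRing R] [IsDedekindDomain R] [Field K] [Algebra R K] [IsFractionRing R K]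

/-- A matrix maps graded pieces to graded pieces if its support is bounded by a permutation. -/
lemma Graded.mulVec {n : ℕ} {L L' : Submodule R (Fin n → K)} {X : Matrix (Fin n) (Fin n) K}
    (hX : ∀ y ∈ L, X.mulVec y ∈ L') {w : Equiv.Perm (Fin n)} {q p : Fin n}
    (hw : ∀ p q, X p q ≠ 0 → w p ≤ q) (hr : ∀ r < q, w r = r) (hp : w p = q) {x : K}
    (h : Graded L q q x) : Graded L' q p (X p q * x) := by
  obtain ⟨y, hy, rfl, hy0⟩ := h
  refine ⟨_, hX y hy, ?_, fun r hqr hrp => ?_⟩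
  · rw [Matrix.mulVec, dotProduct]
    refine Finset.sum_eq_single q (fun r _ hrq => ?_) (by simp)
    rcases lt_or_ge r q with h | h
    · have : X p r = 0 := by
        by_contra h0
        exact absurd (hw _ _ h0) (by rw [hp]; exact not_le.2 h)
      rw [this, zero_mul]
    · rw [hy0 r h hrq, mul_zero]
  · have hwr : q < w r := by
      rcases lt_trichotomy (w r) q with h | h | h
      · have := w.injective (hr _ h)
        rw [this] at h
        exact absurd hqr (not_le.2 h)
      · exact absurd (w.injective (h.trans hp.symm)) hrp
      · exact h
    rw [Matrix.mulVec, dotProduct]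
    refine Finset.sum_eq_zero fun s _ => ?_
    rcases le_or_gt s q with h | h
    · have : X r s = 0 := by
        by_contra h0
        exact absurd (hw _ _ h0) (not_le.2 (lt_of_le_of_lt h hwr))
      rw [this, zero_mul]
    · rw [hy0 s h.le h.ne', mul_zero]

lemma Graded.mulVec_inv {n : ℕ} {L L' : Submodule R (Fin n → K)} {Y : Matrix (Fin n) (Fin n) K}
    (hY : ∀ y ∈ L', Y.mulVec y ∈ L) {w : Equiv.Perm (Fin n)} {q p : Fin n}
    (hw : ∀ p q, Y q p ≠ 0 → q ≤ w p) (hr : ∀ r < q, w r = r) (hp : w p = q) {x : K}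
    (h : Graded L' q p x) : Graded L q q (Y q p * x) := by
  obtain ⟨y, hy, rfl, hy0⟩ := h
  have key : ∀ r s, q ≤ r → s ≠ p ∨ r ≠ q → Y r s * y s = 0 := by
    intro r s hqr hs
    by_cases h0 : Y r s = 0
    · rw [h0, zero_mul]
    have h1 := hw _ _ h0
    rcases lt_or_ge s q with h | h
    · rw [hr _ h] at h1
      exact absurd (hqr.trans h1) (not_le.2 h)
    · rcases eq_or_ne s p with rfl | hsp
      · rw [hp] at h1
        exact absurd (le_antisymm h1 hqr) (by tauto)
      · rw [hy0 s h hsp, mul_zero]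
  refine ⟨_, hY y hy, ?_, fun r hqr hrp => ?_⟩
  · rw [Matrix.mulVec, dotProduct]
    exact Finset.sum_eq_single p (fun r _ h => key _ _ le_rfl (Or.inl h)) (by simp)
  · rw [Matrix.mulVec, dotProduct]
    exact Finset.sum_eq_zero fun s _ => key _ _ hqr (Or.inr hrp)

theorem lattice_rigid {k : ℕ} {c c' : Fin k → ClassGroup R} (hc : ∀ i, c i ≠ 1)
    {L L' : Submodule R (Fin (k + 1) → K)}
    (hL : ∀ j m : Fin (k + 1), j ≤ m → ∃ E : (FractionalIdeal R⁰ K)ˣ,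
        ClassGroup.mk K E = (if j = m then padClass c ((j : ℕ) + 1) else 1) * (padClass c j)⁻¹ ∧
        ∀ x, x ∈ (E : FractionalIdeal R⁰ K) ↔ Graded L j m x)
    (hL' : ∀ j m : Fin (k + 1), j ≤ m → ∃ E : (FractionalIdeal R⁰ K)ˣ,
        ClassGroup.mk K E = (if j = m then padClass c' ((j : ℕ) + 1) else 1) * (padClass c' j)⁻¹ ∧
        ∀ x, x ∈ (E : FractionalIdeal R⁰ K) ↔ Graded L' j m x)
    {X Y : Matrix (Fin (k + 1)) (Fin (k + 1)) K} (hYX : Y * X = 1)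
    (hX : ∀ y ∈ L, X.mulVec y ∈ L') (hY : ∀ y ∈ L', Y.mulVec y ∈ L)
    {w : Equiv.Perm (Fin (k + 1))} (hwX : ∀ p q, X p q ≠ 0 → w p ≤ q)
    (hwY : ∀ p q, Y q p ≠ 0 → q ≤ w p) : c = c' ∧ w = 1 := by
  have main : ∀ t : ℕ, t ≤ k → (∀ r : Fin (k + 1), (r : ℕ) < t → w r = r) ∧
      ∀ s ≤ t, padClass c s = padClass c' s := by
    intro t
    induction t with
    | zero =>
      intro _
      refine ⟨fun r hr => absurd hr (by omega), fun s hs => ?_⟩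
      rw [Nat.le_zero.1 hs]; rfl
    | succ t ih =>
      intro ht
      obtain ⟨h1, h2⟩ := ih (by omega)
      let q : Fin (k + 1) := ⟨t, by omega⟩
      obtain ⟨p, hp⟩ := w.surjective q
      have hr : ∀ r < q, w r = r := fun r hr => h1 r hr
      have hqp : q ≤ p := by
        by_contra h
        have h := not_le.1 h
        have := hr p h
        rw [← this, hp] at h
        exact lt_irrefl _ h
      obtain ⟨E, hE, hE'⟩ := hL q q le_rfl
      obtain ⟨F, hF, hF'⟩ := hL' q p hqp
      have h1' : Y q p * X p q = 1 := by
        have := congrFun (congrFun hYX q) q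
        rw [Matrix.mul_apply, Matrix.one_apply_eq, Finset.sum_eq_single p (fun r _ hrp => ?_)
          (by simp)] at this
        · exact this
        · by_contra h0
          exact hrp (w.injective (hp.symm ▸ le_antisymm (hwX _ _ (right_ne_zero_of_mul h0))
            (hwY _ _ (left_ne_zero_of_mul h0))))
      have hX0 : X p q ≠ 0 := right_ne_zero_of_mul (by rw [h1']; exact one_ne_zero)
      have hEF : (F : FractionalIdeal R⁰ K) = spanSingleton R⁰ (X p q) * E := by
        ext x
        rw [mem_singleton_mul]
        constructor
        · intro hx
          refine ⟨Y q p * x, (hE' _).2 (Graded.mulVec_inv hY hwY hr hp ((hF' _).1 hx)), ?_⟩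
          linear_combination -x * h1'
        · rintro ⟨y, hy, rfl⟩
          exact (hF' _).2 (Graded.mulVec hX hwX hr hp ((hE' _).1 hy))
      have hcl := class_eq_of_smul hX0 hEF
      rw [hE, hF, if_pos rfl, h2 t le_rfl] at hcl
      have hcl := (mul_right_cancel hcl).symm
      have hqp' : q = p := by
        by_contra h
        rw [if_neg h] at hcl
        refine hc ⟨t, by omega⟩ ?_
        rw [← hcl]
        simp [padClass, q, show t < k by omega]
      refine ⟨fun r hr' => ?_, fun s hs => ?_⟩
      · rcases Nat.lt_succ_iff_lt_or_eq.1 hr' with h | h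
        · exact h1 r h
        · have : r = q := Fin.ext h
          rw [this]; conv_lhs => rw [hqp']
          exact hp
      · rcases Nat.le_succ_iff.1 hs with h | h
        · exact h2 s h
        · rw [h]
          rw [if_pos hqp'] at hcl
          exact hcl
  obtain ⟨h1, h2⟩ := main k le_rfl
  constructor
  · funext i
    have := h2 (i + 1) (by omega)
    simpa [padClass] using this
  · refine Equiv.ext fun r => ?_
    by_cases h : (r : ℕ) < k
    · exact h1 r h
    · by_contra h'
      have hlt : (w r : ℕ) < k := by
        have h3 : (w r : ℕ) ≠ r := fun e => h' (Fin.ext e)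
        have := r.2; have := (w r).2
        omega
      exact h' (w.injective (h1 _ hlt))

end Rigid

section Frames

open NumberField
open scoped nonZeroDivisors

variable {K : Type} [Field K] [NumberField K]

lemma exists_perm_of_det_ne_zero {n : ℕ} {X : Matrix (Fin n) (Fin n) K} (h : X.det ≠ 0) :
    ∃ σ : Equiv.Perm (Fin n), ∀ i, X (σ i) i ≠ 0 := by
  rw [Matrix.det_apply] at h
  obtain ⟨σ, -, hσ⟩ := Finset.exists_ne_zero_of_sum_ne_zero h
  exact ⟨σ, fun i h0 => hσ (by
    have : ∏ i, X (σ i) i = 0 := Finset.prod_eq_zero (Finset.mem_univ i) h0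
    exact (congrArg _ this).trans (smul_zero _))⟩

/-- A function bounding the supports of a matrix and of its inverse is a permutation. -/
lemma exists_perm_of_supports {n : ℕ} {X Y : Matrix (Fin n) (Fin n) K} (hX : X.det ≠ 0)
    (hY : Y.det ≠ 0) {w : Fin n → Fin n} (hwX : ∀ p q, X p q ≠ 0 → w p ≤ q)
    (hwY : ∀ p q, Y q p ≠ 0 → q ≤ w p) : ∃ σ : Equiv.Perm (Fin n), w = σ := by
  obtain ⟨σ, hσ⟩ := exists_perm_of_det_ne_zero hX
  obtain ⟨τ, hτ⟩ := exists_perm_of_det_ne_zero hY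
  have h1 : ∀ i ∈ Finset.univ, (w (σ i) : ℕ) ≤ i := fun i _ => hwX _ _ (hσ i)
  have h2 : ∑ i, (w (σ i) : ℕ) = ∑ i : Fin n, (i : ℕ) := by
    refine le_antisymm (Finset.sum_le_sum h1) ?_
    rw [Equiv.sum_comp σ fun i => (w i : ℕ), ← Equiv.sum_comp τ]
    exact Finset.sum_le_sum fun i _ => hwY _ _ (hτ i)
  refine ⟨σ.symm, funext fun p => ?_⟩
  have := (Finset.sum_eq_sum_iff_of_le h1).1 h2 (σ.symm p) (Finset.mem_univ _)
  rw [Equiv.apply_symm_apply] at this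
  exact Fin.ext this

/-- Representatives of the boundary components detecting tuples of nontrivial ideal classes. -/
theorem exists_frames (K : Type) [Field K] [NumberField K] (k : ℕ) :
    ∃ f : (Fin k → {c : ClassGroup (𝓞 K) // c ≠ 1}) → GL (Fin (k + 1)) K,
      ∀ (i j) (X : GL (Fin (k + 1)) K) (w : Fin (k + 1) → Fin (k + 1)),
        f i * X * (f j)⁻¹ ∈ (slIncl K (k + 1)).range → (∀ p q, X.1 p q ≠ 0 → w p ≤ q) →
        (∀ p q, (X⁻¹).1 q p ≠ 0 → q ≤ w p) → i = j ∧ w = id := by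
  choose f L hf hL using fun i : Fin k → {c : ClassGroup (𝓞 K) // c ≠ 1} =>
    exists_lattice_of_classes (R := 𝓞 K) (K := K) fun r => (i r).1
  have hmap : ∀ (i j) (X : GL (Fin (k + 1)) K), f i * X * (f j)⁻¹ ∈ (slIncl K (k + 1)).range →
      ∀ y ∈ L j, X.1.mulVec y ∈ L i := by
    rintro i j X ⟨γ, hγ⟩ y hy
    obtain ⟨z, hz⟩ := (hf j y).1 hy
    refine (hf i _).2 ⟨γ.1.mulVec z, ?_⟩
    have h1 : f i * X = slIncl K (k + 1) γ * f j := by rw [hγ]; group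
    rw [Matrix.mulVec_mulVec, ← Units.val_mul, h1, Units.val_mul, ← Matrix.mulVec_mulVec, hz]
    funext r
    simp only [Matrix.mulVec, dotProduct, map_sum, map_mul, slIncl_apply]
  refine ⟨f, fun i j X w h hX hY => ?_⟩
  have h' : f j * X⁻¹ * (f i)⁻¹ ∈ (slIncl K (k + 1)).range := by
    have := inv_mem h
    simpa [mul_assoc] using this
  obtain ⟨σ, rfl⟩ := exists_perm_of_supports (Matrix.GeneralLinearGroup.det_ne_zero X)
    (Matrix.GeneralLinearGroup.det_ne_zero X⁻¹) hX hY
  obtain ⟨h1, h2⟩ := lattice_rigid (fun r => (j r).2) (hL j) (hL i)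
    (X := X.1) (Y := (X⁻¹).1) (by rw [← Units.val_mul, inv_mul_cancel, Units.val_one])
    (hmap i j X h) (hmap j i _ h') hX hY
  exact ⟨funext fun r => Subtype.ext (congrFun h1 r).symm, by rw [h2]; rfl⟩

end Frames

section Analysis

open NumberField NumberField.InfinitePlace
open scoped Classical

variable {K : Type} [Field K] [NumberField K] {n : ℕ}

lemma place_natCast (w : InfinitePlace K) (q : ℕ) : w (q : K) = q := by
  rw [← norm_embedding_eq w, map_natCast, Complex.norm_natCast]

lemma le_of_denominator {x : K} {q : ℕ} (hx : x ≠ 0) (hq : q ≠ 0) (hi : IsIntegral ℤ ((q : K) * x))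
    {s t : ℝ} (hs : 0 ≤ s) (h : ∀ w : InfinitePlace K, w x * s ≤ t) : s ≤ q * t := by
  obtain ⟨w₀⟩ : Nonempty (InfinitePlace K) := inferInstance
  obtain ⟨w, hw⟩ : ∃ w : InfinitePlace K, 1 ≤ w ((q : K) * x) := by
    by_contra! h0
    have h1 : (⟨_, hi⟩ : 𝓞 K) ≠ 0 := fun e => mul_ne_zero (Nat.cast_ne_zero.2 hq) hx
      (congrArg Subtype.val e)
    exact absurd (one_le_of_lt_one (w := w₀) h1 fun z _ => h0 z) (not_le.2 (h0 w₀))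
  rw [map_mul, place_natCast] at hw
  calc s = 1 * s := (one_mul s).symm
    _ ≤ q * w x * s := mul_le_mul_of_nonneg_right hw hs
    _ = q * (w x * s) := by ring
    _ ≤ q * t := mul_le_mul_of_nonneg_left (h w) (Nat.cast_nonneg q)

lemma isIntegral_entry {f f' X : GL (Fin n) K} (h : f * X * f'⁻¹ ∈ (slIncl K n).range) {q : ℕ}
    (hq : ∀ a b c d, IsIntegral ℤ ((q : K) * ((f⁻¹).1 a b * f'.1 c d))) (i j : Fin n) :
    IsIntegral ℤ ((q : K) * X.1 i j) := by
  obtain ⟨γ, hγ⟩ := h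
  have : X = f⁻¹ * slIncl K n γ * f' := by rw [hγ]; group
  rw [this, Units.val_mul, Units.val_mul]
  simp only [Matrix.mul_apply, Finset.sum_mul, Finset.mul_sum]
  refine IsIntegral.sum _ fun c _ => IsIntegral.sum _ fun d _ => ?_
  have := (hq i d c j).mul (RingOfIntegers.isIntegral_coe (γ.1 d c))
  convert this using 1
  rw [slIncl_apply]; ring

lemma finite_of_place_le (B : ℝ) : {γ : Matrix.SpecialLinearGroup (Fin n) (𝓞 K) |
    ∀ (w : InfinitePlace K) i j, w ((slIncl K n γ).1 i j) ≤ B}.Finite := by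
  have h1 := Set.Finite.pi' fun _ : Fin n => Set.Finite.pi' fun _ : Fin n =>
    Embeddings.finite_of_norm_le K ℂ B
  refine Set.Finite.of_finite_image (f := fun γ : Matrix.SpecialLinearGroup (Fin n) (𝓞 K) =>
    fun i j => (γ.1 i j : K)) (h1.subset ?_) ?_
  · rintro _ ⟨γ, hγ, rfl⟩ i j
    exact ⟨RingOfIntegers.isIntegral_coe _, (le_iff_le _ _).1 fun w => hγ w i j⟩
  · intro γ _ γ' _ h
    exact Subtype.ext (Matrix.ext fun i j => RingOfIntegers.ext (congrFun (congrFun h i) j))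

lemma exists_upper {α : Type*} [Finite α] (F : α → ℝ) : ∃ B : ℝ, 1 ≤ B ∧ ∀ a, F a ≤ B := by
  obtain ⟨B, hB⟩ := (Set.finite_range F).bddAbove
  exact ⟨max 1 B, le_max_left _ _, fun a => (hB ⟨a, rfl⟩).trans (le_max_right _ _)⟩

lemma exists_entry_bound {α : Type*} [Finite α] (M : α → Matrix (Fin n) (Fin n) K) :
    ∃ B : ℝ, 1 ≤ B ∧ ∀ s (w : InfinitePlace K) i j, w (M s i j) ≤ B := by
  obtain ⟨B, h1, h2⟩ := exists_upper fun x : α × InfinitePlace K × Fin n × Fin n =>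
    x.2.1 (M x.1 x.2.2.1 x.2.2.2)
  exact ⟨B, h1, fun s w i j => h2 (s, w, i, j)⟩

lemma exists_det_bound {α : Type*} [Finite α] (g : α → GL (Fin n) K) :
    ∃ D : ℝ, 1 ≤ D ∧ ∀ s (w : InfinitePlace K), w (g s).1.det ≤ D ∧ 1 ≤ D * w (g s).1.det := by
  obtain ⟨D, h1, h2⟩ := exists_upper fun x : α × InfinitePlace K =>
    max (x.2 (g x.1).1.det) (x.2 (g x.1).1.det)⁻¹
  refine ⟨D, h1, fun s w => ⟨(le_max_left _ _).trans (h2 (s, w)), ?_⟩⟩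
  have h0 : 0 < w (g s).1.det := pos_iff.2 (Matrix.GeneralLinearGroup.det_ne_zero (g s))
  exact (inv_le_iff_one_le_mul₀ h0).1 ((le_max_right _ _).trans (h2 (s, w)))

lemma place_mul_le (w : InfinitePlace K) {P Q : Matrix (Fin n) (Fin n) K} {x y z : Fin n → ℝ}
    {C D : ℝ} (hy : ∀ i, 0 < y i) (hz : ∀ i, 0 < z i)
    (hP : ∀ i j, w (P i j) * y j ≤ C * x i) (hQ : ∀ i j, w (Q i j) * z j ≤ D * y i) (i j : Fin n) :
    w ((P * Q) i j) * z j ≤ n * C * D * x i :=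
  mul_bound w.1 hy hz hP hQ i j

lemma place_mul_le_one (w : InfinitePlace K) {P Q : Matrix (Fin n) (Fin n) K}
    {C D : ℝ} (hP : ∀ i j, w (P i j) ≤ C) (hQ : ∀ i j, w (Q i j) ≤ D) (i j : Fin n) :
    w ((P * Q) i j) ≤ n * C * D := by
  simpa using place_mul_le w (x := 1) (y := 1) (z := 1) (fun _ => one_pos) (fun _ => one_pos)
    (fun i j => by simpa using hP i j) (fun i j => by simpa using hQ i j) i j

lemma finite_locClass {k : ℕ} {a : Fin (k + 1) → ℝ} (ha : ∀ i, 0 < a i) (f : GL (Fin (k + 1)) K)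
    (l : List (GL (Fin (k + 1)) K)) : (Function.support fun γ : Matrix.SpecialLinearGroup _ (𝓞 K) =>
      locClass ha (l.map fun s => f * (slIncl K _ γ * s))).Finite := by
  rcases l with _ | ⟨h₀, l⟩
  · refine Set.finite_empty.subset fun γ hγ => ?_
    exact absurd rfl (coch_bigCup _ _ _ hγ).2
  set l' := h₀ :: l with hl'
  obtain ⟨R, hR1, hR⟩ := exists_upper fun x : Fin (k + 1) × Fin (k + 1) => a x.2 / a x.1
  obtain ⟨C, hC1, hC⟩ := exists_entry_bound fun x : {g // g ∈ l'} × {g // g ∈ l'} =>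
    ((x.1.1)⁻¹ * x.2.1).1
  obtain ⟨D, hD1, hD⟩ := exists_det_bound fun x : {g // g ∈ l'} => f * x.1
  obtain ⟨C', hC'1, hC'⟩ := locClass_bound (K := K) k (C * R) D (one_le_mul_of_one_le_of_one_le hC1
      hR1) hD1
  obtain ⟨q, hq, hqi⟩ := exists_denominator (h₀⁻¹).1 (f⁻¹).1
  obtain ⟨E, hE1, hE⟩ := exists_entry_bound fun x : Bool => if x then (f⁻¹).1 else (h₀⁻¹).1
  obtain ⟨A, hA1, hA⟩ := exists_upper a
  obtain ⟨R', hR'1, hR'⟩ := exists_upper fun i => (a i)⁻¹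
  set B := C' * (q * (C' * A)) * R'
  refine (finite_of_place_le ((k + 1 : ℕ) * ((k + 1 : ℕ) * E * B) * E)).subset fun γ hγ => ?_
  have hcond : ∀ g ∈ l'.map fun s => f * (slIncl K _ γ * s), ∀ g' ∈ l'.map fun s => f * (slIncl K _
      γ * s),
      ∀ (w : InfinitePlace K) i j, w ((g⁻¹ * g').1 i j) * a j ≤ C * R * a i := fun g hg g' hg' w i j
          => by
    obtain ⟨s, hs, rfl⟩ := List.mem_map.1 hg
    obtain ⟨s', hs', rfl⟩ := List.mem_map.1 hg'
    have e : (f * (slIncl K _ γ * s))⁻¹ * (f * (slIncl K _ γ * s')) = s⁻¹ * s' := by group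
    rw [e]
    have h1 := hC (⟨s, hs⟩, ⟨s', hs'⟩) w i j
    have h2 := hR (i, j)
    rw [div_le_iff₀ (ha i)] at h2
    calc _ ≤ C * (R * a i) := mul_le_mul h1 h2 (ha j).le (by linarith)
      _ = _ := by ring
  have hdet : ∀ g ∈ l'.map fun s => f * (slIncl K _ γ * s), ∀ w : InfinitePlace K,
      w g.1.det ≤ D ∧ 1 ≤ D * w g.1.det := fun g hg w => by
    obtain ⟨s, hs, rfl⟩ := List.mem_map.1 hg
    have := hD ⟨s, hs⟩ w
    have e : (f * (slIncl K _ γ * s)).1.det = (f * s).1.det := by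
      rw [Units.val_mul, Units.val_mul, Matrix.det_mul, Matrix.det_mul, det_slIncl, one_mul,
        Units.val_mul, Matrix.det_mul]
    rw [e]; exact this
  obtain ⟨t, ht, hb⟩ := hC' ha _ hcond hdet hγ
  have hm : f * (slIncl K _ γ * h₀) ∈ l'.map fun s => f * (slIncl K _ γ * s) :=
    List.mem_map_of_mem (by simp [hl'])
  have hb := hb _ hm
  set X := f * (slIncl K _ γ * h₀) with hX
  have hX' : f⁻¹ * X * h₀⁻¹ = slIncl K _ γ := by rw [hX]; group
  have hint : ∀ i j, IsIntegral ℤ ((q : K) * (X⁻¹).1 i j) := fun i j => by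
    refine isIntegral_entry (f := h₀) (f' := f⁻¹) ⟨γ⁻¹, ?_⟩ hqi i j
    rw [map_inv, ← hX']; group
  have htB : ∀ j, t j ≤ q * (C' * A) := fun j => by
    obtain ⟨i, hi⟩ : ∃ i, (X⁻¹).1 i j ≠ 0 := by
      by_contra! h0
      exact Matrix.GeneralLinearGroup.det_ne_zero X⁻¹ (Matrix.det_eq_zero_of_column_eq_zero j h0)
    refine le_of_denominator hi hq (hint i j) (ht j).le fun w => ((hb w i j).2).trans ?_
    exact mul_le_mul_of_nonneg_left (hA i) (by linarith)
  have hXB : ∀ (w : InfinitePlace K) i j, w (X.1 i j) ≤ B := fun w i j => by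
    have h1 := (hb w i j).1
    have h2 : w (X.1 i j) ≤ C' * t i * (a j)⁻¹ := by
      rw [← div_eq_mul_inv, le_div_iff₀ (ha j)]; exact h1
    refine h2.trans (mul_le_mul (mul_le_mul_of_nonneg_left (htB i) (by linarith)) (hR' j)
      (inv_nonneg.2 (ha j).le) (by positivity))
  intro w i j
  have h1 := place_mul_le_one w (hE true w) (hXB w)
  have h2 := place_mul_le_one w h1 (hE false w) i j
  rw [← hX']
  exact h2

end Analysis

section Deep

open NumberField NumberField.InfinitePlace

variable {K : Type} [Field K] [NumberField K]

lemma upper_mul_le {k : ℕ} {a : Fin (k + 1) → ℝ} (ha : ∀ i, 0 < a i) (hanti : Antitone a)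
    {b : Matrix (Fin (k + 1)) (Fin (k + 1)) K} (hb : ∀ i j, j < i → b i j = 0) {C : ℝ} (hC : 0 ≤ C)
    (w : InfinitePlace K) (hbC : ∀ i j, w (b i j) ≤ C) (i j : Fin (k + 1)) :
    w (b i j) * a j ≤ C * a i := by
  rcases lt_or_ge j i with h | h
  · rw [hb i j h, map_zero, zero_mul]
    exact mul_nonneg hC (ha i).le
  · exact mul_le_mul (hbC i j) (hanti h) (ha j).le hC

lemma pattern_of_bounds {k : ℕ} {a t : Fin (k + 1) → ℝ} {κ A : ℝ} (hκ : 0 ≤ κ) (hA : κ * κ < A)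
    (ha : ∀ i, 0 < a i) (hstep : ∀ i j, i < j → A * a j ≤ a i) (X : GL (Fin (k + 1)) K)
    (h1 : ∀ p q, X.1 p q ≠ 0 → a q ≤ κ * t p) (h2 : ∀ p q, (X⁻¹).1 q p ≠ 0 → t p ≤ κ * a q) :
    ∃ w : Fin (k + 1) → Fin (k + 1), (∀ p q, X.1 p q ≠ 0 → w p ≤ q) ∧
      (∀ p q, (X⁻¹).1 q p ≠ 0 → q ≤ w p) := by
  have hw : ∀ p, ∃ q, X.1 p q ≠ 0 ∧ (X⁻¹).1 q p ≠ 0 := fun p => by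
    by_contra! h0
    have e : (X.1 * (X⁻¹).1) p p = 1 := by
      rw [← Units.val_mul, mul_inv_cancel, Units.val_one, Matrix.one_apply_eq]
    rw [Matrix.mul_apply, Finset.sum_eq_zero] at e
    · exact zero_ne_one e
    · intro q _
      by_cases hq : X.1 p q = 0
      · rw [hq, zero_mul]
      · rw [h0 q hq, mul_zero]
  choose w hw using hw
  have key : ∀ i j, a i ≤ κ * (κ * a j) → j ≤ i := fun i j h => by
    by_contra! hij
    have := hstep i j hij
    nlinarith [ha j]
  refine ⟨w, fun p q hq => key _ _ ?_, fun p q hq => key _ _ ?_⟩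
  · exact (h1 p q hq).trans (mul_le_mul_of_nonneg_left (h2 p _ (hw p).2) hκ)
  · exact (h1 p _ (hw p).1).trans (mul_le_mul_of_nonneg_left (h2 p q hq) hκ)

lemma upper_borel {n : ℕ} (b : borel K n) (i j : Fin n) (h : j < i) : b.1.1 i j = 0 := by
  exact b.2 i j h

theorem exists_pattern {k : ℕ} {ι : Type} [Finite ι] (f : ι → GL (Fin (k + 1)) K)
    {Z : Set (borel K (k + 1))} (hZ : Z.Finite) :
    ∃ (a : Fin (k + 1) → ℝ) (ha : ∀ i, 0 < a i), ∀ i j γ (l : List (borel K (k + 1))),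
      (∀ b ∈ l, b ∈ Z) →
      locClass ha (l.map fun b => (f i)⁻¹ * (slIncl K _ γ * (f j * b.1))) ≠ 0 →
      ∃ w : Fin (k + 1) → Fin (k + 1),
        (∀ p q, ((f i)⁻¹ * slIncl K _ γ * f j).1 p q ≠ 0 → w p ≤ q) ∧
        (∀ p q, (((f i)⁻¹ * slIncl K _ γ * f j)⁻¹).1 q p ≠ 0 → q ≤ w p) := by
  have := hZ.to_subtype
  obtain ⟨C, hC1, hC⟩ := exists_entry_bound fun x : Z × Z => ((x.1.1)⁻¹ * x.2.1 : borel K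
      (k + 1)).1.1
  obtain ⟨M, hM1, hM⟩ := exists_entry_bound fun x : Z => x.1.1.1
  obtain ⟨M', hM'1, hM'⟩ := exists_entry_bound fun x : Z => (x.1⁻¹).1.1
  obtain ⟨D, hD1, hD⟩ := exists_det_bound fun x : ι × ι × Z => (f x.1)⁻¹ * (f x.2.1 * x.2.2.1.1)
  obtain ⟨C', hC'1, hC'⟩ := locClass_bound (K := K) k C D hC1 hD1
  choose q hq hqi using fun x : ι × ι => exists_denominator ((f x.1)⁻¹).1 (f x.2).1
  obtain ⟨Q, hQ1, hQ⟩ := exists_upper fun x : ι × ι => (q x : ℝ)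
  set κ : ℝ := Q * (((k + 1 : ℕ) : ℝ) * C' * M' + ((k + 1 : ℕ) : ℝ) * M * C') with hκ
  have hκ0 : 0 ≤ κ := by positivity
  set A : ℝ := κ * κ + 1 with hA
  have hA1 : 1 ≤ A := by nlinarith
  have hA0 : 0 < A := by linarith
  set a : Fin (k + 1) → ℝ := fun p => (A ^ (p : ℕ))⁻¹ with haDef
  have ha : ∀ i, 0 < a i := fun i => by positivity
  have hstep : ∀ i j, i < j → A * a j ≤ a i := fun i j hij => by
    have h1 : A ^ ((i : ℕ) + 1) ≤ A ^ (j : ℕ) := pow_le_pow_right₀ hA1 hij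
    simp only [haDef]
    rw [← div_eq_mul_inv, div_le_iff₀ (by positivity), ← div_eq_inv_mul, le_div_iff₀
        (by positivity)]
    rwa [pow_succ'] at h1
  have hanti : Antitone a := fun i j hij => by
    rcases hij.eq_or_lt with rfl | h
    · exact le_rfl
    · exact (le_mul_of_one_le_left (ha j).le hA1).trans (hstep i j h)
  refine ⟨a, ha, fun i j γ l hl hne => ?_⟩
  set X := (f i)⁻¹ * slIncl K _ γ * f j with hX
  have hfX : f i * X * (f j)⁻¹ ∈ (slIncl K (k + 1)).range := ⟨γ, by rw [hX]; group⟩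
  have hfX' : f j * X⁻¹ * (f i)⁻¹ ∈ (slIncl K (k + 1)).range := ⟨γ⁻¹, by rw [map_inv, hX]; group⟩
  obtain ⟨t, ht, hb⟩ := hC' ha _ (by
    intro g hg g' hg' w p r
    obtain ⟨b, hbl, rfl⟩ := List.mem_map.1 hg
    obtain ⟨b', hbl', rfl⟩ := List.mem_map.1 hg'
    have e : ((f i)⁻¹ * (slIncl K _ γ * (f j * b.1)))⁻¹ * ((f i)⁻¹ * (slIncl K _ γ * (f j * b'.1)))
        = (b⁻¹ * b' : borel K (k + 1)).1 := by
      rw [Subgroup.coe_mul, Subgroup.coe_inv]; group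
    rw [e]
    exact upper_mul_le ha hanti (upper_borel _) (by linarith) w
      (fun p r => hC (⟨b, hl b hbl⟩, ⟨b', hl b' hbl'⟩) w p r) p r) (by
    intro g hg w
    obtain ⟨b, hbl, rfl⟩ := List.mem_map.1 hg
    have e : ((f i)⁻¹ * (slIncl K _ γ * (f j * b.1))).1.det = ((f i)⁻¹ * (f j * b.1)).1.det := by
      simp only [Units.val_mul, Matrix.det_mul, det_slIncl, one_mul]
    rw [e]
    exact hD (i, j, ⟨b, hl b hbl⟩) w) hne
  obtain ⟨b, hbl⟩ : ∃ b, b ∈ l := by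
    rcases l with _ | ⟨b, l⟩
    · exact absurd rfl (coch_bigCup _ _ _ hne).2
    · exact ⟨b, List.mem_cons_self⟩
  have hg := hb _ (List.mem_map_of_mem hbl)
  set g := (f i)⁻¹ * (slIncl K _ γ * (f j * b.1)) with hgDef
  have e1 : X = g * (b⁻¹ : borel K (k + 1)).1 := by rw [hX, hgDef, Subgroup.coe_inv]; group
  have e2 : X⁻¹ = b.1 * g⁻¹ := by rw [hX, hgDef]; group
  refine pattern_of_bounds (t := t) hκ0 (lt_add_one _) ha hstep X (fun p r h => ?_) (fun p r h =>
      ?_)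
  · have h1 := le_of_denominator h (hq (i, j)) (isIntegral_entry hfX (hqi (i, j)) p r) (ha r).le
      (t := ((k + 1 : ℕ) : ℝ) * C' * M' * t p) fun w => by
        rw [e1, Units.val_mul]
        exact place_mul_le w ha ha (fun p r => (hg w p r).1)
          (upper_mul_le ha hanti (upper_borel _) (by linarith) w (hM' ⟨b, hl b hbl⟩ w)) p r
    refine h1.trans ((mul_le_mul_of_nonneg_right (hQ (i, j)) (by have := ht p; positivity)).trans
        ?_)
    rw [hκ, mul_assoc Q]
    gcongr
    · exact (ht p).le
    · have : (0 : ℝ) ≤ ((k + 1 : ℕ) : ℝ) * M * C' := by positivity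
      linarith
  · have h1 := le_of_denominator h (hq (j, i)) (isIntegral_entry hfX' (hqi (j, i)) r p) (ht p).le
      (t := ((k + 1 : ℕ) : ℝ) * M * C' * a r) fun w => by
        rw [e2, Units.val_mul]
        exact place_mul_le w ha ht
          (upper_mul_le ha hanti (upper_borel _) (by linarith) w (hM ⟨b, hl b hbl⟩ w))
          (fun p r => (hg w p r).2) r p
    refine h1.trans ((mul_le_mul_of_nonneg_right (hQ (j, i)) (by have := ha r; positivity)).trans
        ?_)
    rw [hκ, mul_assoc Q]
    gcongr
    have : (0 : ℝ) ≤ ((k + 1 : ℕ) : ℝ) * C' * M' := by positivity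
    linarith

end Deep

section Assembly

open NumberField NumberField.InfinitePlace

variable {K : Type} [Field K] [NumberField K] {k : ℕ}

/-- The arithmetic group acts on `GL` by left multiplication. -/
noncomputable instance slAction (n : ℕ) :
    MulAction (Matrix.SpecialLinearGroup (Fin n) (𝓞 K)) (GL (Fin n) K) :=
  MulAction.compHom _ (slIncl K n)

lemma sl_smul_def {n : ℕ} (γ : Matrix.SpecialLinearGroup (Fin n) (𝓞 K)) (s : GL (Fin n) K) :
    γ • s = slIncl K n γ * s := rfl

/-- The sum of all translates under the arithmetic group of the local cocycle at the frame `f`. -/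
noncomputable def avgClass {a : Fin (k + 1) → ℝ} (ha : ∀ i, 0 < a i) (f : GL (Fin (k + 1)) K)
    (l : List (GL (Fin (k + 1)) K)) : ℤ :=
  ∑ᶠ γ : Matrix.SpecialLinearGroup (Fin (k + 1)) (𝓞 K),
    locClass ha (l.map fun s => f⁻¹ * (slIncl K _ γ * s))

variable {a : Fin (k + 1) → ℝ} (ha : ∀ i, 0 < a i)

lemma coch_avgClass (f : GL (Fin (k + 1)) K) :
    Coch (Units.rank K * k + Module.finrank ℚ K * ((k + 1) * k / 2) + 1) (avgClass ha f) := by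
  intro l hl
  obtain ⟨γ, hγ⟩ : ∃ γ : Matrix.SpecialLinearGroup (Fin (k + 1)) (𝓞 K),
      locClass ha (l.map fun s => f⁻¹ * (slIncl K _ γ * s)) ≠ 0 := by
    by_contra! h
    exact hl (finsum_eq_zero_of_forall_eq_zero h)
  obtain ⟨h1, h2⟩ := coch_bigCup _ _ _ hγ
  rw [List.length_map] at h1
  exact ⟨h1, fun h => h2 (by rw [h, List.map_nil])⟩

lemma avgClass_map_smul (f : GL (Fin (k + 1)) K) (t : Matrix.SpecialLinearGroup (Fin (k + 1)) (𝓞 K))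
    (l : List (GL (Fin (k + 1)) K)) : avgClass ha f (l.map (t • ·)) = avgClass ha f l := by
  refine (finsum_congr fun γ => ?_).trans (finsum_comp_equiv (Equiv.mulRight t))
  rw [List.map_map]
  congr 2
  funext s
  simp only [Function.comp_apply, sl_smul_def, Equiv.coe_mulRight, map_mul, mul_assoc]

lemma cobd_avgClass (f : GL (Fin (k + 1)) K) : cobd (avgClass ha f) = 0 := by
  funext l
  refine (cobd_finsum (fun (γ : Matrix.SpecialLinearGroup (Fin (k + 1)) (𝓞 K)) l =>
    locClass ha (l.map fun s => f⁻¹ * (slIncl K _ γ * s)))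
    (fun l => finite_locClass ha f⁻¹ l) l).2.trans (finsum_eq_zero_of_forall_eq_zero fun γ => ?_)
  rw [cobd_comp, locClass, cobd_bigCup]
  rfl

lemma exists_localGroup_incl (f : GL (Fin (k + 1)) K) :
    ∃ e : localGroup f → Matrix.SpecialLinearGroup (Fin (k + 1)) (𝓞 K),
      Function.Injective e ∧ ∀ x, slIncl K _ (e x) = f * x.1.1 * f⁻¹ := by
  choose e he using fun x : localGroup f => mem_localGroup.1 x.2
  refine ⟨e, fun x y h => Subtype.ext (Subtype.ext ?_), he⟩
  have := he x
  rw [h, he y] at this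
  exact (mul_left_cancel (mul_right_cancel this)).symm

lemma locClass_localGroup (f : GL (Fin (k + 1)) K) (x : localGroup f)
    {γ : Matrix.SpecialLinearGroup (Fin (k + 1)) (𝓞 K)} (hγ : slIncl K _ γ = f * x.1.1 * f⁻¹)
    (l : List (borel K (k + 1))) :
    locClass ha (l.map fun b => f⁻¹ * (slIncl K _ γ * (f * b.1))) =
      triClass (Subtype.val : borel K (k + 1) → _) (l.map (x.1 • ·)) := by
  rw [← locClass_of_upper ha (Subtype.val : borel K (k + 1) → _) (fun s => upper_borel s),
      List.map_map]
  congr 2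
  funext b
  rw [hγ, Function.comp_apply, smul_eq_mul, Subgroup.coe_mul]
  group

lemma finite_triClass (f : GL (Fin (k + 1)) K) (l : List (borel K (k + 1))) :
    (Function.support fun x : localGroup f =>
      triClass (Subtype.val : borel K (k + 1) → _) (l.map (x.1 • ·))).Finite := by
  obtain ⟨e, hinj, he⟩ := exists_localGroup_incl f
  have h := finite_locClass (a := 1) (fun _ => one_pos) f⁻¹ (l.map fun b => f * b.1)
  refine (h.preimage hinj.injOn).subset fun x hx => ?_
  rw [Set.mem_preimage, Function.mem_support, List.map_map]
  exact fun h0 => hx ((locClass_localGroup _ f x (he x) l).symm.trans h0)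

lemma avgClass_eq_finsum_triClass (f : GL (Fin (k + 1)) K) (l : List (borel K (k + 1)))
    (h : ∀ γ, locClass ha (l.map fun b => f⁻¹ * (slIncl K _ γ * (f * b.1))) ≠ 0 →
      ∀ p q, q < p → (f⁻¹ * slIncl K _ γ * f).1 p q = 0) :
    avgClass ha f (l.map fun b => f * b.1) =
      ∑ᶠ x : localGroup f, triClass (Subtype.val : borel K (k + 1) → _) (l.map (x.1 • ·)) := by
  obtain ⟨e, hinj, he⟩ := exists_localGroup_incl f
  have h1 : ∀ γ, locClass ha ((l.map fun b => f * b.1).map fun s => f⁻¹ * (slIncl K _ γ * s)) =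
      locClass ha (l.map fun b => f⁻¹ * (slIncl K _ γ * (f * b.1))) := fun γ => by
    rw [List.map_map]; rfl
  rw [avgClass, finsum_congr h1, ← finsum_congr fun x => locClass_localGroup ha f x (he x) l,
    ← finsum_mem_range (f := fun γ => locClass ha (l.map fun b => f⁻¹ * (slIncl K _ γ * (f * b.1))))
        hinj]
  rw [← finsum_mem_univ]
  refine finsum_mem_inter_support_eq' _ _ _ fun γ hγ => ⟨fun _ => ?_, fun _ => trivial⟩
  let x : borel K (k + 1) := ⟨f⁻¹ * slIncl K _ γ * f, fun p q hpq => h γ hγ p q hpq⟩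
  have hx : f * (f⁻¹ * slIncl K _ γ * f) * f⁻¹ = slIncl K _ γ := by group
  exact ⟨⟨x, mem_localGroup.2 ⟨γ, hx.symm⟩⟩, slIncl_injective ((he _).trans hx)⟩

theorem card_le_rank_cohomology [Fintype {c : ClassGroup (𝓞 K) // c ≠ 1}] (hk : 1 ≤ k) {m : ℕ}
    (hm : m + 1 = Units.rank K * k + Module.finrank ℚ K * ((k + 1) * k / 2)) :
    (Fintype.card (Fin k → {c : ClassGroup (𝓞 K) // c ≠ 1}) : Cardinal) ≤
      Module.rank ℚ (groupCohomology
        (Rep.trivial ℚ (Matrix.SpecialLinearGroup (Fin (k + 1)) (𝓞 K)) ℚ) (m + 1)) := by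
  classical
  obtain ⟨f, hf⟩ := exists_frames K k
  choose z hz0 hz using fun i => exists_chain_localGroup hk (f i)
  obtain ⟨a, ha, hpat⟩ := exists_pattern f (Z := {b | ∃ i, ∃ l ∈ (z i).support, b ∈ l}) (by
    have : {b | ∃ i, ∃ l ∈ (z i).support, b ∈ l} =
        ⋃ i, ⋃ l ∈ (z i).support, {b | b ∈ l} := by ext b; simp
    rw [this]
    exact Set.finite_iUnion fun i => (z i).support.finite_toSet.biUnion fun l _ => l.finite_toSet)
  have hrange : ∀ i j γ, f i * ((f i)⁻¹ * slIncl K _ γ * f j) * (f j)⁻¹ ∈ (slIncl K (k + 1)).range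
      :=
    fun i j γ => ⟨γ, by group⟩
  have hdiag : ∀ j, ∀ l ∈ (z j).support, avgClass ha (f j) (l.map fun b => f j * b.1) =
      ∑ᶠ x : localGroup (f j), triClass (Subtype.val : borel K (k + 1) → _) (l.map (x.1 • ·)) :=
    fun j l hl => avgClass_eq_finsum_triClass ha (f j) l fun γ hγ p q hpq => by
      obtain ⟨w, h1, h2⟩ := hpat j j γ l (fun b hb => ⟨j, l, hl, hb⟩) hγ
      have := (hf j j _ w (hrange j j γ) h1 h2).2
      by_contra h0
      exact absurd (h1 p q h0) (by rw [this]; exact not_le.2 hpq)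
  have hoff : ∀ i j, i ≠ j → ∀ l ∈ (z j).support, avgClass ha (f i) (l.map fun b => f j * b.1) = 0
      :=
    fun i j hij l hl => finsum_eq_zero_of_forall_eq_zero fun γ => by
      by_contra h0
      rw [List.map_map] at h0
      obtain ⟨w, h1, h2⟩ := hpat i j γ l (fun b hb => ⟨j, l, hl, hb⟩) h0
      exact hij (hf i j _ w (hrange i j γ) h1 h2).1
  refine card_le_rank_of_free (S := GL (Fin (k + 1)) K) (fun γ s h => ?_)
    (fun i l => (Int.castAddHom ℚ) (avgClass ha (f i) l)) (fun i => ?_) (fun i => ?_) (fun i => ?_)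
        ?_
  · refine slIncl_injective (mul_right_cancel (b := s) ?_)
    rw [map_one, one_mul]
    exact h
  · have := (coch_avgClass ha (f i)).map (Int.castAddHom ℚ)
    rwa [← hm] at this
  · intro t _
    rw [mem_stab]
    funext l
    exact congrArg _ (avgClass_map_smul ha (f i) t l)
  · funext l
    rw [cobd_map, cobd_avgClass]
    rfl
  · intro A β _ hβ h
    funext j
    have hval : ∀ l ∈ (z j).support, cobd (fun l => β (l.map fun b : borel K (k + 1) => f j * b.1))
        l =
        A j * ((∑ᶠ x : localGroup (f j),
          triClass (Subtype.val : borel K (k + 1) → _) (l.map (x.1 • ·)) : ℤ) : ℚ) := fun l hl => by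
      rw [cobd_comp, ← h, Finset.sum_apply, Finset.sum_eq_single j, ← hdiag j l hl]
      · rfl
      · intro i _ hij
        rw [Pi.smul_apply, hoff i j hij l hl, map_zero, smul_zero]
      · exact fun h => absurd (Finset.mem_univ j) h
    have h0 := hz0 j (fun l => β (l.map fun b : borel K (k + 1) => f j * b.1)) (fun x hx => by
      rw [mem_stab]
      funext l
      obtain ⟨γ, hγ⟩ := mem_localGroup.1 hx
      have h1 := congrFun (mem_stab.1 (hβ (Subgroup.mem_top γ))) (l.map fun b => f j * b.1)
      refine Eq.trans ?_ h1
      simp only [tr, List.map_map]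
      congr 2
      funext b
      simp only [Function.comp_apply, sl_smul_def, hγ, smul_eq_mul, Subgroup.coe_mul]
      group)
    rw [Finsupp.linearCombination_apply, Finsupp.sum, Finset.sum_congr rfl
      (fun l hl => by rw [hval l hl, smul_eq_mul, mul_left_comm]), ← Finset.mul_sum] at h0
    refine (mul_eq_zero.1 h0).resolve_right fun h1 => ?_
    refine hz j (fun l _ => finite_triClass (f j) l) ?_
    rw [Finsupp.linearCombination_apply, Finsupp.sum]
    simpa only [smul_eq_mul] using h1

end Assembly

section Degree

open NumberField NumberField.InfinitePlace

variable (K : Type) [Field K] [NumberField K]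

lemma vcd_eq {k : ℕ} :
    nrRealPlaces K * ((k + 1) * (k + 1 + 1) / 2 - 1) + nrComplexPlaces K * ((k + 1) ^ 2 - 1) - k =
      Units.rank K * k + Module.finrank ℚ K * ((k + 1) * k / 2) := by
  have h1 := card_add_two_mul_card_eq_rank K
  have h2 : Fintype.card (InfinitePlace K) = nrRealPlaces K + nrComplexPlaces K :=
    card_eq_nrRealPlaces_add_nrComplexPlaces K
  have h3 : 0 < Fintype.card (InfinitePlace K) := Fintype.card_pos
  obtain ⟨r, hr⟩ : ∃ r, Fintype.card (InfinitePlace K) = r + 1 := ⟨_, (Nat.succ_pred_eq_of_pos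
      h3).symm⟩
  have hrank : Units.rank K = r := by rw [Units.rank, hr, Nat.add_sub_cancel]
  obtain ⟨T, hT⟩ : ∃ T, (k + 1) * k = 2 * T := (mul_comm k (k + 1) ▸ Nat.even_mul_succ_self
      k).two_dvd
  have e1 : (k + 1) * (k + 1 + 1) / 2 - 1 = T + k := by
    rw [show (k + 1) * (k + 1 + 1) = 2 * (T + k + 1) by linarith, Nat.mul_div_cancel_left _ two_pos,
      Nat.add_sub_cancel]
  have e2 : (k + 1) ^ 2 - 1 = 2 * T + k := by
    rw [show (k + 1) ^ 2 = 2 * T + k + 1 by linarith, Nat.add_sub_cancel]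
  rw [e1, e2, hT, Nat.mul_div_cancel_left _ two_pos, hrank, ← h1]
  refine Nat.sub_eq_of_eq_add ?_
  have h4 : nrRealPlaces K * k + nrComplexPlaces K * k = r * k + k := by
    rw [← add_mul, ← h2, hr, add_mul, one_mul]
  linarith

end Degree

end ChurchFarbPutman

open NumberField NumberField.InfinitePlace

/-- **Church–Farb–Putman.** Let `K` be a number field with class number `h` and let
`d = r₁·(n(n+1)/2 − 1) + r₂·(n² − 1) − (n − 1)` be the virtual cohomological dimension of
`SL_n(𝓞_K)` for `n ≥ 2`. Then `H^d(SL_n(𝓞_K); ℚ)` has dimension at least `(h − 1)^(n−1)`;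
in particular, if `𝓞_K` is not a PID then this cohomology group is nonzero. -/
theorem sln_ringOfIntegers_top_cohomology_rank_lower_bound
    (K : Type) [Field K] [NumberField K] (n : ℕ) (hn : 2 ≤ n)
    (h : ℕ) (hh : h = Fintype.card (ClassGroup (RingOfIntegers K)))
    (d : ℕ)
    (hd : d = nrRealPlaces K * (n * (n + 1) / 2 - 1) + nrComplexPlaces K * (n ^ 2 - 1)
      - (n - 1)) :
    (((h - 1) ^ (n - 1) : ℕ) : Cardinal) ≤
        Module.rank ℚ
          (groupCohomology
            (Rep.trivial ℚ (Matrix.SpecialLinearGroup (Fin n) (RingOfIntegers K)) ℚ) d) ∧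
      (¬ IsPrincipalIdealRing (RingOfIntegers K) →
        Nontrivial
          (groupCohomology
            (Rep.trivial ℚ (Matrix.SpecialLinearGroup (Fin n) (RingOfIntegers K)) ℚ)
            d)) := by
  classical
  obtain ⟨k, rfl⟩ : ∃ k, n = k + 1 := ⟨n - 1, by omega⟩
  have hk : 1 ≤ k := by omega
  rw [Nat.add_sub_cancel, ChurchFarbPutman.vcd_eq] at hd
  have hpos : 0 < d := by
    have h1 : 0 < Module.finrank ℚ K := Module.finrank_pos
    have h2 : 0 < (k + 1) * k / 2 := Nat.div_pos (by nlinarith) two_pos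
    rw [hd]
    positivity
  obtain ⟨m, rfl⟩ : ∃ m, d = m + 1 := ⟨d - 1, by omega⟩
  have hrank := ChurchFarbPutman.card_le_rank_cohomology hk hd
  rw [Fintype.card_fun, Fintype.card_fin, Fintype.card_subtype_compl, Fintype.card_subtype_eq, ← hh]
      at hrank
  rw [Nat.add_sub_cancel]
  refine ⟨hrank, fun hpid => ?_⟩
  have h1 : h ≠ 1 := fun h1 => hpid (card_classGroup_eq_one_iff.1 (hh.symm.trans h1))
  have h0 : 0 < h := hh ▸ Fintype.card_pos
  refine rank_pos_iff_nontrivial.1 (lt_of_lt_of_le ?_ hrank)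
  exact Nat.cast_pos.2 (Nat.pow_pos (by omega))
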